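/- arXiv:1711.11176 — 4 statements merged into one kernel-verified Lean document; each statement's English description precedes it below -/
import Mathlib

section
/- Let G be a finite connected simple graph and let i and j be distinct edges of G. Let t denote the number of spanning trees of G, t_i the number of spanning trees containing i, t_j the number containing j, and t_{ij} the number containing both i and j. Then t_i · t_j ≥ t · t_{ij}. -/
open SimpleGraph

section LinearAlgebra

open Matrix
open scoped Nat

variable {n ι R : Type*} [Fintype n] [DecidableEq n]

theorem det_sum_vecMulVec_eq_sum_piFinset [CommRing R] (s : Finset ι) (b : ι → n → R) :
    (∑ e ∈ s, vecMulVec (b e) (b e)).det =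
      ∑ f ∈ Fintype.piFinset (fun _ : n => s),
        (∏ k, b (f k) k) * (of fun k => b (f k)).det := by
  have h : (∑ e ∈ s, vecMulVec (b e) (b e)) = fun k => ∑ e ∈ s, b e k • b e := by
    ext k l
    simp [Matrix.sum_apply, vecMulVec_apply]
  rw [h]
  have h2 := (detRowAlternating (n := n) (R := R)).toMultilinearMap.map_sum_finset
    (fun k e => b e k • b e) (fun _ => s)
  refine h2.trans (Finset.sum_congr rfl fun f _ => ?_)
  exact (detRowAlternating (n := n) (R := R)).toMultilinearMap.map_smul_univ
    (fun k => b (f k) k) (fun k => b (f k))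

/-- A form of the Cauchy–Binet formula for Gram-type matrices. -/
theorem factorial_mul_det_sum_vecMulVec [CommRing R] (s : Finset ι) (b : ι → n → R) :
    ((Fintype.card n)! : R) * (∑ e ∈ s, vecMulVec (b e) (b e)).det =
      ∑ f ∈ Fintype.piFinset (fun _ : n => s), (of fun k => b (f k)).det ^ 2 := by
  have h (σ : Equiv.Perm n) : (∑ e ∈ s, vecMulVec (b e) (b e)).det =
      ∑ f ∈ Fintype.piFinset (fun _ : n => s),
        ((Equiv.Perm.sign σ : ℤ) : R) * (∏ k, b (f (σ k)) k) * (of fun k => b (f k)).det := by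
    rw [det_sum_vecMulVec_eq_sum_piFinset]
    refine Finset.sum_bij' (fun f _ => f ∘ σ.symm) (fun f _ => f ∘ σ) ?_ ?_ ?_ ?_ ?_
    · intro f hf
      simp only [Fintype.mem_piFinset] at hf ⊢
      exact fun k => hf _
    · intro f hf
      simp only [Fintype.mem_piFinset] at hf ⊢
      exact fun k => hf _
    · intro f _
      ext k
      simp
    · intro f _
      ext k
      simp
    · intro f _
      have hp := det_permute σ (of fun k => b ((f ∘ σ.symm) k))
      have hs : (of fun k => b ((f ∘ σ.symm) k)).submatrix σ id = of fun k => b (f k) := by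
        ext k l
        simp
      rw [hs] at hp
      rw [hp]
      simp only [Function.comp_apply, Equiv.symm_apply_apply]
      ring
  have hcard : ((Fintype.card n)! : R) * (∑ e ∈ s, vecMulVec (b e) (b e)).det =
      ∑ _σ : Equiv.Perm n, (∑ e ∈ s, vecMulVec (b e) (b e)).det := by
    simp [Finset.sum_const, Fintype.card_perm]
  rw [hcard, Finset.sum_congr rfl fun σ _ => h σ, Finset.sum_comm]
  refine Finset.sum_congr rfl fun f _ => ?_
  rw [← Finset.sum_mul, sq]
  congr 1
  rw [det_apply']
  rfl

theorem det_sub_vecMulVec_sub_vecMulVec {K : Type*} [Field K] (A : Matrix n n K)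
    (hA : A.det ≠ 0) (u v : n → K) :
    (A - vecMulVec u u - vecMulVec v v).det =
      A.det * ((1 - u ⬝ᵥ A⁻¹ *ᵥ u) * (1 - v ⬝ᵥ A⁻¹ *ᵥ v) -
        (u ⬝ᵥ A⁻¹ *ᵥ v) * (v ⬝ᵥ A⁻¹ *ᵥ u)) := by
  let U : Matrix (Fin 2) n K := of ![u, v]
  have hU : A - vecMulVec u u - vecMulVec v v = A * (1 - (A⁻¹ * Uᵀ) * U) := by
    rw [Matrix.mul_sub, Matrix.mul_one, ← Matrix.mul_assoc, ← Matrix.mul_assoc,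
      Matrix.mul_nonsing_inv _ (isUnit_iff_ne_zero.mpr hA), Matrix.one_mul, sub_sub]
    congr 1
    ext k l
    simp [U, Matrix.mul_apply, vecMulVec_apply]
  have hent (x y : Fin 2) : (U * (A⁻¹ * Uᵀ)) x y = U x ⬝ᵥ A⁻¹ *ᵥ U y := rfl
  rw [hU, det_mul, det_one_sub_mul_comm, det_fin_two]
  have hU0 : U 0 = u := rfl
  have hU1 : U 1 = v := rfl
  simp [hent, hU0, hU1]

theorem det_sub_vecMulVec {K : Type*} [Field K] (A : Matrix n n K)
    (hA : A.det ≠ 0) (u : n → K) :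
    (A - vecMulVec u u).det = A.det * (1 - u ⬝ᵥ A⁻¹ *ᵥ u) := by
  simpa using det_sub_vecMulVec_sub_vecMulVec A hA u 0

theorem det_mul_det_sub_le {K : Type*} [Field K] [LinearOrder K] [IsStrictOrderedRing K]
    (A : Matrix n n K) (hsymm : A.IsSymm) (hA : A.det ≠ 0) (u v : n → K) :
    A.det * (A - vecMulVec u u - vecMulVec v v).det ≤
      (A - vecMulVec u u).det * (A - vecMulVec v v).det := by
  have hcomm : v ⬝ᵥ A⁻¹ *ᵥ u = u ⬝ᵥ A⁻¹ *ᵥ v := by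
    rw [Matrix.dotProduct_mulVec, ← Matrix.mulVec_transpose, Matrix.transpose_nonsing_inv,
      hsymm.eq, dotProduct_comm]
  rw [det_sub_vecMulVec_sub_vecMulVec A hA, det_sub_vecMulVec A hA, det_sub_vecMulVec A hA, hcomm]
  linear_combination sq_nonneg (A.det * (u ⬝ᵥ A⁻¹ *ᵥ v))

end LinearAlgebra

theorem Set.range_coe_equiv {α β : Type*} {T : Set β} (e : α ≃ T) :
    Set.range (fun k => (e k).1) = T :=
  (e.surjective.range_comp Subtype.val).trans Subtype.range_coe

namespace SimpleGraph

open Matrix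
open scoped Nat

variable {V : Type*} [DecidableEq V] (r : V)

/-- The indicator of `v`, restricted to the vertices other than the root `r`. -/
def rootedIndicator (v : V) (w : {w : V // w ≠ r}) : ℤ := if w.1 = v then 1 else 0

/-- The signed incidence vector of an edge (arbitrarily oriented), with the root entry removed. -/
noncomputable def rootedIncidence (e : Sym2 V) : {w : V // w ≠ r} → ℤ :=
  rootedIndicator r (Quot.out e).1 - rootedIndicator r (Quot.out e).2

theorem exists_rootedIncidence_eq (e : Sym2 V) :
    ∃ a b, e = s(a, b) ∧ rootedIncidence r e = rootedIndicator r a - rootedIndicator r b :=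
  ⟨_, _, (Quot.out_eq e).symm, rfl⟩

variable [Fintype V]

theorem rootedIndicator_dotProduct (x : V → ℤ) (hx : x r = 0) (v : V) :
    rootedIndicator r v ⬝ᵥ (fun w => x w.1) = x v := by
  by_cases hv : v = r
  · subst hv
    rw [hx]
    refine Finset.sum_eq_zero fun w _ => ?_
    simp [rootedIndicator, w.2]
  · rw [dotProduct, Finset.sum_eq_single ⟨v, hv⟩]
    · simp [rootedIndicator]
    · intro w _ hw
      have : w.1 ≠ v := fun h => hw (Subtype.ext h)
      simp [rootedIndicator, this]
    · simp

theorem det_rootedIncidence_eq_zero (f : {w : V // w ≠ r} → Sym2 V)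
    (hf : ¬ (fromEdgeSet (Set.range f)).Connected) :
    (of fun k => rootedIncidence r (f k)).det = 0 := by
  classical
  obtain ⟨u, hu⟩ : ∃ u, ¬ (fromEdgeSet (Set.range f)).Reachable r u := by
    by_contra! h
    exact hf ((connected_iff_exists_forall_reachable _).2 ⟨r, h⟩)
  let x : V → ℤ := fun w => if (fromEdgeSet (Set.range f)).Reachable r w then 0 else 1
  have hxr : x r = 0 := by simp [x]
  rw [← exists_mulVec_eq_zero_iff]
  refine ⟨fun w => x w.1, fun h => ?_, ?_⟩
  · have hur : u ≠ r := by
      intro h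
      rw [h] at hu
      exact hu (Reachable.refl _)
    have := congrFun h ⟨u, hur⟩
    simp [x, hu] at this
  · ext k
    obtain ⟨a, b, hab, hinc⟩ := exists_rootedIncidence_eq r (f k)
    change rootedIncidence r (f k) ⬝ᵥ (fun w => x w.1) = 0
    rw [hinc, sub_dotProduct, rootedIndicator_dotProduct r x hxr,
      rootedIndicator_dotProduct r x hxr, sub_eq_zero]
    by_cases hne : a = b
    · rw [hne]
    · have hadj : (fromEdgeSet (Set.range f)).Adj a b :=
        (fromEdgeSet_adj _).2 ⟨⟨k, hab⟩, hne⟩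
      have : (fromEdgeSet (Set.range f)).Reachable r a ↔
          (fromEdgeSet (Set.range f)).Reachable r b :=
        ⟨fun h => h.trans hadj.reachable, fun h => h.trans hadj.symm.reachable⟩
      simp only [x, this]

theorem isUnit_det_rootedIncidence (f : {w : V // w ≠ r} → Sym2 V)
    (hf : (fromEdgeSet (Set.range f)).Connected) :
    IsUnit (of fun k => rootedIncidence r (f k)).det := by
  let M : Matrix {w : V // w ≠ r} {w : V // w ≠ r} ℤ := of fun k => rootedIncidence r (f k)
  let S : Submodule ℤ ({w : V // w ≠ r} → ℤ) := LinearMap.range M.vecMulLinear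
  have hrow (k) : rootedIncidence r (f k) ∈ S :=
    ⟨Pi.single k 1, by simp [M]⟩
  have hadj {a b : V} (h : (fromEdgeSet (Set.range f)).Adj a b) :
      rootedIndicator r a ∈ S → rootedIndicator r b ∈ S := by
    intro ha
    obtain ⟨⟨k, hk⟩, -⟩ := (fromEdgeSet_adj _).1 h
    obtain ⟨c, d, hcd, hinc⟩ := exists_rootedIncidence_eq r (f k)
    have hkS := hrow k
    rw [hinc] at hkS
    rw [hk, Sym2.eq_iff] at hcd
    rcases hcd with ⟨rfl, rfl⟩ | ⟨rfl, rfl⟩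
    · simpa using S.sub_mem ha hkS
    · simpa using S.add_mem hkS ha
  have hind (v : V) : rootedIndicator r v ∈ S := by
    have hr := (reachable_iff_reflTransGen r v).1 (hf.preconnected r v)
    induction hr with
    | refl =>
      have : rootedIndicator r r = 0 := by
        ext w
        simp [rootedIndicator, w.2]
      rw [this]
      exact S.zero_mem
    | tail _ h ih => exact hadj h ih
  have hsurj : Function.Surjective M.vecMul := by
    intro y
    have hy : y = ∑ w, y w • rootedIndicator r w.1 := by
      ext w
      simp [Finset.sum_apply, rootedIndicator, Subtype.val_inj]
    have : y ∈ S := by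
      rw [hy]
      exact S.sum_mem fun w _ => S.smul_mem _ (hind w.1)
    exact this
  exact (isUnit_iff_isUnit_det M).1 (vecMul_surjective_iff_isUnit.1 hsurj)

open Classical in
theorem det_rootedIncidence_sq (f : {w : V // w ≠ r} → Sym2 V) :
    (of fun k => rootedIncidence r (f k)).det ^ 2 =
      if (fromEdgeSet (Set.range f)).Connected then 1 else 0 := by
  split_ifs with h
  · exact Int.isUnit_sq (isUnit_det_rootedIncidence r f h)
  · simp [det_rootedIncidence_eq_zero r f h]

/-- The number of trees spanning `V` with edge set contained in `S`. -/
noncomputable def spanningTreeCount (S : Set (Sym2 V)) : ℕ :=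
  {T : Set (Sym2 V) | T ⊆ S ∧ (fromEdgeSet T).IsTree}.ncard

theorem isTree_fromEdgeSet_iff {T : Set (Sym2 V)} (hT : ∀ e ∈ T, ¬ e.IsDiag) :
    (fromEdgeSet T).IsTree ↔
      (fromEdgeSet T).Connected ∧ Nat.card T = Nat.card {w : V // w ≠ r} := by
  have hE : (fromEdgeSet T).edgeSet = T := by
    rw [edgeSet_fromEdgeSet]
    exact sdiff_eq_left.2 (Set.disjoint_left.2 fun e he h => hT e he (by simpa using h))
  have hV : Nat.card V = Nat.card {w : V // w ≠ r} + 1 := by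
    have : 0 < Fintype.card V := Fintype.card_pos_iff.2 ⟨r⟩
    simp [Fintype.card_subtype_compl]
    omega
  rw [isTree_iff_connected_and_card, hE, hV, add_left_inj]

theorem card_connected_range_eq (S : Set (Sym2 V)) (hS : ∀ e ∈ S, ¬ e.IsDiag) :
    Nat.card {f : {w : V // w ≠ r} → Sym2 V //
      (∀ k, f k ∈ S) ∧ (fromEdgeSet (Set.range f)).Connected} =
      (Fintype.card {w : V // w ≠ r})! * spanningTreeCount S := by
  classical
  let 𝒯 := {T : Set (Sym2 V) | T ⊆ S ∧ (fromEdgeSet T).IsTree}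
  have hcard (T : 𝒯) : Nat.card T.1 = Nat.card {w : V // w ≠ r} :=
    ((isTree_fromEdgeSet_iff r fun e he => hS e (T.2.1 he)).1 T.2.2).2
  let g : (Σ T : 𝒯, ({w : V // w ≠ r} ≃ T.1)) → {f : {w : V // w ≠ r} → Sym2 V //
      (∀ k, f k ∈ S) ∧ (fromEdgeSet (Set.range f)).Connected} := fun p =>
    ⟨fun k => (p.2 k).1, fun k => p.1.2.1 (p.2 k).2, by
      rw [Set.range_coe_equiv p.2]
      exact p.1.2.2.connected⟩
  have hg : Function.Bijective g := by
    constructor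
    · rintro ⟨⟨T, hT⟩, e⟩ ⟨⟨T', hT'⟩, e'⟩ h
      have hfun : (fun k => (e k).1) = fun k => (e' k).1 := congrArg Subtype.val h
      have hTT : T = T' := by
        have h1 : Set.range (fun k => (e k).1) = T := Set.range_coe_equiv e
        have h2 : Set.range (fun k => (e' k).1) = T' := Set.range_coe_equiv e'
        rw [← h1, ← h2, hfun]
      subst hTT
      have : e = e' := Equiv.ext fun k => Subtype.ext (congrFun hfun k)
      rw [this]
    · rintro ⟨f, hfS, hf⟩
      have hdet := (isUnit_det_rootedIncidence r f hf).ne_zero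
      have hinj : Function.Injective f := by
        intro k l hkl
        by_contra hne
        refine hdet (det_zero_of_row_eq hne ?_)
        ext w
        simp [hkl]
      refine ⟨⟨⟨Set.range f, ?_, ?_⟩, Equiv.ofInjective f hinj⟩, rfl⟩
      · rintro _ ⟨k, rfl⟩
        exact hfS k
      · refine (isTree_fromEdgeSet_iff r ?_).2
          ⟨hf, (Nat.card_congr (Equiv.ofInjective f hinj)).symm⟩
        rintro _ ⟨k, rfl⟩
        exact hS _ (hfS k)
  rw [← Nat.card_eq_of_bijective g hg, Nat.card_sigma]
  have hfib (T : 𝒯) : Nat.card ({w : V // w ≠ r} ≃ T.1) = (Fintype.card {w : V // w ≠ r})! := by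
    rw [Nat.card_eq_fintype_card]
    exact Fintype.card_equiv (Finite.card_eq.1 (hcard T).symm).some
  simp only [hfib, Finset.sum_const, smul_eq_mul, Finset.card_univ]
  rw [mul_comm, spanningTreeCount, ← Nat.card_coe_set_eq, Nat.card_eq_fintype_card]

/-- Kirchhoff's matrix-tree theorem. -/
theorem det_sum_vecMulVec_rootedIncidence (F : Finset (Sym2 V)) (hF : ∀ e ∈ F, ¬ e.IsDiag) :
    (∑ e ∈ F, vecMulVec (rootedIncidence r e) (rootedIncidence r e)).det =
      (spanningTreeCount (F : Set (Sym2 V)) : ℤ) := by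
  classical
  have h := factorial_mul_det_sum_vecMulVec F (rootedIncidence r)
  have hc := card_connected_range_eq r (F : Set (Sym2 V)) (by simpa using hF)
  rw [Finset.sum_congr rfl fun f _ => det_rootedIncidence_sq r f, Finset.sum_boole] at h
  have hfil : (((Fintype.piFinset fun _ : {w : V // w ≠ r} => F).filter
      fun f => (fromEdgeSet (Set.range f)).Connected).card) =
      Nat.card {f : {w : V // w ≠ r} → Sym2 V //
        (∀ k, f k ∈ (F : Set (Sym2 V))) ∧ (fromEdgeSet (Set.range f)).Connected} := by
    rw [Nat.card_eq_fintype_card, Fintype.card_subtype]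
    congr 1
    ext f
    simp
  rw [hfil, hc] at h
  push_cast at h
  exact mul_left_cancel₀ (by exact_mod_cast Nat.factorial_ne_zero _) h

end SimpleGraph

theorem Set.ncard_sep_add_ncard_sep_not {α : Type*} [Finite α] (S : Set α) (p : α → Prop) :
    {x | x ∈ S ∧ p x}.ncard + {x | x ∈ S ∧ ¬ p x}.ncard = S.ncard :=
  Set.ncard_inter_add_ncard_sdiff_eq_ncard S {x | p x} (Set.toFinite _)

/-- in a finite connected simple graph `G`, for distinct edges `i ≠ j`, with
`t`, `tᵢ`, `tⱼ`, `tᵢⱼ` the numbers of spanning trees of `G` (containing `i`, resp. `j`,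
resp. both), one has `tᵢ ⬝ tⱼ ≥ t ⬝ tᵢⱼ`. Here a spanning tree is a set `T` of edges of `G`
such that the graph on the vertices of `G` with edge set `T` is connected and acyclic. -/
theorem spanning_tree_negative_correlation {V : Type*} [Fintype V]
    (G : SimpleGraph V) (hG : G.Connected)
    (i j : Sym2 V) (hi : i ∈ G.edgeSet) (hj : j ∈ G.edgeSet) (hij : i ≠ j)
    (t ti tj tij : ℕ)
    (ht : t = Nat.card {T : Set (Sym2 V) //
      T ⊆ G.edgeSet ∧ (SimpleGraph.fromEdgeSet T).IsTree})
    (hti : ti = Nat.card {T : Set (Sym2 V) //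
      T ⊆ G.edgeSet ∧ (SimpleGraph.fromEdgeSet T).IsTree ∧ i ∈ T})
    (htj : tj = Nat.card {T : Set (Sym2 V) //
      T ⊆ G.edgeSet ∧ (SimpleGraph.fromEdgeSet T).IsTree ∧ j ∈ T})
    (htij : tij = Nat.card {T : Set (Sym2 V) //
      T ⊆ G.edgeSet ∧ (SimpleGraph.fromEdgeSet T).IsTree ∧ i ∈ T ∧ j ∈ T}) :
    t * tij ≤ ti * tj := by
    classical
  obtain ⟨r⟩ := hG.nonempty
  have hcard (p : Set (Sym2 V) → Prop) : Nat.card {T // p T} = {T | p T}.ncard :=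
    Nat.card_coe_set_eq _
  rw [hcard] at ht hti htj htij
  have hsub (k : Sym2 V) (S T : Set (Sym2 V)) : T ⊆ S \ {k} ↔ T ⊆ S ∧ k ∉ T := by
    rw [Set.subset_sdiff, Set.disjoint_singleton_right]
  have hsplit (k : Sym2 V) (S : Set (Sym2 V)) :
      {T : Set (Sym2 V) | T ⊆ S ∧ (fromEdgeSet T).IsTree ∧ k ∈ T}.ncard +
        spanningTreeCount (S \ {k}) = spanningTreeCount S := by
    rw [spanningTreeCount, spanningTreeCount, ← Set.ncard_sep_add_ncard_sep_not
      {T : Set (Sym2 V) | T ⊆ S ∧ (fromEdgeSet T).IsTree} (fun T => k ∈ T)]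
    congr 2 <;> ext T <;> simp only [Set.mem_ofPred_eq, hsub] <;> tauto
  have e1 := hsplit i G.edgeSet
  have e2 := hsplit j G.edgeSet
  have e3 := hsplit i (G.edgeSet \ {j})
  have e4 : {T : Set (Sym2 V) | T ⊆ G.edgeSet ∧ (fromEdgeSet T).IsTree ∧ i ∈ T ∧ j ∈ T}.ncard +
      {T : Set (Sym2 V) | T ⊆ G.edgeSet \ {j} ∧ (fromEdgeSet T).IsTree ∧ i ∈ T}.ncard =
      {T : Set (Sym2 V) | T ⊆ G.edgeSet ∧ (fromEdgeSet T).IsTree ∧ i ∈ T}.ncard := by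
    rw [← Set.ncard_sep_add_ncard_sep_not
      {T : Set (Sym2 V) | T ⊆ G.edgeSet ∧ (fromEdgeSet T).IsTree ∧ i ∈ T} (fun T => j ∈ T)]
    congr 2 <;> ext T <;> simp only [Set.mem_ofPred_eq, hsub] <;> tauto
  change t = spanningTreeCount G.edgeSet at ht
  rw [← hti, ← ht] at e1
  rw [← htj, ← ht] at e2
  rw [← htij, ← hti] at e4
  rcases Nat.eq_zero_or_pos t with h0 | hpos
  · simp [h0]
  let b : Sym2 V → {w : V // w ≠ r} → ℚ := fun e w => (rootedIncidence r e w : ℚ)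
  let L : Finset (Sym2 V) → Matrix {w : V // w ≠ r} {w : V // w ≠ r} ℚ :=
    fun F => ∑ e ∈ F, Matrix.vecMulVec (b e) (b e)
  have hdet (F : Finset (Sym2 V)) (hF : ↑F ⊆ G.edgeSet) :
      (L F).det = (spanningTreeCount (F : Set (Sym2 V)) : ℚ) := by
    have h := congrArg (Int.castRingHom ℚ) (det_sum_vecMulVec_rootedIncidence r F
      fun e he => G.not_isDiag_of_mem_edgeSet (hF he))
    rw [RingHom.map_det] at h
    have hL : (Int.castRingHom ℚ).mapMatrix
        (∑ e ∈ F, Matrix.vecMulVec (rootedIncidence r e) (rootedIncidence r e)) = L F := by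
      rw [map_sum]
      refine Finset.sum_congr rfl fun e _ => ?_
      ext k l
      simp [Matrix.vecMulVec_apply, b]
    rw [hL] at h
    simpa using h
  let E : Finset (Sym2 V) := G.edgeSet.toFinset
  have hE : (E : Set (Sym2 V)) = G.edgeSet := Set.coe_toFinset _
  have herase (F : Finset (Sym2 V)) (k : Sym2 V) (hk : k ∈ F) :
      L (F.erase k) = L F - Matrix.vecMulVec (b k) (b k) :=
    eq_sub_of_add_eq (Finset.sum_erase_add _ _ hk)
  have hiE : i ∈ E := Set.mem_toFinset.2 hi
  have hjE : j ∈ E := Set.mem_toFinset.2 hj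
  have d0 := hdet E hE.subset
  have d1 := hdet (E.erase i) (by rw [Finset.coe_erase, hE]; exact Set.sdiff_subset)
  have d2 := hdet (E.erase j) (by rw [Finset.coe_erase, hE]; exact Set.sdiff_subset)
  have d3 := hdet ((E.erase j).erase i) (by
    rw [Finset.coe_erase, Finset.coe_erase, hE]
    exact Set.sdiff_subset.trans Set.sdiff_subset)
  rw [hE, ← ht] at d0
  rw [Finset.coe_erase, hE] at d1 d2
  rw [Finset.coe_erase, Finset.coe_erase, hE] at d3
  have hne : (L E).det ≠ 0 := by
    rw [d0]
    exact_mod_cast hpos.ne'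
  have hsymm : (L E).IsSymm := by
    simp [Matrix.IsSymm, L, Matrix.transpose_sum, Matrix.transpose_vecMulVec]
  have herase_both : L E - Matrix.vecMulVec (b i) (b i) - Matrix.vecMulVec (b j) (b j) =
      L ((E.erase j).erase i) := by
    rw [herase _ _ (Finset.mem_erase.2 ⟨hij, hiE⟩), herase _ _ hjE, sub_right_comm]
  have hineq := det_mul_det_sub_le (L E) hsymm hne (b i) (b j)
  rw [herase_both, ← herase _ _ hiE, ← herase _ _ hjE, d0, d1, d2, d3] at hineq
  have key : t * spanningTreeCount ((G.edgeSet \ {j}) \ {i}) ≤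
      spanningTreeCount (G.edgeSet \ {i}) * spanningTreeCount (G.edgeSet \ {j}) := by
    exact_mod_cast hineq
  zify at e1 e2 e3 e4 key ⊢
  rw [eq_sub_of_add_eq e4, eq_sub_of_add_eq e3, eq_sub_of_add_eq e1, eq_sub_of_add_eq e2]
  linear_combination key
end

section
/- Let G be a finite connected simple graph with d+1 vertices. Then there exist positive integers a_0, a_1, …, a_d such that for every natural number q, χ_G(q) = ∑_{i=0}^d (−1)^i a_i q^{d+1−i}. -/
/-- The number of proper `q`-colorings of a simple graph `G`. -/
noncomputable def numProperColorings {V : Type*} (G : SimpleGraph V) (q : ℕ) : ℕ :=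
  Nat.card {c : V → Fin q // ∀ v w : V, G.Adj v w → c v ≠ c w}

namespace SimpleGraph

universe u

variable {V : Type u} {W : Type*}

/-- The simple graph on `W` obtained by pushing the edges of `G` forward along `f`, dropping loops. -/
def image (G : SimpleGraph V) (f : V → W) : SimpleGraph W where
  Adj a b := a ≠ b ∧ ∃ x y, f x = a ∧ f y = b ∧ G.Adj x y
  symm := ⟨fun _ _ ⟨hne, x, y, hx, hy, h⟩ => ⟨hne.symm, y, x, hy, hx, h.symm⟩⟩
  loopless := ⟨fun _ h => h.1 rfl⟩

theorem Reachable.image {G : SimpleGraph V} (f : V → W) {x y : V} (h : G.Reachable x y) :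
    (G.image f).Reachable (f x) (f y) := by
  obtain ⟨p⟩ := h
  induction p with
  | nil => exact Reachable.refl _
  | @cons u v w huv _ ih =>
    by_cases hf : f u = f v
    · rwa [hf]
    · exact (Adj.reachable (G := G.image f) ⟨hf, u, v, rfl, rfl, huv⟩).trans ih

theorem Connected.image {G : SimpleGraph V} (hG : G.Connected) {f : V → W}
    (hf : Function.Surjective f) : (G.image f).Connected := by
  have := hG.nonempty
  have : Nonempty W := this.map f
  refine ⟨fun a b => ?_⟩
  obtain ⟨x, rfl⟩ := hf a
  obtain ⟨y, rfl⟩ := hf b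
  exact (hG.preconnected x y).image f

open Classical in
/-- The retraction of `V` onto the complement of `w` sending `w` to `v`. -/
noncomputable def mergeVertex {v w : V} (h : v ≠ w) (x : V) : {x : V // x ≠ w} :=
  if hx : x = w then ⟨v, h⟩ else ⟨x, hx⟩

theorem mergeVertex_of_ne {v w x : V} (h : v ≠ w) (hx : x ≠ w) :
    mergeVertex h x = ⟨x, hx⟩ := dif_neg hx

theorem mergeVertex_self {v w : V} (h : v ≠ w) : mergeVertex h w = ⟨v, h⟩ := dif_pos rfl

theorem mergeVertex_surjective {v w : V} (h : v ≠ w) : Function.Surjective (mergeVertex h) :=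
  fun x => ⟨x, mergeVertex_of_ne h x.2⟩

theorem mergeVertex_eq_iff {v w x y : V} (h : v ≠ w) :
    mergeVertex h x = mergeVertex h y ↔ x = y ∨ s(x, y) = s(v, w) := by
  by_cases hx : x = w <;> by_cases hy : y = w
  · simp [hx, hy]
  · subst hx
    rw [mergeVertex_self, mergeVertex_of_ne h hy]
    simp only [Subtype.mk.injEq, Sym2.eq_iff]
    grind
  · subst hy
    rw [mergeVertex_self, mergeVertex_of_ne h hx]
    simp only [Subtype.mk.injEq, Sym2.eq_iff]
    grind
  · rw [mergeVertex_of_ne h hx, mergeVertex_of_ne h hy]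
    simp only [Subtype.mk.injEq, Sym2.eq_iff]
    grind

theorem numProperColorings_bot [Fintype V] (q : ℕ) :
    numProperColorings (⊥ : SimpleGraph V) q = q ^ Fintype.card V := by
  simp [numProperColorings, Nat.card_fun]

/-- Deletion–contraction for the number of proper colorings. -/
theorem numProperColorings_deleteEdges [Finite V] (G : SimpleGraph V) {v w : V}
    (hvw : G.Adj v w) (q : ℕ) :
    numProperColorings (G.deleteEdges {s(v, w)}) q =
      numProperColorings G q + numProperColorings (G.image (mergeVertex hvw.ne)) q := by
  classical
  have hadj : ∀ x y, (G.deleteEdges {s(v, w)}).Adj x y ↔ G.Adj x y ∧ s(x, y) ≠ s(v, w) := by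
    intro x y
    simp only [deleteEdges_adj, Set.mem_singleton_iff, ne_eq]
  let P : (V → Fin q) → Prop := fun c => ∀ x y, (G.deleteEdges {s(v, w)}).Adj x y → c x ≠ c y
  let e₁ : {c : V → Fin q // ∀ x y, G.Adj x y → c x ≠ c y} ≃
      {c : {c : V → Fin q // P c} // c.1 v ≠ c.1 w} :=
    { toFun := fun c => ⟨⟨c.1, fun x y h => c.2 x y ((hadj x y).1 h).1⟩, c.2 v w hvw⟩
      invFun := fun c => ⟨c.1.1, fun x y h => by
        by_cases hs : s(x, y) = s(v, w)
        · rcases Sym2.eq_iff.1 hs with ⟨rfl, rfl⟩ | ⟨rfl, rfl⟩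
          · exact c.2
          · exact c.2.symm
        · exact c.1.2 x y ((hadj x y).2 ⟨h, hs⟩)⟩
      left_inv := fun _ => rfl
      right_inv := fun _ => rfl }
  have hfac : ∀ c : V → Fin q, c v = c w → ∀ x, c (mergeVertex hvw.ne x).1 = c x := by
    intro c hc x
    by_cases hx : x = w
    · rw [hx, mergeVertex_self, hc]
    · rw [mergeVertex_of_ne _ hx]
  let e₂ : {c : {x : V // x ≠ w} → Fin q //
        ∀ a b, (G.image (mergeVertex hvw.ne)).Adj a b → c a ≠ c b} ≃
      {c : {c : V → Fin q // P c} // ¬ c.1 v ≠ c.1 w} :=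
    { toFun := fun c => ⟨⟨c.1 ∘ mergeVertex hvw.ne, fun x y h => by
        obtain ⟨h, hs⟩ := (hadj x y).1 h
        refine c.2 _ _ ⟨fun he => ?_, x, y, rfl, rfl, h⟩
        exact ((mergeVertex_eq_iff _).1 he).elim h.ne hs⟩, by
          have : mergeVertex hvw.ne v = mergeVertex hvw.ne w :=
            (mergeVertex_eq_iff _).2 (Or.inr rfl)
          simp [this]⟩
      invFun := fun c => ⟨fun a => c.1.1 a.1, by
        rintro _ _ ⟨hne, x, y, rfl, rfl, h⟩
        have hc := hfac c.1.1 (not_not.1 c.2)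
        simp only [hc]
        exact c.1.2 x y ((hadj x y).2 ⟨h, fun hs => hne ((mergeVertex_eq_iff _).2 (Or.inr hs))⟩)⟩
      left_inv := fun c => by
        ext a
        simp [mergeVertex_of_ne hvw.ne a.2]
      right_inv := fun c => by
        ext x
        exact congrArg Fin.val (hfac c.1.1 (not_not.1 c.2) x) }
  have := Fintype.ofFinite V
  unfold numProperColorings
  rw [Nat.card_congr e₁, Nat.card_congr e₂, ← Nat.card_sum]
  exact (Nat.card_congr (Equiv.sumCompl _)).symm

/-- The coefficients of the chromatic polynomial alternate weakly in sign, and strictly for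
connected graphs. -/
theorem exists_chromatic_coefficients (d : ℕ) :
    ∀ {V : Type u} [Fintype V] (G : SimpleGraph V), Fintype.card V = d + 1 →
      ∃ a : ℕ → ℤ, 0 < a 0 ∧ (∀ i, 0 ≤ a i) ∧ (G.Connected → ∀ i ≤ d, 0 < a i) ∧
        ∀ q : ℕ, (numProperColorings G q : ℤ) =
          ∑ i ∈ Finset.range (d + 1), (-1 : ℤ) ^ i * a i * (q : ℤ) ^ (d + 1 - i) := by
  induction d with
  | zero =>
    intro V _ G hV
    have : Subsingleton V := Fintype.card_le_one_iff_subsingleton.1 hV.le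
    refine ⟨fun _ => 1, one_pos, fun _ => zero_le_one, fun _ _ _ => one_pos, fun q => ?_⟩
    rw [Subsingleton.elim G ⊥, numProperColorings_bot, hV]
    simp
  | succ d ihd =>
    intro V _ G hV
    induction G using WellFoundedLT.induction with
    | ind G ih =>
    classical
    by_cases hG : G = ⊥
    · subst hG
      refine ⟨fun i => if i = 0 then 1 else 0, by simp, fun i => by positivity, fun hc => ?_,
        fun q => ?_⟩
      · have : Nontrivial V := Fintype.one_lt_card_iff_nontrivial.1 (by omega)
        exact absurd hc.preconnected not_preconnected_bot
      · rw [numProperColorings_bot, hV, Finset.sum_range_succ']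
        simp
    · obtain ⟨v, w, hvw⟩ := ne_bot_iff_exists_adj.1 hG
      have hlt : G.deleteEdges {s(v, w)} < G := by
        refine lt_of_le_of_ne (deleteEdges_le _) fun he => ?_
        rw [← he] at hvw
        simp at hvw
      have hcard : Fintype.card {x : V // x ≠ w} = d + 1 := by
        rw [Fintype.card_subtype_compl, hV]
        simp
      obtain ⟨a, ha0, ha, -, haq⟩ := ih _ hlt
      obtain ⟨b, -, hb, hbc, hbq⟩ := ihd (G.image (mergeVertex hvw.ne)) hcard
      refine ⟨fun i => a i + if i = 0 then 0 else b (i - 1), by simpa using ha0, fun i => ?_,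
        fun hc i hi => ?_, fun q => ?_⟩
      · have := ha i
        have := hb (i - 1)
        dsimp only
        split_ifs <;> omega
      · rcases i with _ | i
        · simpa using ha0
        · have := hbc (hc.image (mergeVertex_surjective hvw.ne)) i (by omega)
          have := ha (i + 1)
          simp only [Nat.add_sub_cancel, Nat.add_eq_zero_iff, one_ne_zero, and_false, if_false]
          omega
      · have hdc := numProperColorings_deleteEdges G hvw q
        zify at hdc
        rw [haq, hbq] at hdc
        rw [eq_sub_of_add_eq hdc.symm]
        simp only [mul_add, add_mul, Finset.sum_add_distrib]
        rw [sub_eq_add_neg, add_right_inj, Finset.sum_range_succ' _ (d + 1),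
          ← Finset.sum_neg_distrib]
        simp [pow_succ, Nat.add_sub_add_right]

end SimpleGraph

/-- Whitney: for a finite connected simple graph `G` with `d + 1` vertices,
there are positive integers `a_0, …, a_d` with
`χ_G(q) = ∑_{i=0}^d (−1)^i a_i q^{d+1−i}` for every natural number `q`. -/
theorem chromatic_polynomial_exists {V : Type*} [Fintype V] (G : SimpleGraph V)
    (hG : G.Connected) (d : ℕ) (hd : Fintype.card V = d + 1) :
    ∃ a : ℕ → ℤ, (∀ i ≤ d, 0 < a i) ∧
      ∀ q : ℕ, (numProperColorings G q : ℤ) =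
        ∑ i ∈ Finset.range (d + 1), (-1 : ℤ) ^ i * a i * (q : ℤ) ^ (d + 1 - i) := by
  obtain ⟨a, -, -, ha, haq⟩ := G.exists_chromatic_coefficients d hd
  exact ⟨a, ha hG, haq⟩
end

section
/- Let G be a finite connected simple graph with d+1 vertices, and let a_0, a_1, …, a_d be integers such that χ_G(q) = ∑_{i=0}^d (−1)^i a_i q^{d+1−i} for every natural number q. Then the sequence a_0, …, a_d is log-concave: a_i^2 ≥ a_{i−1} · a_{i+1} for all 1 ≤ i ≤ d−1. -/
open Matrix in
/-- An eigenvector with positive eigenvalue of a symmetric matrix with nonnegative connected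
off-diagonal part is proportional to the Perron vector. -/
lemma quadForm_nonpos_of_perron {ι : Type*} [Fintype ι] [DecidableEq ι] (A : Matrix ι ι ℝ)
    (hA : A.IsSymm) (v : ι → ℝ) (hv : ∀ i, 0 < v i) (hoff : ∀ i j, i ≠ j → 0 ≤ A i j)
    (hAv : A *ᵥ v = v)
    (hconn : ∀ u : ι → ℝ, (∀ i j, i ≠ j → 0 < A i j → u i = u j) → ∀ i j, u i = u j)
    (hB : ∀ x : ι → ℝ, x ⬝ᵥ A *ᵥ x ≤ A *ᵥ x ⬝ᵥ A *ᵥ x)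
    (y : ι → ℝ) (hy : y ⬝ᵥ v = 0) : y ⬝ᵥ A *ᵥ y ≤ 0 := by
  have key : ∀ (e : ι → ℝ) (c : ℝ), A *ᵥ e = c • e → 0 < c → e ⬝ᵥ y = 0 := by
    intro e c he hc
    have h1 : 0 ≤ e ⬝ᵥ e :=
      Finset.sum_nonneg fun i _ => mul_self_nonneg (e i)
    have h2 : (1 - c) * (e ⬝ᵥ e) ≤ 0 := by
      have := hB e
      rw [he] at this
      simp only [dotProduct_smul, smul_dotProduct, smul_eq_mul] at this
      have h3 : c * ((1 - c) * (e ⬝ᵥ e)) ≤ 0 := by linarith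
      by_contra! h
      exact absurd h3 (not_le.mpr (mul_pos hc h))
    have hrow : ∀ i, ∑ j, A i j * v j = v i := fun i => congrFun hAv i
    have hrow' : ∀ i, ∑ j, A i j * e j = c * e i := fun i => congrFun he i
    have hsum : ∑ i, ∑ j, A i j * v i * v j * (e i / v i - e j / v j) ^ 2
        = 2 * ((1 - c) * (e ⬝ᵥ e)) := by
      have e1 : ∀ i j, A i j * v i * v j * (e i / v i - e j / v j) ^ 2
          = (e i ^ 2 / v i) * (A i j * v j) + (e j ^ 2 / v j) * (A j i * v i)
            - 2 * (e i * (A i j * e j)) := by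
        intro i j
        have := (hv i).ne'
        have := (hv j).ne'
        rw [show A j i = A i j from hA.apply i j]
        field_simp
        ring
      simp only [e1, Finset.sum_sub_distrib, Finset.sum_add_distrib]
      rw [Finset.sum_comm (f := fun i j => (e j ^ 2 / v j) * (A j i * v i))]
      simp only [← Finset.mul_sum, hrow, hrow']
      have e2 : ∀ i, e i ^ 2 / v i * v i = e i * e i := by
        intro i
        have := (hv i).ne'
        field_simp
      simp only [e2, dotProduct]
      have e3 : ∑ i, e i * (c * e i) = c * ∑ i, e i * e i := by
        rw [Finset.mul_sum]
        exact Finset.sum_congr rfl fun i _ => by ring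
      rw [e3]
      ring
    have hterm : ∀ i j, 0 ≤ A i j * v i * v j * (e i / v i - e j / v j) ^ 2 := by
      intro i j
      by_cases hij : i = j
      · simp [hij]
      · have := hoff i j hij
        have := hv i
        have := hv j
        positivity
    have hzero : ∀ i j, A i j * v i * v j * (e i / v i - e j / v j) ^ 2 = 0 := by
      have h0 : ∑ i, ∑ j, A i j * v i * v j * (e i / v i - e j / v j) ^ 2 = 0 :=
        le_antisymm (by rw [hsum]; linarith)
          (Finset.sum_nonneg fun i _ => Finset.sum_nonneg fun j _ => hterm i j)
      intro i j
      rw [Finset.sum_eq_zero_iff_of_nonneg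
        (fun i _ => Finset.sum_nonneg fun j _ => hterm i j)] at h0
      have := h0 i (Finset.mem_univ i)
      rw [Finset.sum_eq_zero_iff_of_nonneg (fun j _ => hterm i j)] at this
      exact this j (Finset.mem_univ j)
    have hconst := hconn (fun i => e i / v i) (by
      intro i j _ hpos
      have h := hzero i j
      have hp : A i j * v i * v j ≠ 0 := (mul_pos (mul_pos hpos (hv i)) (hv j)).ne'
      exact sub_eq_zero.mp (pow_eq_zero_iff (two_ne_zero)|>.mp
        ((mul_eq_zero.mp h).resolve_left hp)))
    rcases isEmpty_or_nonempty ι with hι | ⟨⟨i₀⟩⟩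
    · simp [dotProduct]
    · have : e = (e i₀ / v i₀) • v := by
        ext i
        have h := hconst i i₀
        have := (hv i).ne'
        simp only [Pi.smul_apply, smul_eq_mul, ← h]
        field_simp
      rw [this, smul_dotProduct, dotProduct_comm, hy, smul_zero]
  have hH : A.IsHermitian := by
    rw [Matrix.IsHermitian, conjTranspose_eq_transpose_of_trivial]
    exact hA
  set b := hH.eigenvectorBasis
  have hpar := b.sum_inner_mul_inner (WithLp.toLp 2 y) (WithLp.toLp 2 (A *ᵥ y))
  have hin : ∀ p q : EuclideanSpace ℝ ι, inner ℝ p q = p.ofLp ⬝ᵥ q.ofLp := by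
    intro p q
    rw [dotProduct_comm]
    simp [EuclideanSpace.inner_eq_star_dotProduct]
  simp only [hin] at hpar
  rw [← hpar]
  refine Finset.sum_nonpos fun k _ => ?_
  have hk : A *ᵥ (b k).ofLp = hH.eigenvalues k • (b k).ofLp := hH.mulVec_eigenvectorBasis k
  have hsw : (b k).ofLp ⬝ᵥ A *ᵥ y = hH.eigenvalues k * ((b k).ofLp ⬝ᵥ y) := by
    rw [dotProduct_mulVec, ← mulVec_transpose, hA.eq, hk, smul_dotProduct, smul_eq_mul]
  rw [hsw, dotProduct_comm y]
  rcases le_or_gt (hH.eigenvalues k) 0 with h | h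
  · nlinarith [mul_self_nonneg ((b k).ofLp ⬝ᵥ y)]
  · simp [key _ _ hk h]

open Matrix in
/-- Reversed Cauchy–Schwarz inequality for a symmetric matrix with Perron vector `v`. -/
lemma reverse_cauchy_of_perron {ι : Type*} [Fintype ι] [DecidableEq ι] (A : Matrix ι ι ℝ)
    (hA : A.IsSymm) (v D : ι → ℝ) (hv : ∀ i, 0 < v i) (hD : ∀ i, 0 < D i)
    (hoff : ∀ i j, i ≠ j → 0 ≤ A i j) (hAv : ∀ i, (A *ᵥ v) i = D i * v i)
    (hconn : ∀ u : ι → ℝ, (∀ i j, i ≠ j → 0 < A i j → u i = u j) → ∀ i j, u i = u j)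
    (hB : ∀ x : ι → ℝ, x ⬝ᵥ A *ᵥ x ≤ ∑ i, (A *ᵥ x) i ^ 2 / D i)
    (x : ι → ℝ) : (x ⬝ᵥ A *ᵥ x) * (v ⬝ᵥ A *ᵥ v) ≤ (x ⬝ᵥ A *ᵥ v) ^ 2 := by
  rcases isEmpty_or_nonempty ι with hι | hι
  · simp [dotProduct]
  set s : ι → ℝ := fun i => Real.sqrt (D i)
  have hs : ∀ i, 0 < s i := fun i => Real.sqrt_pos.mpr (hD i)
  have hss : ∀ i, s i * s i = D i := fun i => Real.mul_self_sqrt (hD i).le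
  set B : Matrix ι ι ℝ := Matrix.of fun i j => A i j / (s i * s j)
  have hBm : ∀ z i, (B *ᵥ z) i = (A *ᵥ fun j => z j / s j) i / s i := by
    intro z i
    simp only [mulVec, dotProduct, B, of_apply, Finset.sum_div]
    refine Finset.sum_congr rfl fun j _ => ?_
    have := (hs i).ne'
    have := (hs j).ne'
    field_simp
  have hform : ∀ y z, y ⬝ᵥ B *ᵥ z = (fun j => y j / s j) ⬝ᵥ A *ᵥ (fun j => z j / s j) := by
    intro y z
    simp only [dotProduct, hBm]
    exact Finset.sum_congr rfl fun i _ => by ring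
  have hneg := quadForm_nonpos_of_perron B (by
      ext i j
      simp only [B, transpose_apply, of_apply, hA.apply i j, mul_comm])
    (fun i => s i * v i) (fun i => mul_pos (hs i) (hv i))
    (fun i j hij => div_nonneg (hoff i j hij) (mul_pos (hs i) (hs j)).le)
    (by
      ext i
      have e : (fun j => s j * v j / s j) = v := by
        ext j
        have := (hs j).ne'
        field_simp
      have := (hs i).ne'
      rw [hBm, e, hAv, ← hss]
      field_simp)
    (by
      intro u hu
      refine hconn u fun i j hij hpos => hu i j hij ?_
      exact div_pos hpos (mul_pos (hs i) (hs j)))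
    (by
      intro z
      rw [hform]
      refine (hB _).trans (le_of_eq ?_)
      simp only [dotProduct, hBm, ← hss]
      refine Finset.sum_congr rfl fun i _ => ?_
      have := (hs i).ne'
      field_simp)
  have hvv : 0 < v ⬝ᵥ A *ᵥ v := by
    simp only [dotProduct, hAv]
    exact Finset.sum_pos (fun i _ => mul_pos (hv i) (mul_pos (hD i) (hv i)))
      Finset.univ_nonempty
  set p := x ⬝ᵥ A *ᵥ v
  set q := v ⬝ᵥ A *ᵥ v
  have hsymm : v ⬝ᵥ A *ᵥ x = p := by
    rw [dotProduct_mulVec, ← mulVec_transpose, hA.eq, dotProduct_comm]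
  have h := hneg (fun i => s i * (x i - p / q * v i)) (by
    have e1 : p = ∑ i, x i * (D i * v i) := by simp only [p, dotProduct, hAv]
    have e2 : q = ∑ i, v i * (D i * v i) := by simp only [q, dotProduct, hAv]
    have e3 : p - p / q * q = 0 := by field_simp; ring
    rw [← e3]
    nth_rewrite 3 [e2]
    nth_rewrite 2 [e1]
    rw [Finset.mul_sum, ← Finset.sum_sub_distrib]
    refine Finset.sum_congr rfl fun i _ => ?_
    rw [← hss]
    ring)
  rw [hform] at h
  have e : (fun j => s j * (x j - p / q * v j) / s j) = x - (p / q) • v := by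
    ext j
    have := (hs j).ne'
    simp only [Pi.sub_apply, Pi.smul_apply, smul_eq_mul]
    field_simp
  rw [e] at h
  simp only [mulVec_sub, mulVec_smul, dotProduct_sub, sub_dotProduct, dotProduct_smul,
    smul_dotProduct, smul_eq_mul, hsymm] at h
  change x ⬝ᵥ A *ᵥ x - p / q * p - p / q * (p - p / q * q) ≤ 0 at h
  have e4 : p / q * q = p := by field_simp
  rw [e4] at h
  have : (x ⬝ᵥ A *ᵥ x - p / q * p) * q ≤ 0 := by nlinarith
  have e5 : p / q * p * q = p ^ 2 := by field_simp
  nlinarith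

/-- A graded family of finite subsets of `E` with a least and a greatest member in which, for each
member `F`, the members covering `F` partition the complement of `F`: the lattice of flats of a
loopless matroid. -/
structure FlatSystem (E : Type*) where
  carrier : Finset (Finset E)
  rk : Finset E → ℕ
  top : Finset E
  bot_mem : ∅ ∈ carrier
  top_mem : top ∈ carrier
  subset_top : ∀ F ∈ carrier, F ⊆ top
  rk_bot : rk ∅ = 0
  rk_lt : ∀ F ∈ carrier, ∀ G ∈ carrier, F ⊂ G → rk F < rk G
  exists_cover : ∀ F ∈ carrier, ∀ G ∈ carrier, F ⊆ G → ∀ i ∈ G, i ∉ F →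
    ∃ H ∈ carrier, F ⊆ H ∧ H ⊆ G ∧ i ∈ H ∧ rk H = rk F + 1
  cover_unique : ∀ F ∈ carrier, ∀ H ∈ carrier, ∀ H' ∈ carrier, F ⊆ H → F ⊆ H' → ∀ i, i ∉ F →
    i ∈ H → i ∈ H' → rk H = rk F + 1 → rk H' = rk F + 1 → H = H'

namespace FlatSystem

open Finset

open scoped Classical in
/-- The members strictly between `F` and `G`. -/
noncomputable def between {E : Type*} (L : FlatSystem E) (F G : Finset E) : Finset (Finset E) :=
  L.carrier.filter fun H => F ⊂ H ∧ H ⊂ G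

/-- The function `x` minus the affine function of the cardinality agreeing with `x` at `F`
and `G`. -/
noncomputable def nrm {E : Type*} (F G : Finset E) (x : Finset E → ℝ) (H : Finset E) : ℝ :=
  x H - x F - (x G - x F) * (((#H : ℝ) - #F) / ((#G : ℝ) - #F))

/-- The number of ranks strictly between those of `F` and `G`. -/
def gap {E : Type*} (L : FlatSystem E) (F G : Finset E) : ℕ := L.rk G - L.rk F - 1

section Basic

variable {E : Type*} (L : FlatSystem E) {F G H K : Finset E}

lemma mem_between : H ∈ L.between F G ↔ H ∈ L.carrier ∧ F ⊂ H ∧ H ⊂ G := by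
  classical
  simp [between]

lemma sum_between_comm (f : Finset E → Finset E → ℝ) :
    ∑ H ∈ L.between F G, ∑ K ∈ L.between F H, f H K
      = ∑ K ∈ L.between F G, ∑ H ∈ L.between K G, f H K := by
  refine Finset.sum_comm' fun H K => ?_
  simp only [mem_between]
  constructor
  · rintro ⟨⟨h1, _, h3⟩, h4, h5, h6⟩
    exact ⟨⟨h1, h6, h3⟩, h4, h5, h6.trans h3⟩
  · rintro ⟨⟨h1, h2, h3⟩, h4, h5, _⟩
    exact ⟨⟨h1, h5.trans h2, h3⟩, h4, h5, h2⟩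

lemma gap_add (hF : F ∈ L.carrier) (hG : G ∈ L.carrier) (hH : H ∈ L.between F G) :
    L.gap F H + L.gap H G + 1 = L.gap F G := by
  obtain ⟨h1, h2, h3⟩ := L.mem_between.mp hH
  have := L.rk_lt F hF H h1 h2
  have := L.rk_lt H h1 G hG h3
  unfold gap
  omega

lemma between_eq_empty (hF : F ∈ L.carrier) (hG : G ∈ L.carrier) (h : L.gap F G = 0) :
    L.between F G = ∅ := by
  by_contra hne
  obtain ⟨H, hH⟩ := Finset.nonempty_iff_ne_empty.mpr hne
  have := L.gap_add hF hG hH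
  omega

lemma exists_atom (hF : F ∈ L.carrier) (hG : G ∈ L.carrier) (h : L.gap F G ≠ 0)
    {i : E} (hi : i ∈ G) (hiF : i ∉ F) (hFG : F ⊂ G) :
    ∃ H ∈ L.between F G, i ∈ H ∧ L.rk H = L.rk F + 1 := by
  obtain ⟨H, h1, h2, h3, h4, h5⟩ := L.exists_cover F hF G hG hFG.subset i hi hiF
  refine ⟨H, L.mem_between.mpr ⟨h1, ?_, ?_⟩, h4, h5⟩
  · exact ⟨h2, fun h' => hiF (h' h4)⟩
  · refine ⟨h3, fun h' => ?_⟩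
    have : H = G := h3.antisymm h'
    subst this
    unfold gap at h
    omega

lemma between_nonempty (hF : F ∈ L.carrier) (hG : G ∈ L.carrier) (h : L.gap F G ≠ 0)
    (hFG : F ⊂ G) : (L.between F G).Nonempty := by
  obtain ⟨i, hi, hiF⟩ := Finset.exists_of_ssubset hFG
  obtain ⟨H, hH, _⟩ := L.exists_atom hF hG h hi hiF hFG
  exact ⟨H, hH⟩

lemma nrm_left (x : Finset E → ℝ) : nrm F G x F = 0 := by simp [nrm]

lemma nrm_right (hFG : F ⊂ G) (x : Finset E → ℝ) : nrm F G x G = 0 := by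
  have : (#G : ℝ) - #F ≠ 0 := by
    have := Finset.card_lt_card hFG
    have : (#F : ℝ) < #G := by exact_mod_cast this
    linarith
  simp [nrm, div_self this]

lemma nrm_nrm {F' G' : Finset E} (hFG : F ⊂ G) (x : Finset E → ℝ) :
    nrm F G (nrm F' G' x) H = nrm F G x H := by
  have : (#G : ℝ) - #F ≠ 0 := by
    have := Finset.card_lt_card hFG
    have : (#F : ℝ) < #G := by exact_mod_cast this
    linarith
  simp only [nrm, div_eq_mul_inv]
  generalize ((#G' : ℝ) - #F')⁻¹ = c
  field_simp
  ring

end Basic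

open scoped Classical in
/-- The normalized self-intersection number `deg(v ^ d) / d!` of the interval `[F, G]`. -/
noncomputable def vol {E : Type*} (L : FlatSystem E) (v : Finset E → ℝ) (F G : Finset E) : ℝ :=
  if L.gap F G = 0 then 1 else
    (∑ H : {H // H ∈ L.between F G}, nrm F G v H * vol L v F H * vol L v H G) / L.gap F G
termination_by #G - #F
decreasing_by
  all_goals
    obtain ⟨_, h1, h2⟩ := L.mem_between.mp H.2
    have := Finset.card_lt_card h1
    have := Finset.card_lt_card h2
    omega

/-- The normalized mixed number `deg(x v ^ (d - 1)) / (d - 1)!` of the interval `[F, G]`. -/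
noncomputable def ell {E : Type*} (L : FlatSystem E) (v : Finset E → ℝ) (F G : Finset E)
    (x : Finset E → ℝ) : ℝ :=
  ∑ H ∈ L.between F G, nrm F G x H * L.vol v F H * L.vol v H G

/-- The normalized mixed number `deg(x y v ^ (d - 2)) / (d - 2)!` of the interval `[F, G]`. -/
noncomputable def qf {E : Type*} (L : FlatSystem E) (v : Finset E → ℝ) (F G : Finset E)
    (x y : Finset E → ℝ) : ℝ :=
  ∑ H ∈ L.between F G,
    nrm F G x H * (L.ell v F H y * L.vol v H G + L.vol v F H * L.ell v H G y)

/-- The derivative of `qf` in the direction of the indicator function of `H`. -/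
noncomputable def qfAt {E : Type*} (L : FlatSystem E) (v : Finset E → ℝ) (F G H : Finset E)
    (x y : Finset E → ℝ) : ℝ :=
  L.qf v F H x y * L.vol v H G + L.ell v F H x * L.ell v H G y
    + L.ell v F H y * L.ell v H G x + L.vol v F H * L.qf v H G x y

section Core

variable {E : Type*} (L : FlatSystem E) (v : Finset E → ℝ) {F G H K : Finset E}

lemma vol_of_gap_eq_zero (h : L.gap F G = 0) : L.vol v F G = 1 := by
  rw [vol, if_pos h]

lemma ell_self (hF : F ∈ L.carrier) (hG : G ∈ L.carrier) :
    L.ell v F G v = L.gap F G * L.vol v F G := by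
  by_cases h : L.gap F G = 0
  · simp [ell, L.between_eq_empty hF hG h, h]
  · rw [vol, if_neg h, ell]
    have : (L.gap F G : ℝ) ≠ 0 := by exact_mod_cast h
    rw [mul_div_cancel₀ _ this,
      ← Finset.sum_coe_sort (L.between F G) fun H => nrm F G v H * L.vol v F H * L.vol v H G]

lemma ell_congr {x y : Finset E → ℝ} (h : ∀ H ∈ L.between F G, nrm F G x H = nrm F G y H) :
    L.ell v F G x = L.ell v F G y :=
  Finset.sum_congr rfl fun H hH => by rw [h H hH]

lemma ell_nrm {F' G' : Finset E} (hFG : F ⊂ G) (x : Finset E → ℝ) :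
    L.ell v F G (nrm F' G' x) = L.ell v F G x :=
  L.ell_congr v fun _ _ => nrm_nrm hFG x

lemma ell_add (x y : Finset E → ℝ) :
    L.ell v F G (x + y) = L.ell v F G x + L.ell v F G y := by
  simp only [ell, ← Finset.sum_add_distrib]
  refine Finset.sum_congr rfl fun H _ => ?_
  simp only [nrm, Pi.add_apply]
  ring

lemma ell_smul (c : ℝ) (x : Finset E → ℝ) :
    L.ell v F G (c • x) = c * L.ell v F G x := by
  simp only [ell, Finset.mul_sum]
  refine Finset.sum_congr rfl fun H _ => ?_
  simp only [nrm, Pi.smul_apply, smul_eq_mul]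
  ring

lemma qf_nrm_right {F' G' : Finset E} (x y : Finset E → ℝ) :
    L.qf v F G x (nrm F' G' y) = L.qf v F G x y := by
  refine Finset.sum_congr rfl fun H hH => ?_
  obtain ⟨_, h1, h2⟩ := L.mem_between.mp hH
  rw [L.ell_nrm v h1, L.ell_nrm v h2]

/-- Symmetry of the quadratic form obtained by normalizing on the links of an interval. -/
lemma link_form_symm (g : Finset E → Finset E → ℝ) (x z : Finset E → ℝ)
    (hxF : x F = 0) (hxG : x G = 0) (hzF : z F = 0) (hzG : z G = 0) :
    ∑ H ∈ L.between F G, z H * (∑ K ∈ L.between F H, nrm F H x K * g K H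
        + ∑ K ∈ L.between H G, nrm H G x K * g H K)
      = ∑ H ∈ L.between F G, x H * (∑ K ∈ L.between F H, nrm F H z K * g K H
        + ∑ K ∈ L.between H G, nrm H G z K * g H K) := by
  have expand : ∀ x z : Finset E → ℝ, x F = 0 → x G = 0 →
      ∑ H ∈ L.between F G, z H * (∑ K ∈ L.between F H, nrm F H x K * g K H
        + ∑ K ∈ L.between H G, nrm H G x K * g H K)
      = ∑ H ∈ L.between F G, ∑ K ∈ L.between F H, z H * x K * g K H
        + ∑ H ∈ L.between F G, ∑ K ∈ L.between H G, z H * x K * g H K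
        - ∑ H ∈ L.between F G, x H * z H * (
          ∑ K ∈ L.between F H, (((#K : ℝ) - #F) / ((#H : ℝ) - #F)) * g K H
          + ∑ K ∈ L.between H G, (1 - ((#K : ℝ) - #H) / ((#G : ℝ) - #H)) * g H K) := by
    intro x z hF hG
    rw [← Finset.sum_add_distrib, ← Finset.sum_sub_distrib]
    refine Finset.sum_congr rfl fun H _ => ?_
    simp only [mul_add, Finset.mul_sum]
    rw [← sub_eq_zero]
    have e1 : ∑ K ∈ L.between F H, z H * (nrm F H x K * g K H)
        = ∑ K ∈ L.between F H, z H * x K * g K H - ∑ K ∈ L.between F H,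
          x H * z H * (((#K : ℝ) - #F) / ((#H : ℝ) - #F) * g K H) := by
      rw [← Finset.sum_sub_distrib]
      refine Finset.sum_congr rfl fun K _ => ?_
      simp only [nrm, hF]
      ring
    have e2 : ∑ K ∈ L.between H G, z H * (nrm H G x K * g H K)
        = ∑ K ∈ L.between H G, z H * x K * g H K - ∑ K ∈ L.between H G,
          x H * z H * ((1 - ((#K : ℝ) - #H) / ((#G : ℝ) - #H)) * g H K) := by
      rw [← Finset.sum_sub_distrib]
      refine Finset.sum_congr rfl fun K _ => ?_
      simp only [nrm, hG]
      ring
    rw [e1, e2]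
    ring
  rw [expand x z hxF hxG, expand z x hzF hzG, L.sum_between_comm, L.sum_between_comm,
    add_comm (∑ H ∈ L.between F G, ∑ K ∈ L.between H G, z K * x H * g H K)]
  congr 1
  · congr 1
    · exact Finset.sum_congr rfl fun H _ => Finset.sum_congr rfl fun K _ => by ring
    · exact Finset.sum_congr rfl fun H _ => Finset.sum_congr rfl fun K _ => by ring
  · exact Finset.sum_congr rfl fun H _ => by ring

lemma qf_symm (hFG : F ⊂ G) (x y : Finset E → ℝ) : L.qf v F G x y = L.qf v F G y x := by
  have key : ∀ x y : Finset E → ℝ, L.qf v F G x y = ∑ H ∈ L.between F G, nrm F G x H *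
      (∑ K ∈ L.between F H, nrm F H (nrm F G y) K * (L.vol v F K * L.vol v K H * L.vol v H G)
        + ∑ K ∈ L.between H G, nrm H G (nrm F G y) K *
          (L.vol v F H * L.vol v H K * L.vol v K G)) := by
    intro x y
    rw [← L.qf_nrm_right v x y (F' := F) (G' := G), qf]
    refine Finset.sum_congr rfl fun H _ => ?_
    simp only [ell, Finset.sum_mul, Finset.mul_sum]
    congr 2
    · exact Finset.sum_congr rfl fun K _ => by ring
    · exact Finset.sum_congr rfl fun K _ => by ring
  rw [key, key]
  exact L.link_form_symm (fun K H => L.vol v F K * L.vol v K H * L.vol v H G) _ _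
    (nrm_left y) (nrm_right hFG y) (nrm_left x) (nrm_right hFG x)

end Core

end FlatSystem

namespace FlatSystem
open Finset

section Core

variable {E : Type*} (L : FlatSystem E) (v : Finset E → ℝ) {F G H K : Finset E}

lemma qf_self_right (hF : F ∈ L.carrier) (hG : G ∈ L.carrier) (x : Finset E → ℝ) :
    L.qf v F G x v = ((L.gap F G : ℝ) - 1) * L.ell v F G x := by
  rw [qf, ell, Finset.mul_sum]
  refine Finset.sum_congr rfl fun H hH => ?_
  have hH' := (L.mem_between.mp hH).1
  rw [L.ell_self v hF hH', L.ell_self v hH' hG, ← L.gap_add hF hG hH]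
  push_cast
  ring

lemma qfAt_symm (hH : H ∈ L.between F G) (x y : Finset E → ℝ) :
    L.qfAt v F G H x y = L.qfAt v F G H y x := by
  obtain ⟨_, h1, h2⟩ := L.mem_between.mp hH
  rw [qfAt, qfAt, L.qf_symm v h1 x y, L.qf_symm v h2 x y]
  ring

lemma qfAt_self_right (hF : F ∈ L.carrier) (hG : G ∈ L.carrier) (hH : H ∈ L.between F G)
    (x : Finset E → ℝ) :
    L.qfAt v F G H x v = ((L.gap F G : ℝ) - 2) *
      (L.ell v F H x * L.vol v H G + L.vol v F H * L.ell v H G x) := by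
  have hH' := (L.mem_between.mp hH).1
  rw [qfAt, L.qf_self_right v hF hH', L.qf_self_right v hH' hG, L.ell_self v hF hH',
    L.ell_self v hH' hG, ← L.gap_add hF hG hH]
  push_cast
  ring

/-- Symmetry of the trilinear form obtained from the derivatives of `qf`. -/
lemma sum_nrm_mul_qfAt_comm (hFG : F ⊂ G) (x y z : Finset E → ℝ) :
    ∑ H ∈ L.between F G, nrm F G z H * L.qfAt v F G H x y
      = ∑ H ∈ L.between F G, nrm F G x H * L.qfAt v F G H z y := by
  have key : ∀ x z : Finset E → ℝ, ∑ H ∈ L.between F G, nrm F G z H * L.qfAt v F G H x y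
      = ∑ H ∈ L.between F G, nrm F G z H *
      (∑ K ∈ L.between F H, nrm F H (nrm F G x) K *
          (L.ell v F K y * L.vol v K H * L.vol v H G + L.vol v F K * L.ell v K H y * L.vol v H G
            + L.vol v F K * L.vol v K H * L.ell v H G y)
        + ∑ K ∈ L.between H G, nrm H G (nrm F G x) K *
          (L.ell v F H y * L.vol v H K * L.vol v K G + L.vol v F H * L.ell v H K y * L.vol v K G
            + L.vol v F H * L.vol v H K * L.ell v K G y)) := by
    intro x z
    refine Finset.sum_congr rfl fun H hH => ?_
    obtain ⟨_, h1, h2⟩ := L.mem_between.mp hH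
    congr 1
    simp only [nrm_nrm h1, nrm_nrm h2, mul_add, Finset.sum_add_distrib]
    have d1 : L.ell v F H x
        = ∑ K ∈ L.between F H, nrm F H x K * L.vol v F K * L.vol v K H := rfl
    have d2 : L.ell v H G x
        = ∑ K ∈ L.between H G, nrm H G x K * L.vol v H K * L.vol v K G := rfl
    simp only [qfAt, qf, d1, d2, mul_add, Finset.sum_add_distrib,
      add_mul, Finset.sum_mul, Finset.mul_sum]
    have e1 : ∑ i ∈ L.between F H, nrm F H x i * L.vol v F i * L.vol v i H * L.ell v H G y
        = ∑ K ∈ L.between F H, nrm F H x K * (L.vol v F K * L.vol v K H * L.ell v H G y) :=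
      Finset.sum_congr rfl fun K _ => by ring
    have e2 : ∑ i ∈ L.between F H, nrm F H x i * (L.ell v F i y * L.vol v i H) * L.vol v H G
        = ∑ K ∈ L.between F H, nrm F H x K * (L.ell v F K y * L.vol v K H * L.vol v H G) :=
      Finset.sum_congr rfl fun K _ => by ring
    have e3 : ∑ i ∈ L.between F H, nrm F H x i * (L.vol v F i * L.ell v i H y) * L.vol v H G
        = ∑ K ∈ L.between F H, nrm F H x K * (L.vol v F K * L.ell v K H y * L.vol v H G) :=
      Finset.sum_congr rfl fun K _ => by ring
    have e4 : ∑ i ∈ L.between H G, L.ell v F H y * (nrm H G x i * L.vol v H i * L.vol v i G)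
        = ∑ K ∈ L.between H G, nrm H G x K * (L.ell v F H y * L.vol v H K * L.vol v K G) :=
      Finset.sum_congr rfl fun K _ => by ring
    have e5 : ∑ i ∈ L.between H G, L.vol v F H * (nrm H G x i * (L.ell v H i y * L.vol v i G))
        = ∑ K ∈ L.between H G, nrm H G x K * (L.vol v F H * L.ell v H K y * L.vol v K G) :=
      Finset.sum_congr rfl fun K _ => by ring
    have e6 : ∑ i ∈ L.between H G, L.vol v F H * (nrm H G x i * (L.vol v H i * L.ell v i G y))
        = ∑ K ∈ L.between H G, nrm H G x K * (L.vol v F H * L.vol v H K * L.ell v K G y) :=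
      Finset.sum_congr rfl fun K _ => by ring
    rw [e1, e2, e3, e4, e5, e6]
    ring
  rw [key, key]
  exact L.link_form_symm (fun K H => L.ell v F K y * L.vol v K H * L.vol v H G
    + L.vol v F K * L.ell v K H y * L.vol v H G + L.vol v F K * L.vol v K H * L.ell v H G y) _ _
    (nrm_left x) (nrm_right hFG x) (nrm_left z) (nrm_right hFG z)

lemma sum_nrm_self_mul_qfAt (hF : F ∈ L.carrier) (hG : G ∈ L.carrier) (hFG : F ⊂ G)
    (x : Finset E → ℝ) :
    ∑ H ∈ L.between F G, nrm F G v H * L.qfAt v F G H x x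
      = ((L.gap F G : ℝ) - 2) * L.qf v F G x x := by
  rw [L.sum_nrm_mul_qfAt_comm v hFG, qf, Finset.mul_sum]
  refine Finset.sum_congr rfl fun H hH => ?_
  rw [L.qfAt_symm v hH, L.qfAt_self_right v hF hG hH]
  ring

section Atoms

lemma exists_line (hF : F ∈ L.carrier) (hG : G ∈ L.carrier) (h : 2 ≤ L.gap F G)
    (hH : H ∈ L.between F G) (hK : K ∈ L.between F G) (hHr : L.rk H = L.rk F + 1)
    (hKr : L.rk K = L.rk F + 1) (hne : H ≠ K) :
    ∃ M ∈ L.between F G, L.rk M = L.rk F + 2 ∧ H ⊂ M ∧ K ⊂ M ∧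
      ∀ M' ∈ L.between F G, L.rk M' = L.rk F + 2 → H ⊂ M' → K ⊂ M' → M' = M := by
  obtain ⟨h0, h1, h2⟩ := L.mem_between.mp hH
  obtain ⟨k0, k1, k2⟩ := L.mem_between.mp hK
  have hKH : ¬ K ⊆ H := by
    intro hs
    have := L.rk_lt K k0 H h0 (hs.ssubset_of_ne hne.symm)
    omega
  obtain ⟨i, hiK, hiH⟩ := Finset.not_subset.mp hKH
  have hiF : i ∉ F := fun h' => hiH (h1.subset h')
  obtain ⟨M, m0, m1, m2, m3, m4⟩ := L.exists_cover H h0 G hG h2.subset i (k2.subset hiK) hiH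
  obtain ⟨P, p0, p1, p2, p3, p4⟩ := L.exists_cover F hF M m0 (h1.subset.trans m1) i m3 hiF
  have hPK := L.cover_unique F hF P p0 K k0 p1 k1.subset i hiF p3 hiK p4 hKr
  subst hPK
  have hHM : H ⊂ M := ⟨m1, fun h' => hiH (h' m3)⟩
  have hPM : P ⊂ M := p2.ssubset_of_ne (by rintro rfl; omega)
  have hMG : M ⊂ G := m2.ssubset_of_ne (by
    rintro rfl
    unfold gap at h
    omega)
  refine ⟨M, L.mem_between.mpr ⟨m0, h1.trans hHM, hMG⟩, by omega, hHM, hPM, ?_⟩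
  intro M' hM' hr' hHM' hPM'
  exact L.cover_unique H h0 M' (L.mem_between.mp hM').1 M m0 hHM'.subset m1 i hiH
    (hPM'.subset hiK) m3 (by omega) m4

variable [DecidableEq E]

lemma sum_indicator_of_gap_one (hF : F ∈ L.carrier) (hG : G ∈ L.carrier) (hFG : F ⊂ G)
    (h : L.gap F G = 1) {i : E} (hi : i ∈ G) (hiF : i ∉ F) :
    ∑ H ∈ L.between F G, (if i ∈ H then (1 : ℝ) else 0) = 1 := by
  obtain ⟨p, hp, hip, hrp⟩ := L.exists_atom hF hG (by omega) hi hiF hFG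
  rw [Finset.sum_eq_single p]
  · simp [hip]
  · intro q hq hne
    rw [if_neg]
    intro hiq
    have hg := L.gap_add hF hG hq
    obtain ⟨h1, h2, h3⟩ := L.mem_between.mp hq
    obtain ⟨h1', h2', h3'⟩ := L.mem_between.mp hp
    have := L.rk_lt F hF q h1 h2
    refine hne (L.cover_unique F hF q h1 p h1' h2.subset h2'.subset i hiF hiq hip ?_ hrp)
    unfold gap at hg h
    omega
  · exact fun h => absurd hp h

lemma sum_card_of_gap_one (hF : F ∈ L.carrier) (hG : G ∈ L.carrier) (hFG : F ⊂ G)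
    (h : L.gap F G = 1) :
    ∑ H ∈ L.between F G, ((#H : ℝ) - #F) = #G - #F := by
  have e : ∀ H, F ⊆ H → H ⊆ G →
      ((#H : ℝ) - #F) = ∑ i ∈ G \ F, (if i ∈ H then (1 : ℝ) else 0) := by
    intro H h1 h2
    rw [Finset.sum_boole]
    have : {i ∈ G \ F | i ∈ H} = H \ F := by
      ext i
      simp only [mem_filter, mem_sdiff]
      constructor
      · exact fun h => ⟨h.2, h.1.2⟩
      · exact fun h => ⟨⟨h2 h.1, h.2⟩, h.1⟩
    rw [this, Finset.cast_card_sdiff h1]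
  rw [e G hFG.subset subset_rfl]
  rw [Finset.sum_congr rfl fun H hH => e H (L.mem_between.mp hH).2.1.subset
    (L.mem_between.mp hH).2.2.subset, Finset.sum_comm]
  refine Finset.sum_congr rfl fun i hi => ?_
  rw [mem_sdiff] at hi
  rw [L.sum_indicator_of_gap_one hF hG hFG h hi.1 hi.2, if_pos hi.1]

lemma ell_of_gap_one (hF : F ∈ L.carrier) (hG : G ∈ L.carrier) (hFG : F ⊂ G)
    (h : L.gap F G = 1) (x : Finset E → ℝ) :
    L.ell v F G x = ∑ H ∈ L.between F G, (x H - x F) - (x G - x F) := by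
  have hne : (#G : ℝ) - #F ≠ 0 := by
    have := Finset.card_lt_card hFG
    have : (#F : ℝ) < #G := by exact_mod_cast this
    linarith
  have e : ∀ H ∈ L.between F G, nrm F G x H * L.vol v F H * L.vol v H G
      = (x H - x F) - (x G - x F) / (#G - #F) * (#H - #F) := by
    intro H hH
    have hg := L.gap_add hF hG hH
    rw [L.vol_of_gap_eq_zero v (by omega), L.vol_of_gap_eq_zero v (by omega), nrm]
    field_simp
  rw [ell, Finset.sum_congr rfl e, Finset.sum_sub_distrib, ← Finset.mul_sum,
    L.sum_card_of_gap_one hF hG hFG h]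
  field_simp

lemma nrm_indicator_of_mem {i : E} (hi : i ∈ F) (hFG : F ⊆ G) (hFH : F ⊆ H) :
    nrm F G (fun S => if i ∈ S then 1 else 0) H = 0 := by
  simp [nrm, hi, hFG hi, hFH hi]

lemma nrm_indicator_of_notMem {i : E} (hi : i ∉ G) (hFG : F ⊆ G) (hHG : H ⊆ G) :
    nrm F G (fun S => if i ∈ S then 1 else 0) H = 0 := by
  have h1 : i ∉ F := fun h => hi (hFG h)
  have h2 : i ∉ H := fun h => hi (hHG h)
  simp [nrm, hi, h1, h2]

/-- Linear functions are in the kernel of `ell` on intervals of rank at least two. -/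
lemma ell_indicator (hF : F ∈ L.carrier) (hG : G ∈ L.carrier) (hFG : F ⊂ G) (i : E) :
    L.ell v F G (fun S => if i ∈ S then 1 else 0) = 0 := by
  induction hn : L.gap F G using Nat.strong_induction_on generalizing F G with
  | _ n ih =>
  by_cases hi : i ∈ F
  · refine Finset.sum_eq_zero fun H hH => ?_
    obtain ⟨_, h1, h2⟩ := L.mem_between.mp hH
    rw [nrm_indicator_of_mem hi hFG.subset h1.subset]
    ring
  by_cases hi' : i ∈ G
  swap
  · refine Finset.sum_eq_zero fun H hH => ?_
    obtain ⟨_, h1, h2⟩ := L.mem_between.mp hH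
    rw [nrm_indicator_of_notMem hi' hFG.subset h2.subset]
    ring
  rcases Nat.lt_or_ge n 2 with hn2 | hn2
  · interval_cases n
    · simp [ell, L.between_eq_empty hF hG hn]
    · rw [L.ell_of_gap_one v hF hG hFG hn]
      have := L.sum_indicator_of_gap_one hF hG hFG hn hi' hi
      simp only [hi, hi', if_true, if_false, sub_zero]
      rw [this, sub_self]
  · have h1 := L.qf_self_right v hF hG (fun S => if i ∈ S then 1 else 0)
    rw [L.qf_symm v hFG, qf, Finset.sum_eq_zero] at h1
    · have : (L.gap F G : ℝ) - 1 ≠ 0 := by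
        have : (2 : ℝ) ≤ L.gap F G := by rw [hn]; exact_mod_cast hn2
        linarith
      exact (mul_eq_zero.mp h1.symm).resolve_left this
    · intro H hH
      obtain ⟨h0, h1, h2⟩ := L.mem_between.mp hH
      have hg := L.gap_add hF hG hH
      rw [ih _ (by omega) hF h0 h1 rfl, ih _ (by omega) h0 hG h2 rfl]
      ring

end Atoms

end Core

end FlatSystem

/-- Diagonalization of the intersection form of a linear space, with points `P`, lines `M` and
incidence function `θ`. -/
lemma sum_incidence_form {α : Type*} (P M : Finset α) (θ : α → α → ℝ) (x y : α → ℝ)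
    (h1 : ∀ p ∈ P, ∀ q ∈ P, p ≠ q → ∑ l ∈ M, θ p l * θ q l = 1)
    (h2 : ∀ p l, θ p l * θ p l = θ p l) :
    ∑ p ∈ P, x p * (∑ l ∈ M, θ p l * (y l - y p) + y p)
        + ∑ l ∈ M, x l * (∑ p ∈ P, θ p l * y p - y l)
      = (∑ p ∈ P, x p) * (∑ p ∈ P, y p)
        - ∑ l ∈ M, (∑ p ∈ P, θ p l * x p - x l) * (∑ p ∈ P, θ p l * y p - y l) := by
  classical
  have e1 : ∑ l ∈ M, (∑ p ∈ P, θ p l * x p) * (∑ p ∈ P, θ p l * y p)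
      = (∑ p ∈ P, x p) * (∑ p ∈ P, y p) + ∑ p ∈ P, x p * y p * (∑ l ∈ M, θ p l - 1) := by
    simp only [Finset.sum_mul_sum]
    rw [Finset.sum_comm, ← Finset.sum_add_distrib]
    refine Finset.sum_congr rfl fun p hp => ?_
    rw [Finset.sum_comm, ← Finset.add_sum_erase P (fun q => x p * y q) hp,
      ← Finset.add_sum_erase P _ hp]
    have e : ∀ q ∈ P.erase p, ∑ l ∈ M, θ p l * x p * (θ q l * y q) = x p * y q := by
      intro q hq
      rw [Finset.mem_erase] at hq
      rw [← mul_one (x p * y q), ← h1 p hp q hq.2 hq.1.symm, Finset.mul_sum]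
      exact Finset.sum_congr rfl fun l _ => by ring
    rw [Finset.sum_congr rfl e]
    have e' : ∑ l ∈ M, θ p l * x p * (θ p l * y p) = x p * y p * ∑ l ∈ M, θ p l := by
      rw [Finset.mul_sum]
      refine Finset.sum_congr rfl fun l _ => ?_
      linear_combination x p * y p * h2 p l
    rw [e']
    ring
  have e2 : ∑ l ∈ M, (∑ p ∈ P, θ p l * x p - x l) * (∑ p ∈ P, θ p l * y p - y l)
      = ∑ l ∈ M, (∑ p ∈ P, θ p l * x p) * (∑ p ∈ P, θ p l * y p)
        - ∑ p ∈ P, x p * ∑ l ∈ M, θ p l * y l - ∑ l ∈ M, x l * (∑ p ∈ P, θ p l * y p - y l) := by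
    have : ∑ p ∈ P, x p * ∑ l ∈ M, θ p l * y l = ∑ l ∈ M, (∑ p ∈ P, θ p l * x p) * y l := by
      simp only [Finset.mul_sum, Finset.sum_mul]
      rw [Finset.sum_comm]
      exact Finset.sum_congr rfl fun l _ => Finset.sum_congr rfl fun p _ => by ring
    rw [this, ← Finset.sum_sub_distrib, ← Finset.sum_sub_distrib]
    exact Finset.sum_congr rfl fun l _ => by ring
  have e3 : ∑ p ∈ P, x p * (∑ l ∈ M, θ p l * (y l - y p) + y p)
      = ∑ p ∈ P, x p * ∑ l ∈ M, θ p l * y l - ∑ p ∈ P, x p * y p * (∑ l ∈ M, θ p l - 1) := by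
    rw [← Finset.sum_sub_distrib]
    refine Finset.sum_congr rfl fun p _ => ?_
    simp only [mul_sub, Finset.sum_sub_distrib, ← Finset.sum_mul]
    ring
  rw [e1] at e2
  rw [e2, e3]
  ring

/-- Aczél's inequality. -/
lemma aczel_inequality {α : Type*} (M : Finset α) (a b : ℝ) (x y : α → ℝ)
    (h : 0 < b * b - ∑ l ∈ M, y l * y l) :
    (a * a - ∑ l ∈ M, x l * x l) * (b * b - ∑ l ∈ M, y l * y l)
      ≤ (a * b - ∑ l ∈ M, x l * y l) ^ 2 := by
  have hcs := Finset.sum_mul_sq_le_sq_mul_sq M x y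
  simp only [pow_two] at hcs ⊢
  have hY : 0 ≤ ∑ l ∈ M, y l * y l := Finset.sum_nonneg fun i _ => mul_self_nonneg _
  have hX : 0 ≤ ∑ l ∈ M, x l * x l := Finset.sum_nonneg fun i _ => mul_self_nonneg _
  set Y := ∑ l ∈ M, y l * y l
  set X := ∑ l ∈ M, x l * x l
  set S := ∑ l ∈ M, x l * y l
  rcases hY.eq_or_lt with h0 | h0
  · have hS : S = 0 := by
      rw [← h0, mul_zero] at hcs
      exact mul_self_eq_zero.mp (le_antisymm hcs (mul_self_nonneg S))
    rw [hS, ← h0]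
    nlinarith [mul_nonneg hX (mul_self_nonneg b)]
  · have key : Y * ((a * b - S) * (a * b - S) - (a * a - X) * (b * b - Y))
        = (Y * a - b * S) ^ 2 + (b * b - Y) * (X * Y - S * S) := by ring
    have h3 : 0 ≤ Y * ((a * b - S) * (a * b - S) - (a * a - X) * (b * b - Y)) := by
      rw [key]
      have := mul_nonneg h.le (sub_nonneg.mpr hcs)
      positivity
    have := nonneg_of_mul_nonneg_right h3 h0
    linarith

namespace FlatSystem
open Finset

section Core

variable {E : Type*} (L : FlatSystem E) (v : Finset E → ℝ) {F G H K : Finset E}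

/-- The intersection form of an interval of rank three is diagonal of signature `(1, n)`. -/
lemma qf_of_gap_two (hF : F ∈ L.carrier) (hG : G ∈ L.carrier) (hFG : F ⊂ G)
    (h : L.gap F G = 2) (x y : Finset E → ℝ) :
    L.qf v F G x y =
      (∑ p ∈ (L.between F G).filter fun H => L.rk H = L.rk F + 1, nrm F G x p)
          * (∑ p ∈ (L.between F G).filter fun H => L.rk H = L.rk F + 1, nrm F G y p)
        - ∑ l ∈ (L.between F G).filter fun H => ¬ L.rk H = L.rk F + 1,
          L.ell v F l x * L.ell v F l y := by
  classical
  set P := (L.between F G).filter fun H => L.rk H = L.rk F + 1 with hP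
  set M := (L.between F G).filter fun H => ¬ L.rk H = L.rk F + 1 with hM
  set θ : Finset E → Finset E → ℝ := fun p l => if p ⊂ l then 1 else 0 with hθ
  have rkF : ∀ H ∈ L.between F G, L.rk F < L.rk H := fun H hH =>
    L.rk_lt F hF H (L.mem_between.mp hH).1 (L.mem_between.mp hH).2.1
  have rkG : ∀ H ∈ L.between F G, L.rk H < L.rk G := fun H hH =>
    L.rk_lt H (L.mem_between.mp hH).1 G hG (L.mem_between.mp hH).2.2
  have hrk : L.rk G = L.rk F + 3 := by unfold gap at h; omega
  have hMr : ∀ l ∈ M, L.rk l = L.rk F + 2 := by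
    intro l hl
    rw [hM, mem_filter] at hl
    have := rkF l hl.1
    have := rkG l hl.1
    omega
  have hPr : ∀ p ∈ P, L.rk p = L.rk F + 1 := fun p hp => (mem_filter.mp hp).2
  have hPb : ∀ p ∈ P, p ∈ L.between F G := fun p hp => (mem_filter.mp hp).1
  have hMb : ∀ l ∈ M, l ∈ L.between F G := fun l hl => (mem_filter.mp hl).1
  have bl : ∀ l ∈ M, L.between F l = P.filter fun p => p ⊂ l := by
    intro l hl
    ext p
    simp only [hP, mem_filter, L.mem_between]
    have hl' := L.mem_between.mp (hMb l hl)
    constructor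
    · rintro ⟨h1, h2, h3⟩
      have := L.rk_lt F hF p h1 h2
      have := L.rk_lt p h1 l hl'.1 h3
      have := hMr l hl
      exact ⟨⟨⟨h1, h2, h3.trans hl'.2.2⟩, by omega⟩, h3⟩
    · rintro ⟨⟨⟨h1, h2, _⟩, _⟩, h3⟩
      exact ⟨h1, h2, h3⟩
  have bp : ∀ p ∈ P, L.between p G = M.filter fun l => p ⊂ l := by
    intro p hp
    ext l
    simp only [hM, mem_filter, L.mem_between]
    have hp' := L.mem_between.mp (hPb p hp)
    constructor
    · rintro ⟨h1, h2, h3⟩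
      have := L.rk_lt p hp'.1 l h1 h2
      have := hPr p hp
      exact ⟨⟨⟨h1, hp'.2.1.trans h2, h3⟩, by omega⟩, h2⟩
    · rintro ⟨⟨⟨h1, _, h2⟩, _⟩, h3⟩
      exact ⟨h1, h3, h2⟩
  have ell_l : ∀ z, ∀ l ∈ M, L.ell v F l z = ∑ p ∈ P, θ p l * nrm F G z p - nrm F G z l := by
    intro z l hl
    have hl' := L.mem_between.mp (hMb l hl)
    rw [← L.ell_nrm v hl'.2.1 z (F' := F) (G' := G), L.ell_of_gap_one v hF hl'.1 hl'.2.1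
      (by unfold gap; have := hMr l hl; omega), bl l hl, Finset.sum_filter, nrm_left]
    simp [hθ]
  have ell_p : ∀ z, ∀ p ∈ P, L.ell v p G z
      = ∑ l ∈ M, θ p l * (nrm F G z l - nrm F G z p) + nrm F G z p := by
    intro z p hp
    have hp' := L.mem_between.mp (hPb p hp)
    rw [← L.ell_nrm v hp'.2.2 z (F' := F) (G' := G), L.ell_of_gap_one v hp'.1 hG hp'.2.2
      (by unfold gap; have := hPr p hp; omega), bp p hp, Finset.sum_filter, nrm_right hFG]
    simp [hθ]
  rw [qf, ← Finset.sum_filter_add_sum_filter_not (L.between F G)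
    (fun H => L.rk H = L.rk F + 1)]
  have t1 : ∀ p ∈ P, nrm F G x p * (L.ell v F p y * L.vol v p G + L.vol v F p * L.ell v p G y)
      = nrm F G x p * (∑ l ∈ M, θ p l * (nrm F G y l - nrm F G y p) + nrm F G y p) := by
    intro p hp
    have g0 : L.gap F p = 0 := by unfold gap; have := hPr p hp; omega
    rw [L.vol_of_gap_eq_zero v g0, ell,
      L.between_eq_empty hF (L.mem_between.mp (hPb p hp)).1 g0, ell_p y p hp]
    simp
  have t2 : ∀ l ∈ M, nrm F G x l * (L.ell v F l y * L.vol v l G + L.vol v F l * L.ell v l G y)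
      = nrm F G x l * (∑ p ∈ P, θ p l * nrm F G y p - nrm F G y l) := by
    intro l hl
    have g0 : L.gap l G = 0 := by unfold gap; have := hMr l hl; omega
    rw [L.vol_of_gap_eq_zero v g0, ell.eq_def L v l G,
      L.between_eq_empty (L.mem_between.mp (hMb l hl)).1 hG g0, ell_l y l hl]
    simp
  have t3 : ∀ l ∈ M, L.ell v F l x * L.ell v F l y
      = (∑ p ∈ P, θ p l * nrm F G x p - nrm F G x l)
        * (∑ p ∈ P, θ p l * nrm F G y p - nrm F G y l) := fun l hl => by
    rw [ell_l x l hl, ell_l y l hl]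
  rw [Finset.sum_congr rfl t1, Finset.sum_congr rfl t2, Finset.sum_congr rfl t3]
  refine sum_incidence_form P M θ _ _ ?_ ?_
  · intro p hp q hq hne
    obtain ⟨m, m1, m2, m3, m4, m5⟩ := L.exists_line hF hG h.ge (hPb p hp) (hPb q hq)
      (hPr p hp) (hPr q hq) hne
    have hm : m ∈ M := mem_filter.mpr ⟨m1, by omega⟩
    rw [Finset.sum_eq_single m]
    · simp [hθ, m3, m4]
    · intro l hl hlm
      by_cases hpl : p ⊂ l
      · by_cases hql : q ⊂ l
        · exact absurd (m5 l (hMb l hl) (hMr l hl) hpl hql) hlm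
        · simp [hθ, hql]
      · simp [hθ, hpl]
    · exact fun h => absurd hm h
  · intro p l
    by_cases hpl : p ⊂ l <;> simp [hθ, hpl]

lemma vol_pos (hv : ∀ F ∈ L.carrier, ∀ G ∈ L.carrier, ∀ H ∈ L.between F G, 0 < nrm F G v H)
    (hF : F ∈ L.carrier) (hG : G ∈ L.carrier) (hFG : F ⊂ G) : 0 < L.vol v F G := by
  induction hn : L.gap F G using Nat.strong_induction_on generalizing F G with
  | _ n ih =>
  rcases Nat.eq_zero_or_pos n with rfl | hpos
  · rw [L.vol_of_gap_eq_zero v hn]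
    exact one_pos
  · have h1 := L.ell_self v hF hG
    have h2 : 0 < L.ell v F G v := by
      refine Finset.sum_pos (fun H hH => ?_) (L.between_nonempty hF hG (by omega) hFG)
      obtain ⟨h0, h1, h2⟩ := L.mem_between.mp hH
      have hg := L.gap_add hF hG hH
      exact mul_pos (mul_pos (hv F hF G hG H hH) (ih _ (by omega) hF h0 h1 rfl))
        (ih _ (by omega) h0 hG h2 rfl)
    rw [h1] at h2
    exact pos_of_mul_pos_right h2 (Nat.cast_nonneg _)

end Core
end FlatSystem

/-- Adding two Hodge-Riemann inequalities of degrees `a` and `b`. -/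
lemma hodge_riemann_product {a b : ℕ} {m n p q e f : ℝ} (hm : 0 < m) (hn : 0 < n)
    (h1 : a * m * p ≤ (a - 1) * e ^ 2) (h2 : b * n * q ≤ (b - 1) * f ^ 2)
    (ha : a = 0 → e = 0 ∧ p = 0) (hb : b = 0 → f = 0 ∧ q = 0) :
    ((a : ℝ) + b) * (m * n) * (p * n + e * f + e * f + m * q)
      ≤ ((a : ℝ) + b - 1) * (e * n + m * f) ^ 2 := by
  rcases Nat.eq_zero_or_pos a with rfl | ha'
  · obtain ⟨rfl, rfl⟩ := ha rfl
    have := mul_le_mul_of_nonneg_left h2 (sq_nonneg m)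
    push_cast
    nlinarith
  rcases Nat.eq_zero_or_pos b with rfl | hb'
  · obtain ⟨rfl, rfl⟩ := hb rfl
    have := mul_le_mul_of_nonneg_left h1 (sq_nonneg n)
    push_cast
    nlinarith
  have hA : (0 : ℝ) < a := by exact_mod_cast ha'
  have hB : (0 : ℝ) < b := by exact_mod_cast hb'
  generalize (a : ℝ) = A at *
  generalize (b : ℝ) = B at *
  refine le_of_mul_le_mul_left ?_ (mul_pos hA hB)
  have e1 := mul_le_mul_of_nonneg_left h1 (show 0 ≤ (A + B) * B * n ^ 2 by positivity)
  have e2 := mul_le_mul_of_nonneg_left h2 (show 0 ≤ (A + B) * A * m ^ 2 by positivity)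
  nlinarith [sq_nonneg (B * (e * n) - A * (m * f))]

namespace FlatSystem
open Finset

section HodgeRiemann

variable {E : Type*} (L : FlatSystem E) (v : Finset E → ℝ) {F G H K : Finset E}

open scoped Classical in
/-- Extension by zero of a function on the members strictly between `F` and `G`. -/
noncomputable def extend (F G : Finset E) : ({H // H ∈ L.between F G} → ℝ) →ₗ[ℝ] Finset E → ℝ where
  toFun u S := if h : S ∈ L.between F G then u ⟨S, h⟩ else 0
  map_add' u w := by
    ext S
    by_cases h : S ∈ L.between F G <;> simp [h]
  map_smul' c u := by
    ext S
    by_cases h : S ∈ L.between F G <;> simp [h]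

lemma extend_coe (u : {H // H ∈ L.between F G} → ℝ) (H : {H // H ∈ L.between F G}) :
    L.extend F G u H = u H := by
  simp [extend]

lemma extend_of_notMem (u : {H // H ∈ L.between F G} → ℝ) (h : H ∉ L.between F G) :
    L.extend F G u H = 0 := by
  simp [extend, h]

lemma left_notMem_between : F ∉ L.between F G := fun h => (L.mem_between.mp h).2.1.ne rfl

lemma right_notMem_between : G ∉ L.between F G := fun h => (L.mem_between.mp h).2.2.ne rfl

lemma nrm_extend (u : {H // H ∈ L.between F G} → ℝ) (H : {H // H ∈ L.between F G}) :
    nrm F G (L.extend F G u) H = u H := by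
  rw [nrm, L.extend_of_notMem u L.left_notMem_between,
    L.extend_of_notMem u L.right_notMem_between, extend_coe]
  ring

lemma nrm_extend_restrict (x : Finset E → ℝ) (hFG : F ⊂ G) (h0 : H ∈ L.carrier) (h1 : F ⊆ H)
    (h2 : H ⊆ G) : L.extend F G (fun H => nrm F G x H) H = nrm F G x H := by
  by_cases h : H ∈ L.between F G
  · exact L.extend_coe _ ⟨H, h⟩
  · rw [L.extend_of_notMem _ h]
    rcases h1.eq_or_ssubset with rfl | h1
    · rw [nrm_left]
    rcases h2.eq_or_ssubset with rfl | h2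
    · rw [nrm_right hFG]
    exact absurd (L.mem_between.mpr ⟨h0, h1, h2⟩) h

/-- The derivative of `ell` in the direction of the indicator function of `H`. -/
noncomputable def ellAt (F G H : Finset E) : (Finset E → ℝ) →ₗ[ℝ] ℝ where
  toFun x := L.ell v F H x * L.vol v H G + L.vol v F H * L.ell v H G x
  map_add' x y := by
    rw [ell_add, ell_add]
    ring
  map_smul' c x := by
    rw [ell_smul, ell_smul]
    simp only [RingHom.id_apply, smul_eq_mul]
    ring

lemma ellAt_apply (F G H : Finset E) (x : Finset E → ℝ) :
    L.ellAt v F G H x = L.ell v F H x * L.vol v H G + L.vol v F H * L.ell v H G x := rfl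

lemma ellAt_congr {x y : Finset E → ℝ} (hF : F ∈ L.carrier) (hG : G ∈ L.carrier)
    (hH : H ∈ L.between F G) (h : ∀ K ∈ L.carrier, F ⊆ K → K ⊆ G → x K = y K) :
    L.ellAt v F G H x = L.ellAt v F G H y := by
  obtain ⟨h0, h1, h2⟩ := L.mem_between.mp hH
  rw [ellAt_apply, ellAt_apply, L.ell_congr v (x := x) (y := y), L.ell_congr v (x := x) (y := y)]
  all_goals
    intro K hK
    obtain ⟨k0, k1, k2⟩ := L.mem_between.mp hK
  · rw [nrm, nrm, h K k0 (h1.trans k1).subset k2.subset, h H h0 h1.subset h2.subset,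
      h G hG (h1.trans h2).subset subset_rfl]
  · rw [nrm, nrm, h K k0 k1.subset (k2.trans h2).subset, h H h0 h1.subset h2.subset,
      h F hF subset_rfl (h1.trans h2).subset]

lemma qf_eq_sum_ellAt (x y : Finset E → ℝ) :
    L.qf v F G x y = ∑ H ∈ L.between F G, nrm F G x H * L.ellAt v F G H y := rfl

lemma ellAt_nrm (hH : H ∈ L.between F G) (x : Finset E → ℝ) {F' G' : Finset E} :
    L.ellAt v F G H (nrm F' G' x) = L.ellAt v F G H x := by
  obtain ⟨h0, h1, h2⟩ := L.mem_between.mp hH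
  rw [ellAt_apply, ellAt_apply, L.ell_nrm v h1, L.ell_nrm v h2]

open scoped Classical in
/-- The Hessian of `qf` on functions vanishing at `F` and `G`. -/
noncomputable def hessian (F G : Finset E) :
    Matrix {H // H ∈ L.between F G} {H // H ∈ L.between F G} ℝ :=
  fun H K => L.ellAt v F G H (L.extend F G (Pi.single K 1))

lemma hessian_mulVec (u : {H // H ∈ L.between F G} → ℝ) (H : {H // H ∈ L.between F G}) :
    (L.hessian v F G).mulVec u H = L.ellAt v F G H (L.extend F G u) := by
  classical
  have := LinearMap.pi_apply_eq_sum_univ ((L.ellAt v F G H) ∘ₗ (L.extend F G)) u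
  rw [LinearMap.comp_apply] at this
  rw [this, Matrix.mulVec, dotProduct]
  refine Finset.sum_congr rfl fun K _ => ?_
  rw [smul_eq_mul, mul_comm, hessian, LinearMap.comp_apply]
  congr 4
  ext J
  by_cases h : K = J
  · subst h; simp
  · simp [h, Ne.symm h]

lemma dotProduct_hessian_mulVec (u w : {H // H ∈ L.between F G} → ℝ) :
    dotProduct u ((L.hessian v F G).mulVec w) = L.qf v F G (L.extend F G u) (L.extend F G w) := by
  rw [qf_eq_sum_ellAt, ← Finset.sum_coe_sort, dotProduct]
  exact Finset.sum_congr rfl fun H _ => by rw [hessian_mulVec, nrm_extend]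

lemma hessian_isSymm (hFG : F ⊂ G) : (L.hessian v F G).IsSymm := by
  classical
  ext H K
  have h1 := L.dotProduct_hessian_mulVec v (Pi.single H 1) (Pi.single K 1)
  have h2 := L.dotProduct_hessian_mulVec v (Pi.single K 1) (Pi.single H 1)
  rw [L.qf_symm v hFG, ← h2] at h1
  simpa using h1.symm

open scoped Classical in
lemma ell_extend_single {A B : Finset E}
    (K : {H // H ∈ L.between F G}) (hA : A ≠ K) (hB : B ≠ K) :
    L.ell v A B (L.extend F G (Pi.single K 1))
      = if K.1 ∈ L.between A B then L.vol v A K * L.vol v K B else 0 := by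
  classical
  have e : ∀ M : Finset E, L.extend F G (Pi.single K 1) M = if M = K then 1 else 0 := by
    intro M
    by_cases h : M ∈ L.between F G
    · rw [show M = ((⟨M, h⟩ : {H // H ∈ L.between F G}) : Finset E) from rfl, extend_coe]
      simp [Pi.single_apply, Subtype.ext_iff]
    · rw [L.extend_of_notMem _ h, if_neg]
      rintro rfl
      exact h K.2
  rw [ell]
  simp only [nrm, e, if_neg hA, if_neg hB, sub_zero, zero_mul, ite_mul, one_mul]
  rw [Finset.sum_ite_eq']

open scoped Classical in
lemma hessian_of_ne (H K : {H // H ∈ L.between F G}) (hne : H ≠ K) :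
    L.hessian v F G H K =
      (if K.1 ∈ L.between F H then L.vol v F K * L.vol v K H else 0) * L.vol v H G
        + L.vol v F H * if K.1 ∈ L.between H G then L.vol v H K * L.vol v K G else 0 := by
  have hne' : H.1 ≠ K.1 := fun h => hne (Subtype.ext h)
  have hF : F ≠ K.1 := by
    intro h
    have := K.2
    rw [← h] at this
    exact L.left_notMem_between this
  have hG : G ≠ K.1 := by
    intro h
    have := K.2
    rw [← h] at this
    exact L.right_notMem_between this
  rw [hessian, ellAt_apply, L.ell_extend_single v K hF hne', L.ell_extend_single v K hne' hG]

/-- The Hodge-Riemann inequality for strictly superadditive `v`. -/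
lemma hodge_riemann_of_pos
    (hv : ∀ F ∈ L.carrier, ∀ G ∈ L.carrier, ∀ H ∈ L.between F G, 0 < nrm F G v H)
    (hF : F ∈ L.carrier) (hG : G ∈ L.carrier) (hFG : F ⊂ G) (x : Finset E → ℝ) :
    (L.gap F G : ℝ) * L.vol v F G * L.qf v F G x x ≤ (L.gap F G - 1) * L.ell v F G x ^ 2 := by
  classical
  have h_ell0 : ∀ {A B : Finset E}, A ∈ L.carrier → B ∈ L.carrier → L.gap A B = 0 →
      ∀ y, L.ell v A B y = 0 := by
    intro A B hA hB h y
    rw [ell, L.between_eq_empty hA hB h, Finset.sum_empty]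
  have h_qf0 : ∀ {A B : Finset E}, A ∈ L.carrier → B ∈ L.carrier → L.gap A B = 0 →
      ∀ y, L.qf v A B y y = 0 := by
    intro A B hA hB h y
    rw [qf, L.between_eq_empty hA hB h, Finset.sum_empty]
  induction hn : L.gap F G using Nat.strong_induction_on generalizing F G x with
  | _ n ih =>
  rcases Nat.eq_zero_or_pos n with rfl | hpos
  · simp [h_ell0 hF hG hn]
  have hvol := L.vol_pos v hv hF hG hFG
  have hxv := L.qf_self_right v hF hG x
  have hvv := L.qf_self_right v hF hG v
  rw [L.ell_self v hF hG] at hvv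
  rcases (show n = 1 ∨ n = 2 ∨ 3 ≤ n by omega) with rfl | rfl | h3
  · have : L.qf v F G x x = 0 := by
      rw [qf]
      refine Finset.sum_eq_zero fun H hH => ?_
      have hg := L.gap_add hF hG hH
      have h0 := (L.mem_between.mp hH).1
      rw [h_ell0 hF h0 (by omega), h_ell0 h0 hG (by omega)]
      ring
    rw [this]
    simp
  · have hac := aczel_inequality ((L.between F G).filter fun H => ¬ L.rk H = L.rk F + 1)
      (∑ p ∈ (L.between F G).filter fun H => L.rk H = L.rk F + 1, nrm F G x p)
      (∑ p ∈ (L.between F G).filter fun H => L.rk H = L.rk F + 1, nrm F G v p)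
      (fun l => L.ell v F l x) (fun l => L.ell v F l v)
    rw [← L.qf_of_gap_two v hF hG hFG hn, ← L.qf_of_gap_two v hF hG hFG hn,
      ← L.qf_of_gap_two v hF hG hFG hn, hxv, hvv, hn] at hac
    push_cast at hac ⊢
    have := hac (by nlinarith)
    nlinarith
  · have h3' : (3 : ℝ) ≤ n := by exact_mod_cast h3
    rw [hn] at hxv hvv
    have hP : ∀ H ∈ L.between F G, 0 < L.vol v F H ∧ 0 < L.vol v H G := fun H hH =>
      have h := L.mem_between.mp hH
      ⟨L.vol_pos v hv hF h.1 h.2.1, L.vol_pos v hv h.1 hG h.2.2⟩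
    have hres : ∀ y, ∀ H ∈ L.between F G,
        L.ellAt v F G H (L.extend F G fun H => nrm F G y H) = L.ellAt v F G H y := by
      intro y H hH
      rw [← L.ellAt_nrm v hH y (F' := F) (G' := G)]
      exact L.ellAt_congr v hF hG hH fun K k0 k1 k2 => L.nrm_extend_restrict y hFG k0 k1 k2
    have hqf : ∀ y z, L.qf v F G (L.extend F G fun H => nrm F G y H)
        (L.extend F G fun H => nrm F G z H) = L.qf v F G y z := by
      intro y z
      rw [qf_eq_sum_ellAt, qf_eq_sum_ellAt]
      refine Finset.sum_congr rfl fun H hH => ?_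
      rw [hres z H hH, L.nrm_extend _ ⟨H, hH⟩]
    have key := reverse_cauchy_of_perron (L.hessian v F G) (L.hessian_isSymm v hFG)
      (fun H => nrm F G v H)
      (fun H => ((n : ℝ) - 1) * (L.vol v F H * L.vol v H G) / nrm F G v H)
      (fun H => hv F hF G hG H H.2)
      (fun H => by
        have := hv F hF G hG H H.2
        have : (0 : ℝ) < n - 1 := by linarith
        obtain ⟨h1, h2⟩ := hP H H.2
        positivity)
      ?_ ?_ ?_ ?_ (fun H => nrm F G x H)
    · rw [dotProduct_hessian_mulVec, dotProduct_hessian_mulVec, dotProduct_hessian_mulVec,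
        hqf, hqf, hqf, hxv, hvv] at key
      have h1 : (0 : ℝ) < n - 1 := by linarith
      refine le_of_mul_le_mul_left ?_ h1
      linarith
    · intro H K hne
      rw [L.hessian_of_ne v H K hne]
      obtain ⟨h1, h2⟩ := hP H H.2
      obtain ⟨k1, k2⟩ := hP K K.2
      have h0 := L.mem_between.mp H.2
      have k0 := L.mem_between.mp K.2
      split_ifs with c1 c2 c2
      · exact absurd ((L.mem_between.mp c1).2.2.trans (L.mem_between.mp c2).2.1) (irrefl _)
      · have := L.vol_pos v hv k0.1 h0.1 (L.mem_between.mp c1).2.2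
        positivity
      · have := L.vol_pos v hv h0.1 k0.1 (L.mem_between.mp c2).2.1
        positivity
      · simp
    · intro H
      rw [hessian_mulVec, hres v H H.2, ellAt_apply]
      have h0 := L.mem_between.mp H.2
      rw [L.ell_self v hF h0.1, L.ell_self v h0.1 hG]
      have hg := L.gap_add hF hG H.2
      rw [hn] at hg
      have := hv F hF G hG H H.2
      rw [← hg]
      push_cast
      field_simp
      ring
    · intro u hu
      have hlt : ∀ H K : {H // H ∈ L.between F G}, K.1 ⊂ H.1 → u H = u K := by
        intro H K hKH
        refine hu H K (fun h => hKH.ne (by rw [h])) ?_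
        have h0 := L.mem_between.mp H.2
        have k0 := L.mem_between.mp K.2
        rw [L.hessian_of_ne v H K (fun h => hKH.ne (by rw [h])),
          if_pos (L.mem_between.mpr ⟨k0.1, k0.2.1, hKH⟩),
          if_neg (fun h => (hKH.trans (L.mem_between.mp h).2.1).ne rfl)]
        obtain ⟨h1, h2⟩ := hP H H.2
        obtain ⟨k1, k2⟩ := hP K K.2
        have := L.vol_pos v hv k0.1 h0.1 hKH
        positivity
      have hatom : ∀ H : {H // H ∈ L.between F G}, ∃ P : {H // H ∈ L.between F G},
          L.rk P = L.rk F + 1 ∧ u H = u P := by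
        intro H
        have h0 := L.mem_between.mp H.2
        by_cases hr : L.gap F H = 0
        · refine ⟨H, ?_, rfl⟩
          have := L.rk_lt F hF H h0.1 h0.2.1
          unfold gap at hr
          omega
        · obtain ⟨i, hi, hiF⟩ := Finset.exists_of_ssubset h0.2.1
          obtain ⟨P, hP, _, hPr⟩ := L.exists_atom hF h0.1 hr hi hiF h0.2.1
          have p0 := L.mem_between.mp hP
          exact ⟨⟨P, L.mem_between.mpr ⟨p0.1, p0.2.1, p0.2.2.trans h0.2.2⟩⟩, hPr,
            hlt H _ p0.2.2⟩
      intro H K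
      obtain ⟨P, hPr, hHP⟩ := hatom H
      obtain ⟨Q, hQr, hKQ⟩ := hatom K
      rw [hHP, hKQ]
      by_cases hPQ : P = Q
      · rw [hPQ]
      obtain ⟨M, hM, _, h1, h2, _⟩ := L.exists_line hF hG (by omega) P.2 Q.2 hPr hQr
        (fun h => hPQ (Subtype.ext h))
      rw [← hlt ⟨M, hM⟩ P h1, hlt ⟨M, hM⟩ Q h2]
    · intro u
      rw [dotProduct_hessian_mulVec]
      have hs := L.sum_nrm_self_mul_qfAt v hF hG hFG (L.extend F G u)
      rw [hn] at hs
      have h2 : (0 : ℝ) < n - 2 := by linarith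
      have h1 : (0 : ℝ) < n - 1 := by linarith
      refine le_of_mul_le_mul_left ?_ h2
      rw [← hs, Finset.mul_sum, ← Finset.sum_coe_sort]
      refine Finset.sum_le_sum fun H _ => ?_
      rw [hessian_mulVec]
      have h0 := L.mem_between.mp H.2
      obtain ⟨p1, p2⟩ := hP H H.2
      have hvH := hv F hF G hG H H.2
      have hg := L.gap_add hF hG H.2
      rw [hn] at hg
      have hp := hodge_riemann_product p1 p2
        (ih _ (by omega) hF h0.1 h0.2.1 (L.extend F G u) rfl)
        (ih _ (by omega) h0.1 hG h0.2.2 (L.extend F G u) rfl)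
        (fun h => ⟨h_ell0 hF h0.1 h _, h_qf0 hF h0.1 h _⟩)
        (fun h => ⟨h_ell0 h0.1 hG h _, h_qf0 h0.1 hG h _⟩)
      have hgr : (L.gap F H : ℝ) + L.gap H G = n - 1 := by
        rw [← hg]
        push_cast
        ring
      rw [hgr] at hp
      rw [ellAt_apply, qfAt, div_div_eq_mul_div, ← mul_div_assoc, le_div_iff₀ (by positivity)]
      have := mul_le_mul_of_nonneg_left hp hvH.le
      linarith

end HodgeRiemann

end FlatSystem

namespace FlatSystem
open Finset Filter Topology

section Limit

variable {E : Type*} (L : FlatSystem E) {F G H K : Finset E}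

lemma continuous_nrm {v : ℝ → Finset E → ℝ} (hv : ∀ S, Continuous fun t => v t S) :
    Continuous fun t => nrm F G (v t) H := by
  have := hv F
  have := hv G
  have := hv H
  unfold nrm
  fun_prop

lemma continuous_vol {v : ℝ → Finset E → ℝ} (hv : ∀ S, Continuous fun t => v t S)
    (hF : F ∈ L.carrier) (hG : G ∈ L.carrier) : Continuous fun t => L.vol (v t) F G := by
  induction hn : L.gap F G using Nat.strong_induction_on generalizing F G with
  | _ n ih =>
  by_cases h : L.gap F G = 0
  · simp only [fun t => L.vol_of_gap_eq_zero (v t) h]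
    exact continuous_const
  · have e : ∀ t, L.vol (v t) F G = (∑ H : {H // H ∈ L.between F G},
        nrm F G (v t) H * L.vol (v t) F H * L.vol (v t) H G) / L.gap F G := fun t => by
      rw [vol, if_neg h]
    simp only [e]
    refine Continuous.div_const (continuous_finsetSum _ fun H _ => ?_) _
    have hg := L.gap_add hF hG H.2
    have h0 := (L.mem_between.mp H.2).1
    exact ((continuous_nrm hv).mul (ih _ (by omega) hF h0 rfl)).mul (ih _ (by omega) h0 hG rfl)

lemma continuous_ell {v : ℝ → Finset E → ℝ} (hv : ∀ S, Continuous fun t => v t S)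
    (hF : F ∈ L.carrier) (hG : G ∈ L.carrier) (x : Finset E → ℝ) :
    Continuous fun t => L.ell (v t) F G x := by
  refine continuous_finsetSum _ fun H hH => ?_
  have h0 := (L.mem_between.mp hH).1
  exact (continuous_const.mul (L.continuous_vol hv hF h0)).mul (L.continuous_vol hv h0 hG)

lemma continuous_qf {v : ℝ → Finset E → ℝ} (hv : ∀ S, Continuous fun t => v t S)
    (hF : F ∈ L.carrier) (hG : G ∈ L.carrier) (x y : Finset E → ℝ) :
    Continuous fun t => L.qf (v t) F G x y := by
  refine continuous_finsetSum _ fun H hH => ?_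
  have h0 := (L.mem_between.mp hH).1
  exact continuous_const.mul (((L.continuous_ell hv hF h0 y).mul (L.continuous_vol hv h0 hG)).add
    ((L.continuous_vol hv hF h0).mul (L.continuous_ell hv h0 hG y)))

/-- The indicator function of the nonempty sets. -/
noncomputable def posInd (S : Finset E) : ℝ := if S.Nonempty then 1 else 0

lemma posInd_of_nonempty (h : F.Nonempty) : posInd F = 1 := if_pos h

lemma posInd_empty : posInd (∅ : Finset E) = 0 := by simp [posInd]

lemma nrm_posInd_of_nonempty (hF : F.Nonempty) (hFG : F ⊆ G) (hFH : F ⊆ H) :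
    nrm F G posInd H = 0 := by
  simp [nrm, posInd_of_nonempty hF, posInd_of_nonempty (hF.mono hFG),
    posInd_of_nonempty (hF.mono hFH)]

lemma nrm_posInd_nonneg (hFH : F ⊂ H) (hHG : H ⊂ G) : 0 ≤ nrm F G posInd H := by
  rcases F.eq_empty_or_nonempty with rfl | hF
  · have hH := Finset.empty_ssubset.mp hFH
    have hG := Finset.empty_ssubset.mp (hFH.trans hHG)
    rw [nrm, posInd_empty, posInd_of_nonempty hH, posInd_of_nonempty hG]
    simp only [card_empty, Nat.cast_zero, sub_zero, one_mul]
    have : (#H : ℝ) / #G ≤ 1 :=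
      div_le_one_of_le₀ (by exact_mod_cast Finset.card_le_card hHG.subset) (Nat.cast_nonneg _)
    linarith
  · exact (nrm_posInd_of_nonempty hF (hFH.trans hHG).subset hFH.subset).ge

/-- A strictly superadditive perturbation of `posInd`. -/
noncomputable def perturb (t : ℝ) (S : Finset E) : ℝ := posInd S - t * (#S : ℝ) ^ 2

lemma perturb_zero : perturb 0 = posInd (E := E) := by
  ext S
  simp [perturb]

lemma continuous_perturb (S : Finset E) : Continuous fun t => perturb t S := by
  unfold perturb
  fun_prop

lemma nrm_perturb_pos {t : ℝ} (ht : 0 < t) (hFH : F ⊂ H) (hHG : H ⊂ G) :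
    0 < nrm F G (perturb t) H := by
  have h1 : (#F : ℝ) < #H := by exact_mod_cast Finset.card_lt_card hFH
  have h2 : (#H : ℝ) < #G := by exact_mod_cast Finset.card_lt_card hHG
  have h3 : (#G : ℝ) - #F ≠ 0 := by linarith
  have e : nrm F G (perturb t) H = nrm F G posInd H + t * ((#H - #F) * (#G - #H)) := by
    simp only [nrm, perturb]
    field_simp
    ring
  rw [e]
  have := nrm_posInd_nonneg hFH hHG
  have : 0 < t * (((#H : ℝ) - #F) * (#G - #H)) :=
    mul_pos ht (mul_pos (by linarith) (by linarith))
  linarith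

lemma vol_posInd_nonneg (hF : F ∈ L.carrier) (hG : G ∈ L.carrier) (hFG : F ⊂ G) :
    0 ≤ L.vol posInd F G := by
  have hc := (L.continuous_vol continuous_perturb hF hG).tendsto 0
  rw [perturb_zero] at hc
  refine ge_of_tendsto (hc.mono_left (nhdsWithin_le_nhds (s := Set.Ioi 0))) ?_
  filter_upwards [self_mem_nhdsWithin] with t ht
  exact (L.vol_pos _ (fun F _ G _ H hH => nrm_perturb_pos ht (L.mem_between.mp hH).2.1
    (L.mem_between.mp hH).2.2) hF hG hFG).le

lemma hodge_riemann_posInd (hF : F ∈ L.carrier) (hG : G ∈ L.carrier) (hFG : F ⊂ G)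
    (x : Finset E → ℝ) :
    (L.gap F G : ℝ) * L.vol posInd F G * L.qf posInd F G x x
      ≤ (L.gap F G - 1) * L.ell posInd F G x ^ 2 := by
  have c1 := L.continuous_vol continuous_perturb hF hG
  have c2 := L.continuous_ell continuous_perturb hF hG x
  have c3 := L.continuous_qf continuous_perturb hF hG x x
  have l := ((continuous_const (y := (L.gap F G : ℝ))).mul c1).mul c3 |>.tendsto 0
  have r := (continuous_const (y := (L.gap F G : ℝ) - 1)).mul (c2.pow 2) |>.tendsto 0
  simp only [Pi.mul_apply, Pi.pow_apply, perturb_zero] at l r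
  refine le_of_tendsto_of_tendsto (l.mono_left (nhdsWithin_le_nhds (s := Set.Ioi 0)))
    (r.mono_left nhdsWithin_le_nhds) ?_
  filter_upwards [self_mem_nhdsWithin] with t ht
  exact L.hodge_riemann_of_pos _ (fun F _ G _ H hH => nrm_perturb_pos ht
    (L.mem_between.mp hH).2.1 (L.mem_between.mp hH).2.2) hF hG hFG x

lemma vol_posInd_of_nonempty (hF : F ∈ L.carrier) (hG : G ∈ L.carrier) (hne : F.Nonempty) :
    L.vol posInd F G = if L.gap F G = 0 then 1 else 0 := by
  split_ifs with h
  · exact L.vol_of_gap_eq_zero _ h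
  · have h1 := L.ell_self posInd hF hG
    rw [ell, Finset.sum_eq_zero] at h1
    · exact (mul_eq_zero.mp h1.symm).resolve_left (by exact_mod_cast h)
    · intro H hH
      obtain ⟨_, h1, h2⟩ := L.mem_between.mp hH
      rw [nrm_posInd_of_nonempty hne (h1.trans h2).subset h1.subset]
      ring

/-- The absolute value of the Möbius function of the interval `[∅, F]`. -/
noncomputable def absMoebius (F : Finset E) : ℝ := (L.gap ∅ F).factorial * L.vol posInd ∅ F

lemma absMoebius_empty : L.absMoebius ∅ = 1 := by
  have h : L.gap ∅ ∅ = 0 := by unfold gap; omega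
  simp [absMoebius, h, L.vol_of_gap_eq_zero _ h]

lemma absMoebius_nonneg (hF : F ∈ L.carrier) : 0 ≤ L.absMoebius F := by
  rcases F.eq_empty_or_nonempty with rfl | hne
  · rw [absMoebius_empty]
    exact zero_le_one
  · exact mul_nonneg (Nat.cast_nonneg _)
      (L.vol_posInd_nonneg L.bot_mem hF (Finset.empty_ssubset.mpr hne))

lemma rk_pos (hF : F ∈ L.carrier) (hne : F.Nonempty) : 0 < L.rk F := by
  have := L.rk_lt ∅ L.bot_mem F hF (Finset.empty_ssubset.mpr hne)
  omega

lemma rk_le (hF : F ∈ L.carrier) (hG : G ∈ L.carrier) (hFG : F ⊆ G) : L.rk F ≤ L.rk G := by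
  rcases hFG.eq_or_ssubset with rfl | h
  · exact le_rfl
  · exact (L.rk_lt F hF G hG h).le

open scoped Classical in
lemma ell_posInd_indicator (hG : G ∈ L.carrier) (x : Finset E → ℝ) (h0 : x ∅ = 0) (h1 : x G = 0) :
    L.ell posInd ∅ G x
      = ∑ H ∈ L.between ∅ G with L.gap H G = 0, x H * L.vol posInd ∅ H := by
  rw [ell, Finset.sum_filter]
  refine Finset.sum_congr rfl fun H hH => ?_
  obtain ⟨m0, m1, m2⟩ := L.mem_between.mp hH
  rw [L.vol_posInd_of_nonempty m0 hG (Finset.empty_ssubset.mp m1), nrm, h0, h1]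
  split_ifs <;> ring

open scoped Classical in
/-- Weisner's recursion. -/
lemma absMoebius_eq_sum (hG : G ∈ L.carrier) {i : E} (hi : i ∈ G) :
    L.absMoebius G
      = ∑ H ∈ L.carrier with H ⊆ G ∧ i ∉ H ∧ L.rk H + 1 = L.rk G, L.absMoebius H := by
  have hG0 : (∅ : Finset E) ⊂ G := Finset.empty_ssubset.mpr ⟨i, hi⟩
  have hpos := L.rk_pos hG ⟨i, hi⟩
  have h0 := L.rk_bot
  by_cases hg : L.gap ∅ G = 0
  · rw [absMoebius, hg, L.vol_of_gap_eq_zero _ hg, Finset.sum_eq_single ∅]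
    · simp [absMoebius_empty]
    · intro H hH hne
      simp only [mem_filter] at hH
      have := L.rk_pos hH.1 (Finset.nonempty_iff_ne_empty.mpr hne)
      unfold gap at hg
      omega
    · intro h
      refine absurd (mem_filter.mpr ⟨L.bot_mem, empty_subset _, notMem_empty _, ?_⟩) h
      unfold gap at hg
      omega
  · have h1 := L.ell_self posInd L.bot_mem hG
    have h2 := L.ell_indicator posInd L.bot_mem hG hG0 i
    have h3 : L.ell posInd ∅ G posInd = L.ell posInd ∅ G
        (posInd + (-1 : ℝ) • fun S => if i ∈ S then 1 else 0) := by
      rw [ell_add, ell_smul, h2]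
      ring
    rw [h1, L.ell_posInd_indicator hG _ (by simp [posInd])
      (by simp [posInd_of_nonempty ⟨i, hi⟩, hi])] at h3
    obtain ⟨n, hn⟩ := Nat.exists_eq_succ_of_ne_zero hg
    rw [absMoebius, hn, Nat.factorial_succ, mul_comm (n + 1), Nat.cast_mul, mul_assoc,
      ← Nat.succ_eq_add_one, ← hn, h3, Finset.mul_sum]
    have e : ∀ H ∈ (L.between ∅ G).filter (fun H => L.gap H G = 0), (n.factorial : ℝ) *
        ((posInd + (-1 : ℝ) • fun S => if i ∈ S then 1 else 0 : Finset E → ℝ) H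
          * L.vol posInd ∅ H)
        = if i ∉ H then L.absMoebius H else 0 := by
      intro H hH
      obtain ⟨hH, hr⟩ := mem_filter.mp hH
      have hg' := L.gap_add L.bot_mem hG hH
      obtain ⟨m0, m1, m2⟩ := L.mem_between.mp hH
      have : L.gap ∅ H = n := by omega
      rw [absMoebius, this]
      by_cases hi : i ∈ H <;> simp [hi, posInd_of_nonempty (Finset.empty_ssubset.mp m1)]
    rw [Finset.sum_congr rfl e, ← Finset.sum_filter, Finset.filter_filter]
    refine Finset.sum_congr ?_ fun _ _ => rfl
    ext H
    simp only [mem_filter, L.mem_between]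
    constructor
    · rintro ⟨⟨m0, m1, m2⟩, m3, m4⟩
      refine ⟨m0, m2.subset, m4, ?_⟩
      have := L.rk_lt H m0 G hG m2
      unfold gap at m3
      omega
    · rintro ⟨m0, m1, m3, m4⟩
      refine ⟨⟨m0, Finset.empty_ssubset.mpr ?_, m1, fun h => m3 (h hi)⟩, ?_, m3⟩
      · rw [Finset.nonempty_iff_ne_empty]
        rintro rfl
        unfold gap at hg
        omega
      · unfold gap
        omega

end Limit

end FlatSystem

namespace FlatSystem
open Finset

section LogConcave

variable {E : Type*} (L : FlatSystem E) {F G H K : Finset E}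

open scoped Classical in
lemma ell_posInd_coatom {i : E} (hF : F ∈ L.carrier) (hi : i ∈ F) (hFT : F ⊂ L.top) :
    L.ell posInd F L.top (fun S => if i ∈ S ∧ S ≠ L.top then 1 else 0)
      = if L.gap F L.top = 1 then 1 else 0 := by
  split_ifs with h
  · rw [L.ell_of_gap_one posInd hF L.top_mem hFT h, Finset.sum_eq_zero]
    · simp [hi, hFT.ne]
    · intro H hH
      obtain ⟨_, h1, h2⟩ := L.mem_between.mp hH
      simp [hi, h1.subset hi, hFT.ne, h2.ne]
  · refine Finset.sum_eq_zero fun H hH => ?_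
    have hg := L.gap_add hF L.top_mem hH
    obtain ⟨h0, h1, h2⟩ := L.mem_between.mp hH
    rw [L.vol_posInd_of_nonempty hF h0 ⟨i, hi⟩,
      L.vol_posInd_of_nonempty h0 L.top_mem ⟨i, h1.subset hi⟩]
    by_cases hz : L.gap F H = 0
    · rw [if_neg (show ¬ L.gap H L.top = 0 by omega), mul_zero]
    · rw [if_neg hz, mul_zero, zero_mul]

open scoped Classical in
/-- The Hodge-Riemann inequality for the interval `[∅, ⊤]`, in terms of Möbius functions. -/
lemma absMoebius_top_mul_le (hr : 3 ≤ L.rk L.top) {i : E} (hi : i ∈ L.top) :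
    L.absMoebius L.top
        * ∑ H ∈ L.carrier with i ∈ H ∧ L.rk H + 2 = L.rk L.top, L.absMoebius H
      ≤ (∑ H ∈ L.carrier with i ∈ H ∧ L.rk H + 1 = L.rk L.top, L.absMoebius H) ^ 2 := by
  have h0 := L.rk_bot
  have hT : (∅ : Finset E) ⊂ L.top := Finset.empty_ssubset.mpr ⟨i, hi⟩
  obtain ⟨n, hn⟩ : ∃ n, L.gap ∅ L.top = n + 2 := ⟨L.gap ∅ L.top - 2, by unfold gap; omega⟩
  set x : Finset E → ℝ := fun S => if i ∈ S ∧ S ≠ L.top then 1 else 0 with hx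
  have hbet : ∀ H, H ∈ L.carrier → i ∈ H → L.rk H < L.rk L.top → H ∈ L.between ∅ L.top := by
    intro H h1 h2 h3
    refine L.mem_between.mpr ⟨h1, Finset.empty_ssubset.mpr ⟨i, h2⟩,
      (L.subset_top H h1).ssubset_of_ne ?_⟩
    rintro rfl
    exact h3.false
  have hell : (n + 1).factorial * L.ell posInd ∅ L.top x
      = ∑ H ∈ L.carrier with i ∈ H ∧ L.rk H + 1 = L.rk L.top, L.absMoebius H := by
    rw [L.ell_posInd_indicator L.top_mem x (by simp [hx]) (by simp [hx]), Finset.mul_sum]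
    have e : ∀ H ∈ (L.between ∅ L.top).filter (fun H => L.gap H L.top = 0),
        ((n + 1).factorial : ℝ) * (x H * L.vol posInd ∅ H)
          = if i ∈ H then L.absMoebius H else 0 := by
      intro H hH
      obtain ⟨hH, hr⟩ := mem_filter.mp hH
      have hg := L.gap_add L.bot_mem L.top_mem hH
      have : L.gap ∅ H = n + 1 := by omega
      rw [absMoebius, this]
      have := (L.mem_between.mp hH).2.2.ne
      by_cases hi : i ∈ H <;> simp [hx, hi, this]
    rw [Finset.sum_congr rfl e, ← Finset.sum_filter, Finset.filter_filter]
    refine Finset.sum_congr ?_ fun _ _ => rfl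
    ext H
    simp only [mem_filter]
    constructor
    · rintro ⟨m0, m1, m2⟩
      have := L.mem_between.mp m0
      have := L.rk_lt H this.1 L.top L.top_mem this.2.2
      refine ⟨(L.mem_between.mp m0).1, m2, ?_⟩
      unfold gap at m1
      omega
    · rintro ⟨m0, m1, m2⟩
      exact ⟨hbet H m0 m1 (by omega), by unfold gap; omega, m1⟩
  have hqf : n.factorial * L.qf posInd ∅ L.top x x
      = ∑ H ∈ L.carrier with i ∈ H ∧ L.rk H + 2 = L.rk L.top, L.absMoebius H := by
    rw [qf, Finset.mul_sum]
    have e : ∀ H ∈ L.between ∅ L.top, (n.factorial : ℝ) * (nrm ∅ L.top x H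
        * (L.ell posInd ∅ H x * L.vol posInd H L.top + L.vol posInd ∅ H * L.ell posInd H L.top x))
        = if i ∈ H ∧ L.gap H L.top = 1 then L.absMoebius H else 0 := by
      intro H hH
      obtain ⟨m0, m1, m2⟩ := L.mem_between.mp hH
      have hnx : nrm ∅ L.top x H = if i ∈ H then 1 else 0 := by
        simp [nrm, hx, m2.ne]
      by_cases hiH : i ∈ H
      · have h1 : L.ell posInd ∅ H x = 0 := by
          rw [← L.ell_indicator posInd L.bot_mem m0 m1 i]
          refine L.ell_congr posInd fun K hK => ?_
          have := ((L.mem_between.mp hK).2.2.trans m2).ne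
          simp [nrm, hx, m2.ne, this]
        rw [h1, L.ell_posInd_coatom m0 hiH m2, hnx, if_pos hiH]
        by_cases hg : L.gap H L.top = 1
        · have := L.gap_add L.bot_mem L.top_mem hH
          have : L.gap ∅ H = n := by omega
          rw [absMoebius, this]
          simp [hg, hiH]
        · simp [hg]
      · rw [hnx, if_neg hiH, if_neg (fun h => hiH h.1)]
        ring
    rw [Finset.sum_congr rfl e, ← Finset.sum_filter]
    refine Finset.sum_congr ?_ fun _ _ => rfl
    ext H
    simp only [mem_filter]
    constructor
    · rintro ⟨m0, m1, m2⟩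
      refine ⟨(L.mem_between.mp m0).1, m1, ?_⟩
      unfold gap at m2
      omega
    · rintro ⟨m0, m1, m2⟩
      exact ⟨hbet H m0 m1 (by omega), m1, by unfold gap; omega⟩
  have key := L.hodge_riemann_posInd L.bot_mem L.top_mem hT x
  rw [← hell, ← hqf, absMoebius, hn, Nat.factorial_succ (n + 1), Nat.factorial_succ n]
  rw [hn] at key
  push_cast at key ⊢
  have hf : (0 : ℝ) < n.factorial := by exact_mod_cast n.factorial_pos
  have := mul_le_mul_of_nonneg_left key (show (0 : ℝ) ≤ (n + 1) * n.factorial ^ 2 by positivity)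
  nlinarith

open scoped Classical in
/-- Flats containing `i` and flats avoiding `i` have matching Möbius sums in adjacent ranks. -/
lemma sum_absMoebius_mem (hK : K ∈ L.carrier) {i : E} (hi : i ∈ K) (φ : ℕ → ℝ) :
    ∑ F ∈ L.carrier with F ⊆ K ∧ i ∈ F, φ (L.rk F) * L.absMoebius F
      = ∑ H ∈ L.carrier with H ⊆ K ∧ i ∉ H, φ (L.rk H + 1) * L.absMoebius H := by
  have e1 : ∀ F ∈ L.carrier.filter (fun F => F ⊆ K ∧ i ∈ F), φ (L.rk F) * L.absMoebius F
      = ∑ H ∈ L.carrier with H ⊆ F ∧ i ∉ H ∧ L.rk H + 1 = L.rk F,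
        φ (L.rk H + 1) * L.absMoebius H := by
    intro F hF
    obtain ⟨h0, h1, h2⟩ := mem_filter.mp hF
    rw [L.absMoebius_eq_sum h0 h2, Finset.mul_sum]
    exact Finset.sum_congr rfl fun H hH => by rw [(mem_filter.mp hH).2.2.2]
  have e2 : ∀ H ∈ L.carrier.filter (fun H => H ⊆ K ∧ i ∉ H), φ (L.rk H + 1) * L.absMoebius H
      = ∑ F ∈ L.carrier with F ⊆ K ∧ i ∈ F ∧ H ⊆ F ∧ L.rk H + 1 = L.rk F,
        φ (L.rk H + 1) * L.absMoebius H := by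
    intro H hH
    obtain ⟨h0, h1, h2⟩ := mem_filter.mp hH
    obtain ⟨F, f0, f1, f2, f3, f4⟩ := L.exists_cover H h0 K hK h1 i hi h2
    have : L.carrier.filter (fun F => F ⊆ K ∧ i ∈ F ∧ H ⊆ F ∧ L.rk H + 1 = L.rk F) = {F} := by
      ext F'
      simp only [mem_filter, mem_singleton]
      constructor
      · rintro ⟨g0, g1, g2, g3, g4⟩
        exact L.cover_unique H h0 F' g0 F f0 g3 f1 i h2 g2 f3 g4.symm f4
      · rintro rfl
        exact ⟨f0, f2, f3, f1, f4.symm⟩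
    rw [this, Finset.sum_singleton]
  rw [Finset.sum_congr rfl e1, Finset.sum_congr rfl e2]
  refine Finset.sum_comm' fun F H => ?_
  simp only [mem_filter]
  constructor
  · rintro ⟨⟨h0, h1, h2⟩, h3, h4, h5, h6⟩
    exact ⟨⟨h0, h1, h2, h4, h6⟩, h3, h4.trans h1, h5⟩
  · rintro ⟨⟨h0, h1, h2, h4, h6⟩, h3, _, h5⟩
    exact ⟨⟨h0, h1, h2⟩, h3, h4, h5, h6⟩

open scoped Classical in
/-- The alternating sum of the absolute values of the Möbius function vanishes. -/
lemma sum_neg_one_pow_mul_absMoebius (hK : K ∈ L.carrier) :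
    ∑ F ∈ L.carrier with F ⊆ K, (-1) ^ L.rk F * L.absMoebius F = if K = ∅ then 1 else 0 := by
  split_ifs with h
  · subst h
    rw [Finset.sum_eq_single ∅]
    · simp [L.rk_bot, L.absMoebius_empty]
    · intro F hF hne
      exact absurd (Finset.subset_empty.mp (mem_filter.mp hF).2) hne
    · intro h
      simp [L.bot_mem] at h
  · obtain ⟨i, hi⟩ := Finset.nonempty_iff_ne_empty.mpr h
    rw [← Finset.sum_filter_add_sum_filter_not _ (fun F => i ∈ F), Finset.filter_filter,
      Finset.filter_filter, L.sum_absMoebius_mem hK hi (fun k => (-1) ^ k),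
      ← Finset.sum_add_distrib]
    refine Finset.sum_eq_zero fun H _ => ?_
    rw [pow_succ]
    ring

open scoped Classical in
/-- The absolute values of the coefficients of the reduced characteristic polynomial. -/
noncomputable def redCoeff (i : E) (k : ℕ) : ℝ :=
  ∑ H ∈ L.carrier with i ∉ H ∧ L.rk H = k, L.absMoebius H

open scoped Classical in
/-- The absolute values of the coefficients of the characteristic polynomial. -/
noncomputable def whitney (k : ℕ) : ℝ :=
  ∑ H ∈ L.carrier with L.rk H = k, L.absMoebius H

open scoped Classical in
lemma sum_mem_eq_redCoeff {i : E} (hi : i ∈ L.top) (k : ℕ) :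
    ∑ F ∈ L.carrier with i ∈ F ∧ L.rk F = k + 1, L.absMoebius F = L.redCoeff i k := by
  have := L.sum_absMoebius_mem L.top_mem hi (fun j => if j = k + 1 then 1 else 0)
  simp only [ite_mul, one_mul, zero_mul] at this
  rw [← Finset.sum_filter, ← Finset.sum_filter, Finset.filter_filter,
    Finset.filter_filter] at this
  rw [redCoeff]
  convert this using 2
  · ext F
    simp only [mem_filter]
    exact ⟨fun h => ⟨h.1, ⟨L.subset_top F h.1, h.2.1⟩, h.2.2⟩, fun h => ⟨h.1, h.2.1.2, h.2.2⟩⟩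
  · ext F
    simp only [mem_filter, Nat.add_right_cancel_iff]
    exact ⟨fun h => ⟨h.1, ⟨L.subset_top F h.1, h.2.1⟩, h.2.2⟩, fun h => ⟨h.1, h.2.1.2, h.2.2⟩⟩

lemma whitney_succ {i : E} (hi : i ∈ L.top) (k : ℕ) :
    L.whitney (k + 1) = L.redCoeff i (k + 1) + L.redCoeff i k := by
  classical
  rw [← L.sum_mem_eq_redCoeff hi k, redCoeff, whitney,
    ← Finset.sum_filter_add_sum_filter_not _ (fun F => i ∉ F), Finset.filter_filter,
    Finset.filter_filter]
  congr 1
  · exact Finset.sum_congr (by ext F; simp only [mem_filter]; tauto) fun _ _ => rfl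
  · exact Finset.sum_congr (by ext F; simp only [mem_filter]; tauto) fun _ _ => rfl

lemma whitney_zero {i : E} : L.whitney 0 = L.redCoeff i 0 := by
  classical
  rw [redCoeff, whitney]
  refine Finset.sum_congr ?_ fun _ _ => rfl
  ext F
  simp only [mem_filter]
  refine ⟨fun h => ⟨h.1, fun hi => ?_, h.2⟩, fun h => ⟨h.1, h.2.2⟩⟩
  exact (L.rk_pos h.1 ⟨i, hi⟩).ne' h.2

lemma redCoeff_nonneg (i : E) (k : ℕ) : 0 ≤ L.redCoeff i k := by
  classical
  exact Finset.sum_nonneg fun _ hH => L.absMoebius_nonneg (mem_filter.mp hH).1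

lemma redCoeff_succ_eq_zero {i : E} {k : ℕ} (h : L.redCoeff i k = 0) :
    L.redCoeff i (k + 1) = 0 := by
  classical
  rw [redCoeff, Finset.sum_eq_zero_iff_of_nonneg
    fun H hH => L.absMoebius_nonneg (mem_filter.mp hH).1] at h
  refine Finset.sum_eq_zero fun F hF => ?_
  obtain ⟨h0, h1, h2⟩ := mem_filter.mp hF
  have hne : F.Nonempty := by
    rw [Finset.nonempty_iff_ne_empty]
    rintro rfl
    have := L.rk_bot
    omega
  obtain ⟨j, hj⟩ := hne
  rw [L.absMoebius_eq_sum h0 hj]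
  refine Finset.sum_eq_zero fun H hH => h H ?_
  obtain ⟨k0, k1, k2, k3⟩ := mem_filter.mp hH
  exact mem_filter.mpr ⟨k0, fun h => h1 (k1 h), by omega⟩

lemma redCoeff_eq_zero {i : E} (hi : i ∈ L.top) {k : ℕ} (h : L.rk L.top ≤ k) :
    L.redCoeff i k = 0 := by
  classical
  refine Finset.sum_eq_zero fun F hF => ?_
  obtain ⟨h0, h1, h2⟩ := mem_filter.mp hF
  have hs : F ⊂ L.top := (L.subset_top F h0).ssubset_of_ne (by rintro rfl; exact h1 hi)
  have := L.rk_lt F h0 _ L.top_mem hs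
  omega

lemma redCoeff_top {i : E} (hi : i ∈ L.top) {k : ℕ} (hk : k + 1 = L.rk L.top) :
    L.redCoeff i k = L.absMoebius L.top := by
  classical
  rw [← L.sum_mem_eq_redCoeff hi, Finset.sum_eq_single L.top]
  · intro F hF hne
    have hF := mem_filter.mp hF
    have := L.rk_lt F hF.1 _ L.top_mem ((L.subset_top F hF.1).ssubset_of_ne hne)
    omega
  · exact fun h => absurd (mem_filter.mpr ⟨L.top_mem, hi, hk.symm⟩) h

lemma redCoeff_log_concave_top {i : E} (hi : i ∈ L.top) {k : ℕ} (hk : k + 3 = L.rk L.top) :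
    L.redCoeff i k * L.redCoeff i (k + 2) ≤ L.redCoeff i (k + 1) ^ 2 := by
  classical
  have h := L.absMoebius_top_mul_le (by omega) hi
  rw [← L.redCoeff_top hi hk, ← hk] at h
  have e1 := L.sum_mem_eq_redCoeff hi k
  have e2 := L.sum_mem_eq_redCoeff hi (k + 1)
  simp only [show ∀ a, a + 2 = k + 3 ↔ a = k + 1 from fun a => by omega,
    show ∀ a, a + 1 = k + 3 ↔ a = k + 1 + 1 from fun a => by omega] at h
  rw [e1, e2] at h
  linarith

open scoped Classical in
/-- The truncation of a flat system to rank `t`. -/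
noncomputable def truncate (t : ℕ) (ht : 0 < t) (htr : t ≤ L.rk L.top) : FlatSystem E where
  carrier := L.carrier.filter fun F => L.rk F < t ∨ F = L.top
  rk F := min (L.rk F) t
  top := L.top
  bot_mem := mem_filter.mpr ⟨L.bot_mem, Or.inl (by rwa [L.rk_bot])⟩
  top_mem := mem_filter.mpr ⟨L.top_mem, Or.inr rfl⟩
  subset_top F hF := L.subset_top F (mem_filter.mp hF).1
  rk_bot := by rw [L.rk_bot, Nat.zero_min]
  rk_lt F hF G hG hFG := by
    obtain ⟨f0, f1⟩ := mem_filter.mp hF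
    obtain ⟨g0, g1⟩ := mem_filter.mp hG
    have := L.rk_lt F f0 G g0 hFG
    rcases f1 with f1 | rfl
    · omega
    · exact absurd (L.subset_top G g0) hFG.2
  exists_cover F hF G hG hFG i hi hiF := by
    obtain ⟨f0, f1⟩ := mem_filter.mp hF
    obtain ⟨g0, g1⟩ := mem_filter.mp hG
    have hFt : L.rk F < t := by
      rcases f1 with f1 | rfl
      · exact f1
      · exact absurd (L.subset_top G g0 hi) hiF
    obtain ⟨H, h0, h1, h2, h3, h4⟩ := L.exists_cover F f0 G g0 hFG i hi hiF
    by_cases hH : L.rk H < t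
    · exact ⟨H, mem_filter.mpr ⟨h0, Or.inl hH⟩, h1, h2, h3, by omega⟩
    · have := L.rk_le h0 g0 h2
      rcases g1 with g1 | rfl
      · omega
      · exact ⟨L.top, mem_filter.mpr ⟨L.top_mem, Or.inr rfl⟩, hFG, subset_rfl, hi, by omega⟩
  cover_unique F hF H hH H' hH' hFH hFH' i hi hiH hiH' hr hr' := by
    obtain ⟨f0, f1⟩ := mem_filter.mp hF
    obtain ⟨h0, h1⟩ := mem_filter.mp hH
    obtain ⟨h0', h1'⟩ := mem_filter.mp hH'
    rcases h1 with h1 | rfl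
    · rcases h1' with h1' | rfl
      · exact L.cover_unique F f0 H h0 H' h0' hFH hFH' i hi hiH hiH' (by omega) (by omega)
      · omega
    · rcases h1' with h1' | rfl
      · omega
      · rfl

lemma mem_truncate {t : ℕ} (ht : 0 < t) (htr : t ≤ L.rk L.top) :
    F ∈ (L.truncate t ht htr).carrier ↔ F ∈ L.carrier ∧ (L.rk F < t ∨ F = L.top) :=
  by classical exact mem_filter

lemma rk_truncate {t : ℕ} (ht : 0 < t) (htr : t ≤ L.rk L.top) :
    (L.truncate t ht htr).rk F = min (L.rk F) t := rfl

lemma absMoebius_truncate {t : ℕ} (ht : 0 < t) (htr : t ≤ L.rk L.top) (hF : F ∈ L.carrier)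
    (hFt : L.rk F < t) : (L.truncate t ht htr).absMoebius F = L.absMoebius F := by
  classical
  induction hn : L.rk F using Nat.strong_induction_on generalizing F with
  | _ n ih =>
  rcases F.eq_empty_or_nonempty with rfl | ⟨i, hi⟩
  · rw [absMoebius_empty, absMoebius_empty]
  · have hF' : F ∈ (L.truncate t ht htr).carrier := mem_filter.mpr ⟨hF, Or.inl hFt⟩
    rw [absMoebius_eq_sum _ hF' hi, absMoebius_eq_sum _ hF hi]
    have : (L.truncate t ht htr).carrier.filter (fun H => H ⊆ F ∧ i ∉ H ∧
        (L.truncate t ht htr).rk H + 1 = (L.truncate t ht htr).rk F)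
        = L.carrier.filter (fun H => H ⊆ F ∧ i ∉ H ∧ L.rk H + 1 = L.rk F) := by
      ext H
      simp only [mem_filter, mem_truncate]
      simp only [rk_truncate]
      constructor
      · rintro ⟨⟨h0, h1⟩, h2, h3, h4⟩
        exact ⟨h0, h2, h3, by omega⟩
      · rintro ⟨h0, h2, h3, h4⟩
        exact ⟨⟨h0, Or.inl (by omega)⟩, h2, h3, by omega⟩
    rw [this]
    refine Finset.sum_congr rfl fun H hH => ?_
    obtain ⟨h0, h1, h2, h3⟩ := mem_filter.mp hH
    exact ih _ (by omega) h0 (by omega) rfl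

lemma redCoeff_truncate {t k : ℕ} (ht : 0 < t) (htr : t ≤ L.rk L.top) (i : E)
    (hk : k < t) : (L.truncate t ht htr).redCoeff i k = L.redCoeff i k := by
  classical
  rw [redCoeff, redCoeff]
  have : (L.truncate t ht htr).carrier.filter (fun H => i ∉ H ∧ (L.truncate t ht htr).rk H = k)
      = L.carrier.filter (fun H => i ∉ H ∧ L.rk H = k) := by
    ext H
    simp only [mem_filter, mem_truncate]
    simp only [rk_truncate]
    constructor
    · rintro ⟨⟨h0, h1⟩, h2, h3⟩
      exact ⟨h0, h2, by omega⟩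
    · rintro ⟨h0, h2, h3⟩
      exact ⟨⟨h0, Or.inl (by omega)⟩, h2, by omega⟩
  rw [this]
  refine Finset.sum_congr rfl fun H hH => ?_
  obtain ⟨h0, h1, h2⟩ := mem_filter.mp hH
  exact L.absMoebius_truncate ht htr h0 (by omega)

lemma redCoeff_log_concave {i : E} (hi : i ∈ L.top) (k : ℕ) :
    L.redCoeff i k * L.redCoeff i (k + 2) ≤ L.redCoeff i (k + 1) ^ 2 := by
  by_cases h : k + 3 ≤ L.rk L.top
  · rw [← L.redCoeff_truncate (Nat.succ_pos _) h i (show k < k + 3 by omega),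
      ← L.redCoeff_truncate (Nat.succ_pos _) h i (show k + 1 < k + 3 by omega),
      ← L.redCoeff_truncate (Nat.succ_pos _) h i (show k + 2 < k + 3 by omega)]
    exact redCoeff_log_concave_top (L.truncate (k + 3) _ h) hi (min_eq_right h).symm
  · rw [L.redCoeff_eq_zero hi (show L.rk L.top ≤ k + 2 by omega), mul_zero]
    positivity

/-- The Heron-Rota-Welsh conjecture for flat systems. -/
theorem whitney_log_concave (k : ℕ) :
    L.whitney k * L.whitney (k + 2) ≤ L.whitney (k + 1) ^ 2 := by
  classical
  rcases L.top.eq_empty_or_nonempty with h | ⟨i, hi⟩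
  · have : L.whitney (k + 2) = 0 := by
      refine Finset.sum_eq_zero fun F hF => ?_
      obtain ⟨h0, h1⟩ := mem_filter.mp hF
      have hF0 := L.subset_top F h0
      rw [h, Finset.subset_empty] at hF0
      rw [hF0, L.rk_bot] at h1
      omega
    rw [this, mul_zero]
    positivity
  have hb := L.redCoeff_nonneg i
  cases k with
  | zero =>
    rw [L.whitney_zero (i := i), L.whitney_succ hi, L.whitney_succ hi]
    have := L.redCoeff_log_concave hi 0
    nlinarith [mul_nonneg (hb 0) (hb 1), hb 0, hb 1, sq_nonneg (L.redCoeff i 0)]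
  | succ k =>
    rw [L.whitney_succ hi, L.whitney_succ hi, L.whitney_succ hi]
    have h1 := L.redCoeff_log_concave hi k
    have h2 := L.redCoeff_log_concave hi (k + 1)
    have h3 : L.redCoeff i k * L.redCoeff i (k + 3)
        ≤ L.redCoeff i (k + 1) * L.redCoeff i (k + 2) := by
      by_cases hz : L.redCoeff i (k + 1) * L.redCoeff i (k + 2) = 0
      · have : L.redCoeff i (k + 3) = 0 := by
          rcases mul_eq_zero.mp hz with hz | hz
          · exact L.redCoeff_succ_eq_zero (L.redCoeff_succ_eq_zero hz)
          · exact L.redCoeff_succ_eq_zero hz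
        rw [this, hz, mul_zero]
      · have hp : 0 < L.redCoeff i (k + 1) * L.redCoeff i (k + 2) :=
          (mul_nonneg (hb _) (hb _)).lt_of_ne' hz
        refine le_of_mul_le_mul_left ?_ hp
        have := mul_le_mul h1 h2 (mul_nonneg (hb _) (hb _)) (sq_nonneg _)
        nlinarith
    nlinarith [mul_nonneg (hb (k + 1)) (hb (k + 2))]

end LogConcave

end FlatSystem

namespace FlatSystem
open Finset

section Vectors

variable {𝕜 W E : Type*} [Field 𝕜] [AddCommGroup W] [Module 𝕜 W]

/-- The span of the vectors indexed by a finite set. -/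
def spanOf (w : E → W) (F : Finset E) : Submodule 𝕜 W := Submodule.span 𝕜 (w '' F)

variable {w : E → W} {F G H S : Finset E} {i : E}

lemma mem_spanOf (hi : i ∈ F) : w i ∈ spanOf (𝕜 := 𝕜) w F :=
  Submodule.subset_span ⟨i, hi, rfl⟩

lemma spanOf_mono (h : F ⊆ G) : spanOf (𝕜 := 𝕜) w F ≤ spanOf w G :=
  Submodule.span_mono (Set.image_mono (by exact_mod_cast h))

lemma spanOf_le {p : Submodule 𝕜 W} (h : ∀ i ∈ F, w i ∈ p) : spanOf w F ≤ p := by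
  rw [spanOf, Submodule.span_le]
  rintro _ ⟨i, hi, rfl⟩
  exact h i hi

variable [FiniteDimensional 𝕜 W]

lemma spanOf_eq_sup_span_singleton (hFH : F ⊆ H) (hiH : i ∈ H) (hi : w i ∉ spanOf (𝕜 := 𝕜) w F)
    (hr : Module.finrank 𝕜 (spanOf (𝕜 := 𝕜) w H) = Module.finrank 𝕜 (spanOf (𝕜 := 𝕜) w F) + 1) :
    spanOf (𝕜 := 𝕜) w H = spanOf w F ⊔ Submodule.span 𝕜 {w i} := by
  refine (Submodule.eq_of_le_of_finrank_eq (sup_le (spanOf_mono hFH) ?_) ?_).symm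
  · rw [Submodule.span_singleton_le_iff_mem]
    exact mem_spanOf hiH
  · rw [Submodule.finrank_sup_span_singleton hi, hr]

variable (𝕜) in
open scoped Classical in
/-- The flats of the vector configuration `w` on the finite set `S`. -/
noncomputable def ofVectors (w : E → W) (S : Finset E) (hw : ∀ e ∈ S, w e ≠ 0) :
    FlatSystem E where
  carrier := S.powerset.filter fun F => ∀ e ∈ S, w e ∈ spanOf (𝕜 := 𝕜) w F → e ∈ F
  rk F := Module.finrank 𝕜 (spanOf (𝕜 := 𝕜) w F)
  top := S
  bot_mem := by
    refine mem_filter.mpr ⟨by simp, fun e he h => absurd ?_ (hw e he)⟩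
    simpa [spanOf] using h
  top_mem := by simp +contextual
  subset_top F hF := mem_powerset.mp (mem_filter.mp hF).1
  rk_bot := by
    rw [spanOf, Finset.coe_empty, Set.image_empty, Submodule.span_empty, finrank_bot]
  rk_lt F hF G hG hFG := by
    obtain ⟨-, f1⟩ := mem_filter.mp hF
    obtain ⟨g0, -⟩ := mem_filter.mp hG
    obtain ⟨i, hi, hiF⟩ := Finset.exists_of_ssubset hFG
    refine Submodule.finrank_lt_finrank_of_lt
      (lt_of_le_not_ge (spanOf_mono hFG.subset) fun h => hiF ?_)
    exact f1 i (mem_powerset.mp g0 hi) (h (mem_spanOf hi))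
  exists_cover F hF G hG hFG i hi hiF := by
    obtain ⟨f0, f1⟩ := mem_filter.mp hF
    obtain ⟨g0, g1⟩ := mem_filter.mp hG
    rw [mem_powerset] at f0 g0
    have hiw : w i ∉ spanOf (𝕜 := 𝕜) w F := fun h => hiF (f1 i (g0 hi) h)
    set p := spanOf (𝕜 := 𝕜) w F ⊔ Submodule.span 𝕜 {w i} with hp
    have hip : w i ∈ p := Submodule.mem_sup_right (Submodule.mem_span_singleton_self _)
    have hFp : ∀ e ∈ F, w e ∈ p := fun e he => Submodule.mem_sup_left (mem_spanOf he)
    have hFH : F ⊆ S.filter fun e => w e ∈ p := fun e he => mem_filter.mpr ⟨f0 he, hFp e he⟩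
    have hiH : i ∈ S.filter fun e => w e ∈ p := mem_filter.mpr ⟨g0 hi, hip⟩
    have hspan : spanOf w (S.filter fun e => w e ∈ p) = p := by
      refine le_antisymm (spanOf_le fun e he => (mem_filter.mp he).2) (sup_le (spanOf_mono hFH) ?_)
      rw [Submodule.span_singleton_le_iff_mem]
      exact mem_spanOf hiH
    refine ⟨S.filter fun e => w e ∈ p, ?_, hFH, ?_, hiH, ?_⟩
    · refine mem_filter.mpr ⟨mem_powerset.mpr (filter_subset _ _), fun e he h => ?_⟩
      rw [hspan] at h
      exact mem_filter.mpr ⟨he, h⟩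
    · intro e he
      obtain ⟨h0, h1⟩ := mem_filter.mp he
      refine g1 e h0 ((sup_le (spanOf_mono hFG) ?_ : p ≤ spanOf w G) h1)
      rw [Submodule.span_singleton_le_iff_mem]
      exact mem_spanOf hi
    · rw [hspan, hp, Submodule.finrank_sup_span_singleton hiw]
  cover_unique F hF H hH H' hH' hFH hFH' i hi hiH hiH' hr hr' := by
    obtain ⟨f0, f1⟩ := mem_filter.mp hF
    obtain ⟨h0, h1⟩ := mem_filter.mp hH
    obtain ⟨h0', h1'⟩ := mem_filter.mp hH'
    rw [mem_powerset] at h0 h0'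
    have hiw : w i ∉ spanOf (𝕜 := 𝕜) w F := fun h => hi (f1 i (h0 hiH) h)
    have hspan : spanOf (𝕜 := 𝕜) w H = spanOf w H' := by
      rw [spanOf_eq_sup_span_singleton hFH hiH hiw hr,
        spanOf_eq_sup_span_singleton hFH' hiH' hiw hr']
    refine Finset.Subset.antisymm (fun e he => ?_) fun e he => ?_
    · exact h1' e (h0 he) (by rw [← hspan]; exact mem_spanOf he)
    · exact h1 e (h0' he) (by rw [hspan]; exact mem_spanOf he)

lemma mem_ofVectors {hw : ∀ e ∈ S, w e ≠ 0} : F ∈ (ofVectors 𝕜 w S hw).carrier ↔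
    F ⊆ S ∧ ∀ e ∈ S, w e ∈ spanOf (𝕜 := 𝕜) w F → e ∈ F := by
  classical
  rw [← mem_powerset]
  exact mem_filter

end Vectors

section Graph

variable {V : Type*}

/-- The functional `f ↦ f u - f v` attached to the ordered pair `(u, v)`. -/
def diffFunctional (e : V × V) : Module.Dual ℝ (V → ℝ) :=
  (LinearMap.proj e.1 : (V → ℝ) →ₗ[ℝ] ℝ) - LinearMap.proj e.2

lemma diffFunctional_apply (e : V × V) (f : V → ℝ) : diffFunctional e f = f e.1 - f e.2 := rfl

/-- Functions constant along a relation are functions on the quotient. -/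
def constAlongEquiv {α : Type*} (r : V → V → Prop) :
    {f : V → α // ∀ u v, r u v → f u = f v} ≃ (Quot r → α) where
  toFun f := Quot.lift f.1 f.2
  invFun g := ⟨fun u => g (Quot.mk r u), fun _ _ h => congrArg g (Quot.sound h)⟩
  left_inv _ := rfl
  right_inv g := by
    ext x
    induction x using Quot.ind
    rfl

/-- The linear version of `constAlongEquiv`, for functions constant along a set of pairs. -/
def coannihilatorEquiv (F : Finset (V × V)) :
    (spanOf (𝕜 := ℝ) diffFunctional F).dualCoannihilator
      ≃ₗ[ℝ] (Quot (fun u v : V => (u, v) ∈ F) → ℝ) where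
  toFun f := Quot.lift f.1 fun u v h => by
    have := (Submodule.mem_dualCoannihilator f.1).mp f.2 _
      (mem_spanOf (w := diffFunctional) h)
    rw [diffFunctional_apply] at this
    exact sub_eq_zero.mp this
  map_add' f g := by
    ext x
    induction x using Quot.ind
    rfl
  map_smul' c f := by
    ext x
    induction x using Quot.ind
    rfl
  invFun g := ⟨fun u => g (Quot.mk _ u), by
    rw [Submodule.mem_dualCoannihilator]
    refine fun φ hφ => ?_
    have : spanOf (𝕜 := ℝ) diffFunctional F
        ≤ LinearMap.ker (Module.Dual.eval ℝ (V → ℝ) fun u => g (Quot.mk _ u)) := by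
      refine spanOf_le fun e he => ?_
      rw [LinearMap.mem_ker, Module.Dual.eval_apply, diffFunctional_apply, sub_eq_zero]
      exact congrArg g (Quot.sound (r := fun u v => (u, v) ∈ F) he)
    exact this hφ⟩
  left_inv _ := rfl
  right_inv g := by
    ext x
    induction x using Quot.ind
    rfl

variable [Fintype V]

lemma card_quot_add_finrank (F : Finset (V × V)) :
    Nat.card (Quot fun u v : V => (u, v) ∈ F)
      + Module.finrank ℝ (spanOf (𝕜 := ℝ) diffFunctional F) = Fintype.card V := by
  have h1 := Subspace.finrank_add_finrank_dualCoannihilator_eq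
    (spanOf (𝕜 := ℝ) (diffFunctional (V := V)) F)
  have h2 := (coannihilatorEquiv F).finrank_eq
  have := Fintype.ofFinite (Quot fun u v : V => (u, v) ∈ F)
  rw [Module.finrank_fintype_fun_eq_card] at h1 h2
  rw [Nat.card_eq_fintype_card, ← h2, ← h1, add_comm]

lemma card_constAlong (F : Finset (V × V)) (q : ℕ) :
    Nat.card {c : V → Fin q // ∀ u v, (u, v) ∈ F → c u = c v}
      = q ^ (Fintype.card V - Module.finrank ℝ (spanOf (𝕜 := ℝ) diffFunctional F)) := by
  rw [Nat.card_congr (constAlongEquiv _), Nat.card_fun, Nat.card_fin, ← card_quot_add_finrank F,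
    Nat.add_sub_cancel]

open scoped Classical in
/-- The lattice of flats of the graphic matroid, on the set of darts. -/
noncomputable def graphic (G : SimpleGraph V) : FlatSystem (V × V) :=
  ofVectors ℝ diffFunctional (Finset.univ.filter fun e => G.Adj e.1 e.2) fun e he h => by
    have hne := (mem_filter.mp he).2.ne
    have := congrArg (fun φ : Module.Dual ℝ (V → ℝ) => φ (Pi.single e.1 1)) h
    simp [diffFunctional_apply, hne.symm] at this

lemma mem_graphic_top {G : SimpleGraph V} {e : V × V} :
    e ∈ (graphic G).top ↔ G.Adj e.1 e.2 := by
  classical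
  exact mem_filter.trans (by simp)

lemma graphic_rk (G : SimpleGraph V) (F : Finset (V × V)) :
    (graphic G).rk F = Module.finrank ℝ (spanOf (𝕜 := ℝ) diffFunctional F) := rfl

lemma graphic_rk_lt_card [Nonempty V] (G : SimpleGraph V) (F : Finset (V × V)) :
    (graphic G).rk F < Fintype.card V := by
  have : Nonempty (Quot fun u v : V => (u, v) ∈ F) := ⟨Quot.mk _ (Classical.arbitrary V)⟩
  have h : 0 < Nat.card (Quot fun u v : V => (u, v) ∈ F) := Nat.card_pos
  have := card_quot_add_finrank F
  rw [graphic_rk]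
  omega

open scoped Classical in
/-- The set of monochromatic darts of a colouring. -/
noncomputable def mono {q : ℕ} (G : SimpleGraph V) (c : V → Fin q) : Finset (V × V) :=
  (graphic G).top.filter fun e => c e.1 = c e.2

lemma mono_mem {q : ℕ} (G : SimpleGraph V) (c : V → Fin q) : mono G c ∈ (graphic G).carrier := by
  classical
  refine mem_ofVectors.mpr ⟨filter_subset _ _, fun e he h => ?_⟩
  have : spanOf (𝕜 := ℝ) diffFunctional (mono G c)
      ≤ LinearMap.ker (Module.Dual.eval ℝ (V → ℝ) fun u => ((c u : ℕ) : ℝ)) := by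
    refine spanOf_le fun e he => ?_
    rw [LinearMap.mem_ker, Module.Dual.eval_apply, diffFunctional_apply, (mem_filter.mp he).2,
      sub_self]
  have := this h
  rw [LinearMap.mem_ker, Module.Dual.eval_apply, diffFunctional_apply, sub_eq_zero] at this
  exact mem_filter.mpr ⟨he, Fin.ext (by exact_mod_cast this)⟩

lemma subset_mono_iff {q : ℕ} {G : SimpleGraph V} {c : V → Fin q} {F : Finset (V × V)}
    (hF : F ∈ (graphic G).carrier) : F ⊆ mono G c ↔ ∀ u v, (u, v) ∈ F → c u = c v := by
  classical
  refine ⟨fun h u v huv => (mem_filter.mp (h huv)).2, fun h e he => ?_⟩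
  exact mem_filter.mpr ⟨(graphic G).subset_top F hF he, h _ _ he⟩

lemma mono_eq_empty_iff {q : ℕ} {G : SimpleGraph V} {c : V → Fin q} :
    mono G c = ∅ ↔ ∀ v w, G.Adj v w → c v ≠ c w := by
  classical
  rw [mono, Finset.filter_eq_empty_iff]
  exact ⟨fun h v w hvw => h (x := (v, w)) (mem_graphic_top.mpr hvw),
    fun h e he => h _ _ (mem_graphic_top.mp he)⟩

/-- Whitney's formula for the chromatic polynomial. -/
lemma numProperColorings_eq_sum_flats (G : SimpleGraph V) (q : ℕ) :
    (numProperColorings G q : ℝ) = ∑ F ∈ (graphic G).carrier,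
      (-1) ^ (graphic G).rk F * (graphic G).absMoebius F
        * (q : ℝ) ^ (Fintype.card V - (graphic G).rk F) := by
  classical
  have e1 : (numProperColorings G q : ℝ) = ∑ c : V → Fin q, if mono G c = ∅ then 1 else 0 := by
    rw [Finset.sum_boole, numProperColorings, Nat.card_eq_fintype_card, Fintype.card_subtype]
    simp only [mono_eq_empty_iff]
  have e2 (c : V → Fin q) : (if mono G c = ∅ then (1 : ℝ) else 0)
      = ∑ F ∈ (graphic G).carrier with F ⊆ mono G c,
        (-1) ^ (graphic G).rk F * (graphic G).absMoebius F := by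
    convert ((graphic G).sum_neg_one_pow_mul_absMoebius (mono_mem G c)).symm
  rw [e1, Finset.sum_congr rfl fun c _ => e2 c]
  simp only [Finset.sum_filter]
  rw [Finset.sum_comm]
  refine Finset.sum_congr rfl fun F hF => ?_
  rw [← Finset.sum_filter, Finset.sum_const, nsmul_eq_mul, mul_comm]
  congr 1
  rw [graphic_rk, ← Nat.cast_pow, ← card_constAlong, Nat.card_eq_fintype_card,
    Fintype.card_subtype]
  simp only [subset_mono_iff hF]

lemma numProperColorings_eq_sum_whitney [Nonempty V] (G : SimpleGraph V) (q : ℕ) :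
    (numProperColorings G q : ℝ) = ∑ k ∈ Finset.range (Fintype.card V),
      (-1) ^ k * (graphic G).whitney k * (q : ℝ) ^ (Fintype.card V - k) := by
  classical
  rw [numProperColorings_eq_sum_flats, ← Finset.sum_fiberwise_of_maps_to
    (t := Finset.range (Fintype.card V)) (g := (graphic G).rk)
    fun F _ => Finset.mem_range.mpr (graphic_rk_lt_card G F)]
  refine Finset.sum_congr rfl fun k _ => ?_
  rw [whitney, Finset.mul_sum, Finset.sum_mul]
  exact Finset.sum_congr rfl fun F hF => by rw [(mem_filter.mp hF).2]

end Graph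

end FlatSystem

/-- The coefficients of a polynomial function on the natural numbers are determined by it. -/
lemma coeff_eq_of_eval_nat_eq {R : Type*} [CommRing R] [IsDomain R] [CharZero R] {n : ℕ}
    {a b : ℕ → R} (h : ∀ q : ℕ, ∑ i ∈ Finset.range n, a i * (q : R) ^ (n - i)
      = ∑ i ∈ Finset.range n, b i * (q : R) ^ (n - i)) {i : ℕ} (hi : i < n) : a i = b i := by
  open Polynomial in
  have hp : ∑ i ∈ Finset.range n, C (a i) * X ^ (n - i)
      = ∑ i ∈ Finset.range n, C (b i) * X ^ (n - i) := by
    refine Polynomial.eq_of_infinite_eval_eq _ _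
      ((Set.infinite_range_of_injective (Nat.cast_injective (R := R))).mono ?_)
    rintro _ ⟨q, rfl⟩
    simpa [Polynomial.eval_finsetSum] using h q
  have hc : ∀ c : ℕ → R, (∑ j ∈ Finset.range n, Polynomial.C (c j) * Polynomial.X ^ (n - j)).coeff
      (n - i) = c i := by
    intro c
    rw [Polynomial.finsetSum_coeff, Finset.sum_eq_single i]
    · simp
    · intro j hj hne
      rw [Polynomial.coeff_C_mul_X_pow, if_neg]
      have := Finset.mem_range.mp hj
      omega
    · exact fun h => absurd (Finset.mem_range.mpr hi) h
  rw [← hc a, hp, hc b]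

/-- Read and Hoggar's conjecture, proved by Huh: let `G` be a finite connected
simple graph with `d + 1` vertices and let `a_0, …, a_d` be integers with
`χ_G(q) = ∑_{i=0}^d (−1)^i a_i q^{d+1−i}` for every natural number `q`. Then the sequence
`a_0, …, a_d` is log-concave: `a_i^2 ≥ a_{i−1} ⬝ a_{i+1}` for `1 ≤ i ≤ d − 1`. -/
theorem chromatic_polynomial_log_concave {V : Type*} [Fintype V] (G : SimpleGraph V)
    (hG : G.Connected) (d : ℕ) (hd : Fintype.card V = d + 1)
    (a : ℕ → ℤ)
    (ha : ∀ q : ℕ, (numProperColorings G q : ℤ) =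
      ∑ i ∈ Finset.range (d + 1), (-1 : ℤ) ^ i * a i * (q : ℤ) ^ (d + 1 - i)) :
    ∀ i, 1 ≤ i → i + 1 ≤ d → a (i - 1) * a (i + 1) ≤ a i ^ 2 := by
  have := hG.nonempty
  have hw : ∀ i < d + 1, (a i : ℝ) = (FlatSystem.graphic G).whitney i := by
    intro i hi
    have key := coeff_eq_of_eval_nat_eq (n := d + 1) (a := fun i => (-1 : ℝ) ^ i * a i)
      (b := fun i => (-1) ^ i * (FlatSystem.graphic G).whitney i) (fun q => ?_) hi
    · exact mul_left_cancel₀ (pow_ne_zero _ (by norm_num)) key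
    · rw [← hd, ← FlatSystem.numProperColorings_eq_sum_whitney, hd]
      exact_mod_cast (congrArg (Int.cast (R := ℝ)) (ha q)).symm
  intro i h1 h2
  obtain ⟨k, rfl⟩ := Nat.exists_eq_add_of_le' h1
  have h := (FlatSystem.graphic G).whitney_log_concave k
  rw [← hw _ (by omega), ← hw _ (by omega), ← hw _ (by omega)] at h
  exact_mod_cast h
end

section
/- Let M be a matroid on a finite ground set E, and for each natural number i let f_i(M) denote the number of independent sets of M of cardinality i. Then the sequence f_i(M) is log-concave: f_i(M)^2 ≥ f_{i−1}(M) · f_{i+1}(M) for all i ≥ 1. -/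
open scoped InnerProductSpace in
theorem LinearMap.IsSymmetric.inner_nonpos_of_le_norm_sq {V : Type*} [NormedAddCommGroup V]
    [InnerProductSpace ℝ V] [FiniteDimensional ℝ V] {T : V →ₗ[ℝ] V} (hT : T.IsSymmetric) {p : V}
    (h : ∀ z, ⟪T z, z⟫_ℝ ≤ ‖T z‖ ^ 2)
    (hmax : ∀ z, ‖z‖ ^ 2 ≤ ⟪T z, z⟫_ℝ → ∃ c : ℝ, z = c • p)
    {z : V} (hz : ⟪p, z⟫_ℝ = 0) : ⟪T z, z⟫_ℝ ≤ 0 := by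
  set v := hT.eigenvectorBasis rfl
  set l := hT.eigenvalues rfl
  have hv i : T (v i) = l i • v i := hT.apply_eigenvectorBasis rfl i
  have hn i : ‖v i‖ = 1 := v.orthonormal.1 i
  rw [← v.sum_inner_mul_inner]
  refine Finset.sum_nonpos fun i _ ↦ ?_
  rw [hT, hv, inner_smul_right, real_inner_comm (v i) z, mul_assoc]
  rcases le_or_gt (l i) 0 with hl | hl
  · exact mul_nonpos_of_nonpos_of_nonneg hl (mul_self_nonneg _)
  have h1 := h (v i)
  have h2 := hmax (v i)
  simp only [hv, inner_smul_left, norm_smul, hn, real_inner_self_eq_norm_sq, Real.norm_eq_abs,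
    mul_one, sq_abs, one_pow, conj_trivial] at h1 h2
  obtain ⟨c, hc⟩ := h2 (by nlinarith)
  simp [hc, inner_smul_left, hz]

open scoped InnerProductSpace in
/-- If a quadratic form `s ^ 2 * a + 2 * s * ⟪b, z⟫ + ⟪T z, z⟫` on `ℝ × V` is bounded by
`‖T z + s • b‖ ^ 2`, and `T` has largest eigenvalue `1` with eigenspace spanned by the unit
vector `p`, then the form satisfies a reversed Cauchy-Schwarz inequality with respect to `p`. -/
theorem LinearMap.IsSymmetric.quadratic_le_inner_sq {V : Type*} [NormedAddCommGroup V]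
    [InnerProductSpace ℝ V] [FiniteDimensional ℝ V] {T : V →ₗ[ℝ] V} (hT : T.IsSymmetric)
    {p b : V} (hp : ‖p‖ = 1) (hTp : T p = p) {a : ℝ}
    (h : ∀ (s : ℝ) z, s ^ 2 * a + 2 * s * ⟪b, z⟫_ℝ + ⟪T z, z⟫_ℝ ≤ ‖T z + s • b‖ ^ 2)
    (hmax : ∀ z, ‖z‖ ^ 2 ≤ ⟪T z, z⟫_ℝ → ∃ c : ℝ, z = c • p) (s : ℝ) (z : V) :
    s ^ 2 * a + 2 * s * ⟪b, z⟫_ℝ + ⟪T z, z⟫_ℝ ≤ ⟪p, T z + s • b⟫_ℝ ^ 2 := by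
  have hneg : ∀ z, ⟪p, z⟫_ℝ = 0 → ⟪T z, z⟫_ℝ ≤ 0 := fun z hz ↦
    hT.inner_nonpos_of_le_norm_sq (fun z ↦ by simpa using h 0 z) hmax hz
  obtain ⟨w, hw⟩ : ∃ w, T w = b := by
    have hb : b ∈ (LinearMap.range T)ᗮᗮ := by
      rw [hT.orthogonal_range, Submodule.mem_orthogonal]
      intro v hv
      rw [LinearMap.mem_ker] at hv
      by_contra hne
      have := h 1 (((‖b‖ ^ 2 - a + 1) / (2 * ⟪v, b⟫_ℝ)) • v)
      rw [map_smul, hv, inner_smul_right, real_inner_comm v b] at this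
      simp only [smul_zero, inner_zero_left, zero_add, one_smul] at this
      field_simp at this
      linarith
    rwa [Submodule.orthogonal_orthogonal] at hb
  subst hw
  have hF : a ≤ ⟪T w, w⟫_ℝ := by
    have := h 1 (-w)
    simp only [map_neg, inner_neg_left, inner_neg_right, one_smul, neg_add_cancel,
      norm_zero] at this
    linarith
  have hpT x : ⟪p, T x⟫_ℝ = ⟪p, x⟫_ℝ := by rw [← hT, hTp]
  have hsymm x y : ⟪T x, y⟫_ℝ = ⟪T y, x⟫_ℝ := by rw [hT, real_inner_comm]
  have hpp : ⟪p, p⟫_ℝ = 1 := by rw [real_inner_self_eq_norm_sq, hp, one_pow]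
  set c := ⟪p, T z + s • T w⟫_ℝ with hc
  rw [inner_add_right, inner_smul_right, hpT, hpT] at hc
  have := hneg (z + s • w - c • p) (by
    simp only [inner_sub_right, inner_add_right, inner_smul_right, hpp]; linarith)
  simp only [map_sub, map_add, map_smul, hTp, inner_sub_left, inner_add_left, inner_sub_right,
    inner_add_right, inner_smul_left, inner_smul_right, conj_trivial, hpp, hsymm z w,
    real_inner_comm p (T z), real_inner_comm p (T w), hpT] at this
  rw [hsymm w z, hsymm z w] at this
  have hcc : c * ⟪p, z⟫_ℝ + c * (s * ⟪p, w⟫_ℝ) = c ^ 2 := by rw [← mul_add, ← hc, sq]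
  nlinarith [mul_nonneg (sq_nonneg s) (sub_nonneg.2 hF)]

/-- The Dirichlet form of a symmetric weight on pairs. -/
theorem sum_mul_sub_sq_eq {ι : Type*} [Fintype ι] {C : ι → ι → ℝ}
    (hsymm : ∀ e f, C e f = C f e) (y : ι → ℝ) :
    ∑ e, ∑ f, C e f * (y e - y f) ^ 2 =
      2 * (∑ e, (∑ f, C e f) * y e ^ 2 - ∑ e, y e * ∑ f, C e f * y f) := by
  have h1 : ∑ e, ∑ f, C e f * y f ^ 2 = ∑ e, (∑ f, C e f) * y e ^ 2 := by
    rw [Finset.sum_comm]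
    simp only [Finset.sum_mul, hsymm]
  have h2 : ∑ e, ∑ f, C e f * (y e - y f) ^ 2 = ∑ e, (∑ f, C e f) * y e ^ 2 +
      ∑ e, ∑ f, C e f * y f ^ 2 - 2 * ∑ e, y e * ∑ f, C e f * y f := by
    simp only [Finset.mul_sum, Finset.sum_mul, ← Finset.sum_add_distrib, ← Finset.sum_sub_distrib]
    exact Finset.sum_congr rfl fun e _ ↦ Finset.sum_congr rfl fun f _ ↦ by ring
  rw [h2, h1]
  ring

theorem exists_eq_const_of_dirichlet_nonpos {ι : Type*} [Fintype ι] {C : ι → ι → ℝ}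
    (hC : ∀ e f, 0 ≤ C e f)
    (hconn : ∀ e f g, 0 < C e g → 0 < ∑ k, C f k → 0 < C e f ∨ 0 < C f g)
    {y : ι → ℝ} (hy : ∑ e, ∑ f, C e f * (y e - y f) ^ 2 ≤ 0) :
    ∃ c, ∀ e, 0 < ∑ f, C e f → y e = c := by
  have h0 e f : 0 ≤ C e f * (y e - y f) ^ 2 := mul_nonneg (hC e f) (sq_nonneg _)
  have hadj e f (hef : 0 < C e f) : y e = y f := by
    have h1 := (Finset.sum_eq_zero_iff_of_nonneg fun e _ ↦ Finset.sum_nonneg fun f _ ↦ h0 e f).1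
      (le_antisymm hy (Finset.sum_nonneg fun e _ ↦ Finset.sum_nonneg fun f _ ↦ h0 e f)) e
      (Finset.mem_univ _)
    have h2 := (Finset.sum_eq_zero_iff_of_nonneg fun f _ ↦ h0 e f).1 h1 f (Finset.mem_univ _)
    have h3 := (mul_eq_zero.1 h2).resolve_left hef.ne'
    exact sub_eq_zero.1 (pow_eq_zero_iff two_ne_zero |>.1 h3)
  by_cases hex : ∃ e, 0 < ∑ f, C e f
  · obtain ⟨e, he⟩ := hex
    obtain ⟨g, -, hg⟩ := Finset.exists_lt_of_sum_lt (f := fun _ ↦ (0 : ℝ)) (by simpa using he)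
    refine ⟨y e, fun f hf ↦ ?_⟩
    rcases hconn e f g hg hf with h | h
    · exact (hadj _ _ h).symm
    · rw [hadj _ _ h, hadj _ _ hg]
  · exact ⟨0, fun e he ↦ (hex ⟨e, he⟩).elim⟩

/-- A local-to-global principle: for a connected symmetric nonnegative matrix `C`, bordered by the
vector `b` and the scalar `a`, the bound of the quadratic form by the weighted norm of its gradient
implies a reversed Cauchy-Schwarz inequality with respect to the all-ones vector. -/
theorem quadratic_mul_sum_le_sq {ι : Type*} [Fintype ι] {C : ι → ι → ℝ} {b : ι → ℝ} {a : ℝ}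
    (hsymm : ∀ e f, C e f = C f e) (hC : ∀ e f, 0 ≤ C e f)
    (hb : ∀ e, ∑ f, C e f = 0 → b e = 0)
    (hconn : ∀ e f g, 0 < C e g → 0 < ∑ k, C f k → 0 < C e f ∨ 0 < C f g)
    (hle : ∀ (s : ℝ) (y : ι → ℝ),
      s ^ 2 * a + 2 * s * ∑ e, b e * y e + ∑ e, y e * ∑ f, C e f * y f ≤
        ∑ e, (∑ f, C e f * y f + s * b e) ^ 2 / ∑ f, C e f)
    (s : ℝ) (y : ι → ℝ) :
    (s ^ 2 * a + 2 * s * ∑ e, b e * y e + ∑ e, y e * ∑ f, C e f * y f) * ∑ e, ∑ f, C e f ≤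
      (∑ e, (∑ f, C e f * y f + s * b e)) ^ 2 := by
  classical
  set d : ι → ℝ := fun e ↦ ∑ f, C e f with hd
  have hd0 e : 0 ≤ d e := Finset.sum_nonneg fun f _ ↦ hC e f
  change ∀ e, d e = 0 → b e = 0 at hb
  change ∀ (s : ℝ) (y : ι → ℝ), _ ≤ ∑ e, _ / d e at hle
  change _ * ∑ e, d e ≤ _
  rcases (Finset.sum_nonneg fun e _ ↦ hd0 e).eq_or_lt with hU | hU
  · rw [← hU, mul_zero]
    exact sq_nonneg _
  set U := ∑ e, d e with hUdef
  have hCd e f (h : d e = 0) : C e f = 0 :=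
    (Finset.sum_eq_zero_iff_of_nonneg fun f _ ↦ hC e f).1 h f (Finset.mem_univ _)
  set r : ι → ℝ := fun e ↦ √(d e) with hr
  have hrr e : r e ^ 2 = d e := Real.sq_sqrt (hd0 e)
  have hr0 {e} (h : r e = 0) : d e = 0 := by rw [← hrr, h]; simp
  have hUU : √U ^ 2 = U := Real.sq_sqrt hU.le
  have hU0 : √U ≠ 0 := (Real.sqrt_pos.2 hU).ne'
  let A : Matrix ι ι ℝ := Matrix.of fun e f ↦ C e f / (r e * r f)
  let T := Matrix.toEuclideanLin A
  have hT : T.IsSymmetric := by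
    rw [Matrix.isSymmetric_toEuclideanLin_iff]
    ext e f
    simp [A, hsymm e f, mul_comm]
  have hTz (z : EuclideanSpace ℝ ι) e : T z e = (∑ f, C e f * (z f / r f)) / r e := by
    simp only [T, A, Matrix.toLpLin_apply, Matrix.mulVec, dotProduct, Matrix.of_apply,
      Finset.sum_div]
    exact Finset.sum_congr rfl fun f _ ↦ by simp only [div_eq_mul_inv, mul_inv]; ring
  let p : EuclideanSpace ℝ ι := WithLp.toLp 2 fun e ↦ r e / √U
  let β : EuclideanSpace ℝ ι := WithLp.toLp 2 fun e ↦ b e / r e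
  have hin (z w : EuclideanSpace ℝ ι) : inner ℝ z w = ∑ e, z e * w e := by
    rw [PiLp.inner_apply]
    exact Finset.sum_congr rfl fun e _ ↦ by simp [mul_comm]
  have hno (z : EuclideanSpace ℝ ι) : ‖z‖ ^ 2 = ∑ e, z e ^ 2 := EuclideanSpace.real_norm_sq_eq z
  have hp : ‖p‖ = 1 := by
    rw [← sq_eq_sq₀ (norm_nonneg _) zero_le_one, hno]
    simp only [p, div_pow, hrr, hUU, one_pow, ← Finset.sum_div]
    exact div_self hU.ne'
  have hrd e (x : ℝ) : r e * (x / r e) = if r e = 0 then 0 else x := by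
    split_ifs with h
    · simp [h]
    · field_simp
  have hTp : T p = p := by
    ext e
    rw [hTz]
    have : ∑ f, C e f * (p f / r f) = d e / √U := by
      rw [hd, Finset.sum_div]
      refine Finset.sum_congr rfl fun f _ ↦ ?_
      by_cases h : r f = 0
      · simp [hsymm e f, hCd f e (hr0 h)]
      · simp only [p]; field_simp
    rw [this]
    by_cases h : r e = 0
    · simp [p, h]
    · simp only [p, ← hrr e]; field_simp
  have hTin (z : EuclideanSpace ℝ ι) :
      inner ℝ (T z) z = ∑ e, (z e / r e) * ∑ f, C e f * (z f / r f) := by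
    rw [hin]
    exact Finset.sum_congr rfl fun e _ ↦ by rw [hTz]; ring
  have hβ (z : EuclideanSpace ℝ ι) : inner ℝ β z = ∑ e, b e * (z e / r e) := by
    rw [hin]
    exact Finset.sum_congr rfl fun e _ ↦ by simp only [β]; ring
  have hsum (s : ℝ) (z : EuclideanSpace ℝ ι) e :
      (T z + s • β) e = (∑ f, C e f * (z f / r f) + s * b e) / r e := by
    rw [PiLp.add_apply, PiLp.smul_apply, hTz, smul_eq_mul]; simp only [β]; ring
  have key := hT.quadratic_le_inner_sq (b := β) (a := a) hp hTp (fun s z ↦ by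
    rw [hβ, hTin, hno]
    simp only [hsum, div_pow, hrr]
    exact hle s _) (fun z hz ↦ by
    rw [hTin, hno] at hz
    have hdir := sum_mul_sub_sq_eq hsymm (fun e ↦ z e / r e)
    have hdir0 : 0 ≤ ∑ e, ∑ f, C e f * (z e / r e - z f / r f) ^ 2 :=
      Finset.sum_nonneg fun e _ ↦ Finset.sum_nonneg fun f _ ↦ mul_nonneg (hC e f) (sq_nonneg _)
    change _ = 2 * (∑ e, d e * (z e / r e) ^ 2 - _) at hdir
    have hdz e : d e * (z e / r e) ^ 2 ≤ z e ^ 2 := by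
      rw [← hrr e, ← mul_pow, hrd]
      split_ifs
      · simpa using sq_nonneg (z e)
      · rfl
    have hdzs := Finset.sum_le_sum fun e (_ : e ∈ Finset.univ) ↦ hdz e
    obtain ⟨c, hc⟩ := exists_eq_const_of_dirichlet_nonpos hC hconn
      (y := fun e ↦ z e / r e) (by linarith)
    have heq := (Finset.sum_eq_sum_iff_of_le fun e (_ : e ∈ Finset.univ) ↦ hdz e).1
      (le_antisymm hdzs (by linarith))
    refine ⟨c * √U, ?_⟩
    ext e
    by_cases h : r e = 0
    · have := heq e (Finset.mem_univ _)
      rw [hr0 h, zero_mul] at this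
      simpa [p, h] using pow_eq_zero_iff two_ne_zero |>.1 this.symm
    · have hz' := hc e ((hd0 e).lt_of_ne' fun h' ↦ h (by rw [hr]; simp [h']))
      rw [div_eq_iff h] at hz'
      simp only [PiLp.smul_apply, p, hz', smul_eq_mul]
      field_simp) s (WithLp.toLp 2 fun e ↦ r e * y e)
  rw [hβ, hTin, hin] at key
  simp only [hsum] at key
  have hy e (x : ℝ) (hx : d e = 0 → x = 0) : x * (r e * y e / r e) = x * y e := by
    by_cases h : r e = 0
    · rw [hx (hr0 h)]; simp
    · field_simp
  have hCy e : ∑ f, C e f * (r f * y f / r f) = ∑ f, C e f * y f :=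
    Finset.sum_congr rfl fun f _ ↦ hy f _ fun h ↦ by rw [hsymm]; exact hCd f e h
  have hCy0 e (h : d e = 0) : ∑ f, C e f * y f = 0 :=
    Finset.sum_eq_zero fun f _ ↦ by rw [hCd e f h, zero_mul]
  simp only [hCy] at key
  rw [Finset.sum_congr rfl fun e _ ↦ hy e (b e) (hb e),
    Finset.sum_congr rfl fun e _ ↦ (mul_comm _ _).trans
      ((hy e (∑ f, C e f * y f) (hCy0 e)).trans (mul_comm _ _)),
    Finset.sum_congr rfl fun e _ ↦ show p e * ((∑ f, C e f * y f + s * b e) / r e) =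
      (∑ f, C e f * y f + s * b e) / √U by
      by_cases h : r e = 0
      · simp [hCy0 e (hr0 h), hb e (hr0 h)]
      · simp only [p]; field_simp, ← Finset.sum_div, div_pow, hUU, le_div_iff₀ hU] at key
  exact key

/-- The two matroid axioms on independent sets that remain vacuously valid for the empty family. -/
structure IsIndepFamily {ι : Type*} [DecidableEq ι] (P : Finset ι → Prop) : Prop where
  mono : ∀ ⦃I J⦄, P J → I ⊆ J → P I
  aug : ∀ ⦃I J⦄, P I → P J → I.card < J.card → ∃ e ∈ J, e ∉ I ∧ P (insert e I)

/-- Contraction of an element `e`; this is the empty family when `e` is a loop. -/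
def contractFamily {ι : Type*} [DecidableEq ι] (P : Finset ι → Prop) (e : ι)
    (I : Finset ι) : Prop :=
  e ∉ I ∧ P (insert e I)

open Classical in
/-- The number of members of `P` of cardinality `j` that contain `T`. -/
noncomputable def indepCount {ι : Type*} [DecidableEq ι] [Fintype ι] (P : Finset ι → Prop)
    (T : Finset ι) (j : ℕ) : ℝ :=
  (Finset.univ.filter fun I : Finset ι ↦ P I ∧ I.card = j ∧ T ⊆ I).card

/-- The number of members of `P` of cardinality `j` that contain the two distinct elements
`e` and `f`. -/
noncomputable def pairCount {ι : Type*} [DecidableEq ι] [Fintype ι] (P : Finset ι → Prop) (j : ℕ)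
    (e f : ι) : ℝ :=
  if e = f then 0 else indepCount P {e, f} j

section IndepFamily

variable {ι : Type*} [DecidableEq ι] {P : Finset ι → Prop}

theorem IsIndepFamily.contract (hP : IsIndepFamily P) (e : ι) :
    IsIndepFamily (contractFamily P e) where
  mono I J hJ hIJ := ⟨fun h ↦ hJ.1 (hIJ h), hP.mono hJ.2 (Finset.insert_subset_insert e hIJ)⟩
  aug I J hI hJ hlt := by
    obtain ⟨x, hxJ, hxI, hx⟩ := hP.aug hI.2 hJ.2 (by
      rw [Finset.card_insert_of_notMem hI.1, Finset.card_insert_of_notMem hJ.1]; omega)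
    rw [Finset.mem_insert, not_or] at hxI
    refine ⟨x, (Finset.mem_insert.1 hxJ).resolve_left hxI.1, hxI.2, ?_, ?_⟩
    · rw [Finset.mem_insert, not_or]
      exact ⟨Ne.symm hxI.1, hI.1⟩
    · rwa [Finset.insert_comm]

theorem IsIndepFamily.exists_superset (hP : IsIndepFamily P) {T J : Finset ι} (hT : P T)
    (hJ : P J) (h : T.card ≤ J.card) : ∃ I, P I ∧ I.card = J.card ∧ T ⊆ I := by
  induction hn : J.card - T.card generalizing T with
  | zero => exact ⟨T, hT, by omega, subset_rfl⟩
  | succ n ih =>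
    obtain ⟨e, -, he, hPe⟩ := hP.aug hT hJ (by omega)
    have hc := Finset.card_insert_of_notMem he
    obtain ⟨I, hI, hIJ, hTI⟩ := ih hPe (by omega) (by omega)
    exact ⟨I, hI, hIJ, (Finset.subset_insert e T).trans hTI⟩

theorem IsIndepFamily.pair_or_pair (hP : IsIndepFamily P) {e f g : ι}
    (heg : e ≠ g ∧ P {e, g}) (hf : P {f}) : (e ≠ f ∧ P {e, f}) ∨ (f ≠ g ∧ P {f, g}) := by
  obtain ⟨x, hx, hxf, h⟩ := hP.aug hf heg.2 (by
    rw [Finset.card_singleton, Finset.card_pair heg.1]; norm_num)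
  rw [Finset.mem_singleton] at hxf
  rcases Finset.mem_insert.1 hx with rfl | hx
  · exact Or.inl ⟨hxf, h⟩
  · rw [Finset.mem_singleton] at hx
    subst hx
    exact Or.inr ⟨Ne.symm hxf, by rwa [Finset.pair_comm]⟩

variable [Fintype ι]

theorem indepCount_nonneg (T : Finset ι) (j : ℕ) : 0 ≤ indepCount P T j := Nat.cast_nonneg _

theorem indepCount_pos_iff {T : Finset ι} {j : ℕ} :
    0 < indepCount P T j ↔ ∃ I, P I ∧ I.card = j ∧ T ⊆ I := by
  simp [indepCount, Finset.card_pos, Finset.Nonempty]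

theorem IsIndepFamily.indepCount_pos (hP : IsIndepFamily P) {T J : Finset ι} {j : ℕ} (hT : P T)
    (hJ : P J) (hj : J.card = j) (h : T.card ≤ j) : 0 < indepCount P T j := by
  subst hj
  exact indepCount_pos_iff.2 (hP.exists_superset hT hJ h)

theorem IsIndepFamily.indepCount_eq_zero (hP : IsIndepFamily P) {T : Finset ι} (hT : ¬ P T)
    (j : ℕ) : indepCount P T j = 0 := by
  refine le_antisymm (not_lt.1 fun h ↦ ?_) (indepCount_nonneg T j)
  obtain ⟨I, hI, -, hTI⟩ := indepCount_pos_iff.1 h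
  exact hT (hP.mono hI hTI)

open Classical in
theorem IsIndepFamily.indepCount_card (hP : IsIndepFamily P) (T : Finset ι) :
    indepCount P T T.card = if P T then 1 else 0 := by
  split_ifs with h
  · rw [indepCount, Nat.cast_eq_one, Finset.card_eq_one]
    refine ⟨T, ?_⟩
    ext I
    simp only [Finset.mem_filter, Finset.mem_univ, true_and, Finset.mem_singleton]
    constructor
    · rintro ⟨-, hc, hT⟩
      exact (Finset.eq_of_subset_of_card_le hT hc.le).symm
    · rintro rfl
      exact ⟨h, rfl, subset_rfl⟩
  · exact hP.indepCount_eq_zero h _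

/-- Double counting of the pairs `(I, e)` with `e ∈ I \ T`. -/
theorem sum_indepCount_insert (T : Finset ι) (j : ℕ) :
    ∑ e, (if e ∈ T then 0 else indepCount P (insert e T) j) =
      ((j : ℝ) - T.card) * indepCount P T j := by
  classical
  set F := Finset.univ.filter fun I : Finset ι ↦ P I ∧ I.card = j ∧ T ⊆ I with hF
  have h1 e : (if e ∈ T then 0 else indepCount P (insert e T) j) =
      ∑ I ∈ F, if e ∈ I \ T then (1 : ℝ) else 0 := by
    split_ifs with he
    · simp [he]
    · rw [Finset.sum_boole, indepCount, hF, Finset.filter_filter]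
      congr 3
      ext I
      simp only [Finset.insert_subset_iff, Finset.mem_sdiff, he]
      tauto
  rw [Finset.sum_congr rfl fun e _ ↦ h1 e, Finset.sum_comm]
  have h2 : ∀ I ∈ F, ∑ e, (if e ∈ I \ T then (1 : ℝ) else 0) = (j : ℝ) - T.card := by
    intro I hI
    obtain ⟨-, -, hc, hT⟩ := Finset.mem_filter.1 hI
    rw [Finset.sum_boole, Finset.filter_univ_mem, Finset.card_sdiff_of_subset hT,
      Nat.cast_sub (Finset.card_le_card hT), hc]
  rw [Finset.sum_congr rfl h2, Finset.sum_const, nsmul_eq_mul, mul_comm]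
  rfl

theorem indepCount_contractFamily (e : ι) (T : Finset ι) (j : ℕ) :
    indepCount (contractFamily P e) T j =
      if e ∈ T then 0 else indepCount P (insert e T) (j + 1) := by
  classical
  split_ifs with he
  · refine le_antisymm (not_lt.1 fun h ↦ ?_) (indepCount_nonneg T j)
    obtain ⟨I, hI, -, hTI⟩ := indepCount_pos_iff.1 h
    exact hI.1 (hTI he)
  · rw [indepCount, indepCount, Nat.cast_inj]
    refine Finset.card_bij' (fun I _ ↦ insert e I) (fun I _ ↦ I.erase e) ?_ ?_ ?_ ?_
    · intro I hI
      obtain ⟨-, ⟨heI, hI⟩, hc, hT⟩ := Finset.mem_filter.1 hI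
      exact Finset.mem_filter.2 ⟨Finset.mem_univ _, hI,
        by rw [Finset.card_insert_of_notMem heI, hc], Finset.insert_subset_insert e hT⟩
    · intro I hI
      obtain ⟨-, hI, hc, hT⟩ := Finset.mem_filter.1 hI
      rw [Finset.insert_subset_iff] at hT
      refine Finset.mem_filter.2 ⟨Finset.mem_univ _, ⟨Finset.notMem_erase e I, ?_⟩, ?_, ?_⟩
      · rwa [Finset.insert_erase hT.1]
      · rw [Finset.card_erase_of_mem hT.1, hc, Nat.add_sub_cancel]
      · exact Finset.subset_erase.2 ⟨hT.2, he⟩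
    · intro I hI
      exact Finset.erase_insert (Finset.mem_filter.1 hI).2.1.1
    · intro I hI
      exact Finset.insert_erase ((Finset.insert_subset_iff.1 (Finset.mem_filter.1 hI).2.2.2).1)

theorem sum_indepCount_contractFamily (T : Finset ι) (j : ℕ) :
    ∑ e, indepCount (contractFamily P e) T j =
      ((j : ℝ) + 1 - T.card) * indepCount P T (j + 1) := by
  rw [Finset.sum_congr rfl fun e _ ↦ indepCount_contractFamily e T j, sum_indepCount_insert]
  push_cast
  rfl

theorem pairCount_comm (j : ℕ) (e f : ι) : pairCount P j e f = pairCount P j f e := by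
  rw [pairCount, pairCount, Finset.pair_comm e f]
  simp only [eq_comm]

theorem pairCount_nonneg (j : ℕ) (e f : ι) : 0 ≤ pairCount P j e f := by
  unfold pairCount
  split_ifs
  exacts [le_rfl, indepCount_nonneg _ _]

theorem IsIndepFamily.pairCount_pos_iff (hP : IsIndepFamily P) {j : ℕ} {J : Finset ι} (hJ : P J)
    (hj : J.card = j) (h2 : 2 ≤ j) {e f : ι} :
    0 < pairCount P j e f ↔ e ≠ f ∧ P {e, f} := by
  unfold pairCount
  split_ifs with h
  · simp [h]
  · refine ⟨fun h' ↦ ⟨h, by_contra fun hn ↦ ?_⟩, fun h' ↦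
      hP.indepCount_pos h'.2 hJ hj (Finset.card_le_two.trans h2)⟩
    rw [hP.indepCount_eq_zero hn] at h'
    exact h'.false

theorem sum_pairCount (j : ℕ) (e : ι) :
    ∑ f, pairCount P j e f = ((j : ℝ) - 1) * indepCount P {e} j := by
  have := sum_indepCount_insert (P := P) {e} j
  rw [Finset.card_singleton, Nat.cast_one] at this
  rw [← this]
  refine Finset.sum_congr rfl fun f _ ↦ ?_
  rw [pairCount_comm]
  simp only [pairCount, Finset.mem_singleton]

theorem pairCount_contractFamily_sum_left (j : ℕ) (e g : ι) :
    ∑ f, pairCount (contractFamily P e) j f g = ((j : ℝ) - 1) * pairCount P (j + 1) e g := by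
  rw [Finset.sum_congr rfl fun f _ ↦ pairCount_comm j f g, sum_pairCount,
    indepCount_contractFamily]
  simp [pairCount]

theorem pairCount_contractFamily_sum (j : ℕ) (f g : ι) :
    ∑ e, pairCount (contractFamily P e) j f g = ((j : ℝ) - 1) * pairCount P (j + 1) f g := by
  unfold pairCount
  split_ifs with h
  · simp
  · rw [sum_indepCount_contractFamily, Finset.card_pair h]
    push_cast
    ring

theorem sum_indepCount_singleton_contractFamily (j : ℕ) (e : ι) :
    ∑ f, indepCount (contractFamily P e) {f} j = j * indepCount P {e} (j + 1) := by
  have := sum_indepCount_insert (P := contractFamily P e) ∅ j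
  simpa [indepCount_contractFamily] using this

end IndepFamily

/-- For the `0`-`1` matrix `R` of a partial equivalence relation with domain indicator `l`, the
bordered form of the complementary complete multipartite graph is bounded by the weighted norm of
its gradient. -/
theorem sq_sub_sum_le_of_partialEquiv {ι : Type*} [Fintype ι] {R : ι → ι → ℝ} {l : ι → ℝ}
    (hl : ∀ e, l e = 0 ∨ l e = 1) (hR : ∀ e f, R e f = 0 ∨ R e f = 1)
    (hsymm : ∀ e f, R e f = R f e) (htrans : ∀ e f, R e f = 1 → ∀ g, R e g = R f g)
    (hrefl : ∀ e, l e = 1 → R e e = 1) (hloop : ∀ e, l e = 0 → ∀ f, R e f = 0)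
    (hn : 0 < ∑ e, l e) (hpos : ∀ e, l e = 1 → ∑ f, R e f < ∑ f, l f) (t : ℝ) (y : ι → ℝ) :
    t ^ 2 - ∑ e, y e * ∑ f, R e f * y f ≤
      ∑ e, (l e * t - ∑ f, R e f * y f) ^ 2 / (l e * ∑ f, l f - ∑ f, R e f) := by
  set n := ∑ e, l e
  set k : ι → ℝ := fun e ↦ ∑ f, R e f with hk
  set Y : ι → ℝ := fun e ↦ ∑ f, R e f * y f with hY
  have hk0 e (h : l e = 1) : 0 < k e := by
    have h1 : R e e ≤ k e := Finset.single_le_sum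
      (fun f _ ↦ by rcases hR e f with h | h <;> simp [h]) (Finset.mem_univ e)
    rw [hrefl e h] at h1
    linarith
  have hY0 e (h : l e = 0) : Y e = 0 := Finset.sum_eq_zero fun f _ ↦ by rw [hloop e h, zero_mul]
  have hmul e f (F : ι → ℝ) (hF : R e f = 1 → F e = F f) : R e f * F e = R e f * F f := by
    rcases hR e f with h | h
    · simp [h]
    · rw [hF h]
  have h1 : ∑ e, Y e ^ 2 / k e = ∑ e, y e * Y e := by
    have h e : Y e ^ 2 / k e = ∑ f, R e f * (Y f / k f) * y f := by
      rw [sq, mul_div_assoc, hY, Finset.sum_mul]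
      refine Finset.sum_congr rfl fun f _ ↦ ?_
      rw [← hmul e f (fun e ↦ Y e / k e) fun h ↦ by simp only [hY, hk, htrans e f h]]
      ring
    rw [Finset.sum_congr rfl fun e _ ↦ h e, Finset.sum_comm]
    refine Finset.sum_congr rfl fun f _ ↦ ?_
    rw [← Finset.sum_mul, ← Finset.sum_mul, Finset.sum_congr rfl fun e _ ↦ hsymm e f]
    change k f * (Y f / k f) * y f = _
    rcases hl f with h | h
    · simp [hY0 f h]
    · have := (hk0 f h).ne'
      field_simp
  have h2 e : l e * (t ^ 2 / n) ≤ (l e * t - Y e) ^ 2 / (l e * n - k e) + Y e ^ 2 / k e := by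
    rcases hl e with h | h
    · simp [h, hY0 e h]
    · have hke := hk0 e h
      have hke' : 0 < n - k e := sub_pos.2 (hpos e h)
      rw [h, one_mul, one_mul, one_mul, div_add_div _ _ hke'.ne' hke.ne',
        div_le_div_iff₀ hn (mul_pos hke' hke)]
      nlinarith [sq_nonneg (k e * t - n * Y e)]
  have h3 := Finset.sum_le_sum fun e (_ : e ∈ Finset.univ) ↦ h2 e
  rw [← Finset.sum_mul, Finset.sum_add_distrib, h1, mul_div_cancel₀ _ hn.ne'] at h3
  exact sub_le_iff_le_add.2 h3

section IndepForm

variable {ι : Type*} [DecidableEq ι] [Fintype ι] {P : Finset ι → Prop}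

/-- The second-order form, evaluated at `(s, y)`, of the polynomial whose coefficients record the
members of `P` of cardinality at most `m + 2`. -/
noncomputable def indepForm (P : Finset ι → Prop) (m : ℕ) (s : ℝ) (y : ι → ℝ) : ℝ :=
  s ^ 2 * indepCount P ∅ m + 2 * s * ∑ e, indepCount P {e} (m + 1) * y e +
    ∑ e, y e * ∑ f, pairCount P (m + 2) e f * y f

/-- Half the partial derivative of `indepForm` in the direction of `e`. -/
noncomputable def indepGrad (P : Finset ι → Prop) (m : ℕ) (s : ℝ) (y : ι → ℝ) (e : ι) : ℝ :=
  ∑ f, pairCount P (m + 2) e f * y f + s * indepCount P {e} (m + 1)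

theorem IsIndepFamily.of_sum_pairCount_pos (hP : IsIndepFamily P) {j : ℕ} {e : ι}
    (h : 0 < ∑ f, pairCount P j e f) : P {e} := by
  by_contra hn
  rw [sum_pairCount, hP.indepCount_eq_zero hn, mul_zero] at h
  exact h.false

theorem IsIndepFamily.sum_pairCount_pos (hP : IsIndepFamily P) {j : ℕ} {J : Finset ι} (hJ : P J)
    (hj : J.card = j) (h2 : 2 ≤ j) {e : ι} (he : P {e}) : 0 < ∑ f, pairCount P j e f := by
  rw [sum_pairCount]
  refine mul_pos ?_ (hP.indepCount_pos he hJ hj (by rw [Finset.card_singleton]; omega))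
  have : (2 : ℝ) ≤ j := by exact_mod_cast h2
  linarith

theorem IsIndepFamily.indepForm_mul_le_sq_of_le (hP : IsIndepFamily P) {m : ℕ} {J : Finset ι}
    (hJ : P J) (hm : J.card = m + 2)
    (h : ∀ s y, indepForm P m s y ≤
      ∑ e, indepGrad P m s y e ^ 2 / ∑ f, pairCount P (m + 2) e f) (s : ℝ) (y : ι → ℝ) :
    indepForm P m s y * ∑ e, ∑ f, pairCount P (m + 2) e f ≤ (∑ e, indepGrad P m s y e) ^ 2 := by
  have h2 : 2 ≤ m + 2 := by omega
  refine quadratic_mul_sum_le_sq (pairCount_comm _) (pairCount_nonneg _) (fun e he ↦ ?_)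
    (fun e f g heg hf ↦ ?_) h s y
  · exact hP.indepCount_eq_zero (fun hPe ↦ (hP.sum_pairCount_pos hJ hm h2 hPe).ne' he) _
  · simp only [hP.pairCount_pos_iff hJ hm h2] at heg ⊢
    exact hP.pair_or_pair heg (hP.of_sum_pairCount_pos hf)

theorem IsIndepFamily.indepForm_zero_le (hP : IsIndepFamily P) {J : Finset ι}
    (hJ : P J) (hm : J.card = 2) (s : ℝ) (y : ι → ℝ) :
    indepForm P 0 s y ≤ ∑ e, indepGrad P 0 s y e ^ 2 / ∑ f, pairCount P 2 e f := by
  classical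
  set l : ι → ℝ := fun e ↦ if P {e} then 1 else 0 with hl
  have hl1 e : indepCount P {e} 1 = l e := hP.indepCount_card {e}
  have hC e f : pairCount P 2 e f = if e ≠ f ∧ P {e, f} then 1 else 0 := by
    by_cases h : e = f
    · simp [h, pairCount]
    · have := hP.indepCount_card {e, f}
      rw [Finset.card_pair h] at this
      simp [pairCount, h, this]
  have ha : indepCount P ∅ 0 = 1 := by
    have := hP.indepCount_card ∅
    rwa [Finset.card_empty, if_pos (hP.mono hJ (Finset.empty_subset J))] at this
  have hPl {e f} (h : P {e, f}) : P {e} := hP.mono h (by simp)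
  have hPr {e f} (h : P {e, f}) : P {f} := hP.mono h (by simp)
  set R : ι → ι → ℝ := fun e f ↦ l e * l f - pairCount P 2 e f with hRdef
  have hR e f : R e f = if P {e} ∧ P {f} ∧ ¬ (e ≠ f ∧ P {e, f}) then 1 else 0 := by
    simp only [hRdef, hC, hl]
    by_cases h : e ≠ f ∧ P {e, f}
    · simp [h, hPl h.2, hPr h.2]
    · by_cases he : P {e} <;> by_cases hf : P {f} <;> simp [h, he, hf]
  have hRs (e : ι) : l e * ∑ f, l f - ∑ f, R e f = ∑ f, pairCount P 2 e f := by
    simp only [hRdef, Finset.sum_sub_distrib, Finset.mul_sum, sub_sub_cancel]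
  have hRy (e : ι) : ∑ f, R e f * y f =
      l e * ∑ f, l f * y f - ∑ f, pairCount P 2 e f * y f := by
    simp only [hRdef, Finset.mul_sum, ← Finset.sum_sub_distrib]
    exact Finset.sum_congr rfl fun f _ ↦ by ring
  have hl0 e : l e = 0 ↔ ¬ P {e} := by simp [hl]
  have hl1' e : l e = 1 ↔ P {e} := by simp [hl]
  have hpos e (he : l e = 1) : ∑ f, R e f < ∑ f, l f := by
    have h1 := hP.sum_pairCount_pos hJ hm le_rfl ((hl1' e).1 he)
    have h2 := hRs e
    rw [he, one_mul] at h2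
    linarith
  have hn : 0 < ∑ e, l e := by
    obtain ⟨e, he⟩ := Finset.card_pos.1 (hm.symm ▸ two_pos : 0 < J.card)
    have he1 := (hl1' e).2 (hP.mono hJ (Finset.singleton_subset_iff.2 he))
    have h1 : l e ≤ ∑ e, l e := Finset.single_le_sum
      (fun f _ ↦ by simp only [hl]; split_ifs <;> norm_num) (Finset.mem_univ e)
    linarith
  have hR1 e f : R e f = 1 ↔ P {e} ∧ P {f} ∧ ¬ (e ≠ f ∧ P {e, f}) := by simp [hR]
  have hmain := sq_sub_sum_le_of_partialEquiv (R := R) (l := l)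
    (fun e ↦ by by_cases h : P {e} <;> simp [hl, h])
    (fun e f ↦ by rw [hR]; split_ifs <;> simp)
    (fun e f ↦ by simp only [hRdef, mul_comm (l e), pairCount_comm 2 e f])
    (fun e f hef g ↦ by
      obtain ⟨he, hf, hef⟩ := (hR1 e f).1 hef
      have h1 : (e ≠ g ∧ P {e, g}) → (f ≠ g ∧ P {f, g}) := fun h ↦
        (hP.pair_or_pair h hf).resolve_left hef
      have h2 : (f ≠ g ∧ P {f, g}) → (e ≠ g ∧ P {e, g}) := fun h ↦
        (hP.pair_or_pair h he).resolve_left fun h' ↦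
          hef ⟨h'.1.symm, by rw [Finset.pair_comm]; exact h'.2⟩
      rw [hR, hR]
      simp only [he, hf, true_and, Iff.intro h1 h2])
    (fun e he ↦ (hR1 e e).2 ⟨(hl1' e).1 he, (hl1' e).1 he, fun h ↦ h.1 rfl⟩)
    (fun e he f ↦ by rw [hR, if_neg fun h ↦ (hl0 e).1 he h.1])
    hn hpos (s + ∑ e, l e * y e) y
  have hform : indepForm P 0 s y =
      (s + ∑ e, l e * y e) ^ 2 - ∑ e, y e * ∑ f, R e f * y f := by
    have h1 : ∑ e, y e * ∑ f, R e f * y f =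
        (∑ e, l e * y e) ^ 2 - ∑ e, y e * ∑ f, pairCount P 2 e f * y f := by
      simp only [hRy, mul_sub, Finset.sum_sub_distrib]
      congr 1
      rw [sq, Finset.sum_mul]
      exact Finset.sum_congr rfl fun e _ ↦ by ring
    simp only [indepForm, ha, zero_add, hl1, h1]
    ring
  rw [hform]
  refine hmain.trans_eq (Finset.sum_congr rfl fun e _ ↦ ?_)
  rw [hRs, hRy]
  simp only [indepGrad, zero_add, hl1]
  congr 2
  ring

theorem IsIndepFamily.indepForm_succ_le (hP : IsIndepFamily P) {m : ℕ} {J : Finset ι}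
    (hJ : P J) (hm : J.card = m + 3)
    (h : ∀ e, P {e} → ∀ s y, indepForm (contractFamily P e) m s y *
      ∑ f, ∑ g, pairCount (contractFamily P e) (m + 2) f g ≤
        (∑ f, indepGrad (contractFamily P e) m s y f) ^ 2) (s : ℝ) (y : ι → ℝ) :
    indepForm P (m + 1) s y ≤
      ∑ e, indepGrad P (m + 1) s y e ^ 2 / ∑ f, pairCount P (m + 3) e f := by
  have hm0 : (0 : ℝ) < m + 1 := by positivity
  have hform : ∑ e, indepForm (contractFamily P e) m s y = (m + 1) * indepForm P (m + 1) s y := by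
    have h1 : ∑ e, ∑ f, indepCount (contractFamily P e) {f} (m + 1) * y f =
        (m + 1) * ∑ f, indepCount P {f} (m + 2) * y f := by
      rw [Finset.sum_comm, Finset.mul_sum]
      refine Finset.sum_congr rfl fun f _ ↦ ?_
      rw [← Finset.sum_mul, sum_indepCount_contractFamily, Finset.card_singleton]
      push_cast
      ring
    have h2 : ∑ e, ∑ f, y f * ∑ g, pairCount (contractFamily P e) (m + 2) f g * y g =
        (m + 1) * ∑ f, y f * ∑ g, pairCount P (m + 3) f g * y g := by
      rw [Finset.sum_comm, Finset.mul_sum]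
      refine Finset.sum_congr rfl fun f _ ↦ ?_
      rw [← Finset.mul_sum, Finset.sum_comm, mul_left_comm]
      congr 1
      rw [Finset.mul_sum]
      refine Finset.sum_congr rfl fun g _ ↦ ?_
      rw [← Finset.sum_mul, pairCount_contractFamily_sum]
      push_cast
      ring
    simp only [indepForm]
    rw [Finset.sum_add_distrib, Finset.sum_add_distrib, ← Finset.mul_sum, ← Finset.mul_sum, h1, h2,
      sum_indepCount_contractFamily, Finset.card_empty]
    push_cast
    ring
  have hgrad (e : ι) : ∑ f, indepGrad (contractFamily P e) m s y f =
      (m + 1) * indepGrad P (m + 1) s y e := by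
    simp only [indepGrad]
    rw [Finset.sum_add_distrib, Finset.sum_comm, ← Finset.mul_sum,
      sum_indepCount_singleton_contractFamily, mul_add, Finset.mul_sum]
    congr 1
    · refine Finset.sum_congr rfl fun g _ ↦ ?_
      rw [← Finset.sum_mul, pairCount_contractFamily_sum_left]
      push_cast
      ring
    · push_cast
      ring
  have hdeg (e : ι) : ∑ f, ∑ g, pairCount (contractFamily P e) (m + 2) f g =
      (m + 1) * ∑ g, pairCount P (m + 3) e g := by
    rw [Finset.sum_comm, Finset.mul_sum]
    refine Finset.sum_congr rfl fun g _ ↦ ?_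
    rw [pairCount_contractFamily_sum_left]
    push_cast
    ring
  have hle e : indepForm (contractFamily P e) m s y ≤
      (m + 1) * (indepGrad P (m + 1) s y e ^ 2 / ∑ f, pairCount P (m + 3) e f) := by
    by_cases he : P {e}
    · have h1 := h e he s y
      have h2 := hP.sum_pairCount_pos hJ hm (by omega) he
      rw [hgrad, hdeg, ← le_div_iff₀ (mul_pos hm0 h2)] at h1
      refine h1.trans_eq ?_
      field_simp
    · have hzero T j : indepCount (contractFamily P e) T j = 0 := by
        rw [indepCount_contractFamily, hP.indepCount_eq_zero, ite_self]
        exact fun h ↦ he (hP.mono h (by simp))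
      have h2 : 0 ≤ ∑ f, pairCount P (m + 3) e f :=
        Finset.sum_nonneg fun f _ ↦ pairCount_nonneg _ _ _
      have h3 : indepForm (contractFamily P e) m s y = 0 := by
        simp [indepForm, pairCount, hzero]
      rw [h3]
      positivity
  have hsum := Finset.sum_le_sum fun e (_ : e ∈ Finset.univ) ↦ hle e
  rw [hform, ← Finset.mul_sum] at hsum
  exact le_of_mul_le_mul_left hsum hm0

theorem IsIndepFamily.indepForm_mul_le_sq (hP : IsIndepFamily P) {m : ℕ} {J : Finset ι}
    (hJ : P J) (hm : J.card = m + 2) (s : ℝ) (y : ι → ℝ) :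
    indepForm P m s y * ∑ e, ∑ f, pairCount P (m + 2) e f ≤ (∑ e, indepGrad P m s y e) ^ 2 := by
  induction m generalizing P J s y with
  | zero => exact hP.indepForm_mul_le_sq_of_le hJ hm (hP.indepForm_zero_le hJ hm) s y
  | succ m ih =>
    refine hP.indepForm_mul_le_sq_of_le hJ hm (hP.indepForm_succ_le hJ hm fun e he ↦ ?_) s y
    obtain ⟨I, hI, hIJ, heI⟩ := hP.exists_superset he hJ (by rw [Finset.card_singleton]; omega)
    rw [Finset.singleton_subset_iff] at heI
    refine ih (hP.contract e) (J := I.erase e) ⟨Finset.notMem_erase e I, ?_⟩ ?_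
    · rwa [Finset.insert_erase heI]
    · rw [Finset.card_erase_of_mem heI]; omega

theorem IsIndepFamily.indepCount_mul_le_sq (hP : IsIndepFamily P) (m : ℕ) :
    indepCount P ∅ m * indepCount P ∅ (m + 2) ≤ indepCount P ∅ (m + 1) ^ 2 := by
  rcases (indepCount_nonneg (P := P) ∅ (m + 2)).eq_or_lt with h0 | h0
  · rw [← h0, mul_zero]
    exact sq_nonneg _
  obtain ⟨J, hJ, hm, -⟩ := indepCount_pos_iff.1 h0
  have h := hP.indepForm_mul_le_sq hJ hm 1 0
  have hs (j : ℕ) : ∑ e, indepCount P {e} j = j * indepCount P ∅ j := by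
    simpa using sum_indepCount_insert (P := P) ∅ j
  simp only [indepForm, indepGrad, Pi.zero_apply, mul_zero, Finset.sum_const_zero, one_pow, one_mul,
    add_zero, zero_add, sum_pairCount, ← Finset.mul_sum, hs] at h
  push_cast at h
  have hm0 : (0 : ℝ) ≤ m := Nat.cast_nonneg m
  have hx := mul_nonneg (indepCount_nonneg (P := P) ∅ m) h0.le
  have h' : (m + 1 : ℝ) ^ 2 * (indepCount P ∅ m * indepCount P ∅ (m + 2)) ≤
      (m + 1) ^ 2 * indepCount P ∅ (m + 1) ^ 2 := by
    nlinarith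
  exact le_of_mul_le_mul_left h' (by positivity)

end IndepForm

/-- Mason's conjecture, proved by Lenz / Adiprasito–Huh–Katz: for a matroid
`M` on a finite ground set, the sequence `f_i(M)` of numbers of independent sets of
cardinality `i` is log-concave: `f_i(M)^2 ≥ f_{i−1}(M) ⬝ f_{i+1}(M)` for all `i ≥ 1`. -/
theorem matroid_independent_sets_log_concave {α : Type*} (M : Matroid α)
    (hfin : M.E.Finite)
    (f : ℕ → ℕ)
    (hf : ∀ i, f i = Set.ncard {I : Set α | M.Indep I ∧ I.ncard = i}) :
    ∀ i, 1 ≤ i → f (i - 1) * f (i + 1) ≤ f i * f i := by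
  classical
  have : Fintype M.E := hfin.fintype
  let φ : Finset M.E → Set α := fun I ↦ Subtype.val '' (I : Set M.E)
  have hφ (I : Finset M.E) : (φ I).ncard = I.card := by
    rw [Set.ncard_image_of_injective _ Subtype.val_injective, Set.ncard_coe_finset]
  have hφinj : Function.Injective φ := fun I J h ↦
    Finset.coe_injective (Subtype.val_injective.image_injective h)
  let P : Finset M.E → Prop := fun I ↦ M.Indep (φ I)
  have hP : IsIndepFamily P := by
    refine ⟨fun I J hJ hIJ ↦ hJ.subset (Set.image_mono (by exact_mod_cast hIJ)),
      fun I J hI hJ hlt ↦ ?_⟩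
    obtain ⟨x, hx, h⟩ := hI.augment hJ (by
      rw [← (hfin.subset hI.subset_ground).cast_ncard_eq,
        ← (hfin.subset hJ.subset_ground).cast_ncard_eq, hφ, hφ]
      exact_mod_cast hlt)
    obtain ⟨⟨e, heJ, rfl⟩, heI⟩ := hx
    refine ⟨e, heJ, fun h ↦ heI ⟨e, h, rfl⟩, ?_⟩
    simpa [P, φ, Set.image_insert_eq] using h
  have hcount (j : ℕ) : indepCount P ∅ j = f j := by
    rw [hf, indepCount, Nat.cast_inj, ← Set.ncard_coe_finset,
      ← Set.ncard_image_of_injective _ hφinj]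
    congr 1
    ext I
    simp only [Set.mem_image, Finset.mem_coe, Finset.mem_filter, Finset.mem_univ, true_and,
      Finset.empty_subset, and_true, Set.mem_ofPred_eq]
    constructor
    · rintro ⟨K, ⟨hK, rfl⟩, rfl⟩
      exact ⟨hK, hφ K⟩
    · rintro ⟨hI, rfl⟩
      have hK : φ (Finset.univ.filter fun e : M.E ↦ (e : α) ∈ I) = I := by
        ext x
        simpa [φ] using fun hx ↦ hI.subset_ground hx
      exact ⟨_, ⟨by simpa only [P, hK] using hI, by rw [← hφ, hK]⟩, hK⟩
  intro i hi
  obtain ⟨m, rfl⟩ := Nat.exists_eq_add_of_le' hi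
  have := hP.indepCount_mul_le_sq m
  rw [hcount, hcount, hcount, sq] at this
  exact_mod_cast this
end
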